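/- For every graded left R^Λ(β)-module M (regarded as a graded R(β)-module via the projection R(β) → R^Λ(β)) there is a short exact sequence of graded R(β+α_i)-modules 0 → q^{(α_i, 2Λ−β)} F̄_i M → F_i M → F_i^Λ M → 0, functorial in M, where (α_i, 2Λ−β) := 2 d_i ⟨h_i,Λ⟩ − (α_i, β), F_i^Λ M is regarded as an R(β+α_i)-module via the projection R(β+α_i) → R^Λ(β+α_i), and the map F_i M → F_i^Λ M is the one induced by this projection. -/

import Mathlib

/- ## Scaffold: Khovanov–Lauda–Rouquier algebras -/

open scoped TensorProduct

/-- A symmetrizable Cartan datum together with the structure constants of the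
family of polynomials `Q`. -/
structure CartanDatum (k : Type) [Field k] (I : Type) [Fintype I] [DecidableEq I] : Type where
  a : I → I → ℤ
  d : I → ℤ
  t : I → I → ℕ → ℕ → k
  a_diag : ∀ i, a i i = 2
  a_nonpos : ∀ i j, i ≠ j → a i j ≤ 0
  a_zero_iff : ∀ i j, a i j = 0 ↔ a j i = 0
  d_pos : ∀ i, 0 < d i
  symmetrize : ∀ i j, d i * a i j = d j * a j i
  t_symm : ∀ i j p q, t i j p q = t j i q p
  t_lead : ∀ i j, i ≠ j → t i j (-(a i j)).toNat 0 ≠ 0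

namespace KLR

variable {k : Type} [Field k] {I : Type} [Fintype I] [DecidableEq I]

/-- The symmetric bilinear form `(α_i, α_j) = d_i a_{ij}`. -/
def B (C : CartanDatum k I) (i j : I) : ℤ := C.d i * C.a i j

/-- Generators of the KLR algebra `R(n)`. -/
inductive Gen (I : Type) (n : ℕ) : Type
  | e (ν : Fin n → I) : Gen I n
  | x (a : Fin n) : Gen I n
  | tau (l : ℕ) (h : l + 1 < n) : Gen I n

variable (k) in
/-- The free algebra on the generators. -/
abbrev FA (I : Type) (n : ℕ) : Type := FreeAlgebra k (Gen I n)

variable (k) in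
def ge {n : ℕ} (ν : Fin n → I) : FA k I n := FreeAlgebra.ι k (Gen.e ν)

variable (k) in
def gx {n : ℕ} (a : Fin n) : FA k I n := FreeAlgebra.ι k (Gen.x a)

variable (k) in
def gt {n : ℕ} (l : ℕ) (h : l + 1 < n) : FA k I n := FreeAlgebra.ι k (Gen.tau l h)

/-- The polynomial `Q_{ij}(u,v)` evaluated on two elements of an algebra. -/
def Qel (C : CartanDatum k I) {A : Type} [Ring A] [Algebra k A] (i j : I) (u v : A) : A :=
  if i = j then 0 else
    ∑ p ∈ Finset.range ((-(C.a i j)).toNat + 1), ∑ q ∈ Finset.range ((-(C.a j i)).toNat + 1),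
      if C.d i * (p : ℤ) + C.d j * (q : ℤ) = -(C.d i * C.a i j) then
        C.t i j p q • (u ^ p * v ^ q) else 0

/-- The divided difference `(Q_{ij}(u,v) - Q_{ij}(w,v))/(u - w)` evaluated on elements. -/
def Qdiff (C : CartanDatum k I) {A : Type} [Ring A] [Algebra k A] (i j : I) (u v w : A) : A :=
  if i = j then 0 else
    ∑ p ∈ Finset.range ((-(C.a i j)).toNat + 1), ∑ q ∈ Finset.range ((-(C.a j i)).toNat + 1),
      if C.d i * (p : ℤ) + C.d j * (q : ℤ) = -(C.d i * C.a i j) then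
        C.t i j p q • ((∑ c ∈ Finset.range p, u ^ c * w ^ (p - 1 - c)) * v ^ q) else 0

/-- The defining relations of the KLR algebra `R(n)`. -/
inductive Rel (C : CartanDatum k I) (n : ℕ) : FA k I n → FA k I n → Prop
  | ee : ∀ ν ν' : Fin n → I, Rel C n (ge k ν * ge k ν') (if ν = ν' then ge k ν else 0)
  | esum : Rel C n (∑ ν : Fin n → I, ge k ν) 1
  | xx : ∀ a b : Fin n, Rel C n (gx k a * gx k b) (gx k b * gx k a)
  | xe : ∀ (a : Fin n) (ν : Fin n → I), Rel C n (gx k a * ge k ν) (ge k ν * gx k a)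
  | taue : ∀ (l : ℕ) (h : l + 1 < n) (ν : Fin n → I),
      Rel C n (gt k l h * ge k ν)
        (ge k (ν ∘ Equiv.swap (⟨l, Nat.lt_of_succ_lt h⟩ : Fin n) ⟨l + 1, h⟩) * gt k l h)
  | tautau : ∀ (l : ℕ) (h : l + 1 < n) (l' : ℕ) (h' : l' + 1 < n),
      (l + 1 < l' ∨ l' + 1 < l) →
      Rel C n (gt k l h * gt k l' h') (gt k l' h' * gt k l h)
  | tausq : ∀ (l : ℕ) (h : l + 1 < n) (ν : Fin n → I),
      Rel C n (gt k l h ^ 2 * ge k ν)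
        (Qel C (ν ⟨l, Nat.lt_of_succ_lt h⟩) (ν ⟨l + 1, h⟩)
          (gx k ⟨l, Nat.lt_of_succ_lt h⟩) (gx k ⟨l + 1, h⟩) * ge k ν)
  | taux : ∀ (l : ℕ) (h : l + 1 < n) (m : Fin n) (ν : Fin n → I),
      Rel C n ((gt k l h * gx k m
          - gx k (Equiv.swap (⟨l, Nat.lt_of_succ_lt h⟩ : Fin n) ⟨l + 1, h⟩ m) * gt k l h) * ge k ν)
        (if m = ⟨l, Nat.lt_of_succ_lt h⟩ ∧ ν ⟨l, Nat.lt_of_succ_lt h⟩ = ν ⟨l + 1, h⟩ then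
            -(ge k ν)
          else if m = (⟨l + 1, h⟩ : Fin n) ∧ ν ⟨l, Nat.lt_of_succ_lt h⟩ = ν ⟨l + 1, h⟩ then
            ge k ν
          else 0)
  | braid : ∀ (l : ℕ) (h2 : l + 2 < n) (ν : Fin n → I),
      Rel C n ((gt k (l + 1) h2 * gt k l (Nat.lt_of_succ_lt h2) * gt k (l + 1) h2
          - gt k l (Nat.lt_of_succ_lt h2) * gt k (l + 1) h2 * gt k l (Nat.lt_of_succ_lt h2))
          * ge k ν)
        (if ν ⟨l, Nat.lt_of_succ_lt (Nat.lt_of_succ_lt h2)⟩ = ν ⟨l + 2, h2⟩ then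
            Qdiff C (ν ⟨l, Nat.lt_of_succ_lt (Nat.lt_of_succ_lt h2)⟩)
              (ν ⟨l + 1, Nat.lt_of_succ_lt h2⟩)
              (gx k ⟨l, Nat.lt_of_succ_lt (Nat.lt_of_succ_lt h2)⟩)
              (gx k ⟨l + 1, Nat.lt_of_succ_lt h2⟩)
              (gx k ⟨l + 2, h2⟩) * ge k ν
          else 0)

/-- The Khovanov–Lauda–Rouquier algebra `R(n)`. -/
abbrev Alg (C : CartanDatum k I) (n : ℕ) : Type := RingQuot (Rel C n)

variable (C : CartanDatum k I)

/-- The generator `e(ν)` of `R(n)`. -/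
noncomputable def Ee {n : ℕ} (ν : Fin n → I) : Alg C n :=
  RingQuot.mkAlgHom k (Rel C n) (ge k ν)

/-- The generator `x_a` of `R(n)`. -/
noncomputable def Xx {n : ℕ} (a : Fin n) : Alg C n :=
  RingQuot.mkAlgHom k (Rel C n) (gx k a)

/-- The generator `τ_l` of `R(n)`. -/
noncomputable def Tt {n : ℕ} (l : ℕ) (h : l + 1 < n) : Alg C n :=
  RingQuot.mkAlgHom k (Rel C n) (gt k l h)

variable (I) in
/-- The height of `β = Σ k_i α_i`. -/
def ht (β : I → ℕ) : ℕ := ∑ i, β i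

/-- The content of a sequence `ν`. -/
def content {m : ℕ} (ν : Fin m → I) : I → ℕ :=
  fun i => (Finset.univ.filter (fun a => ν a = i)).card

/-- The set `I^β` of sequences of length `m` with content `β`. -/
def seqs (β : I → ℕ) (m : ℕ) : Finset (Fin m → I) :=
  Finset.univ.filter (fun ν => content ν = β)

/-- The central idempotent `e(β)` in `R(n)`. -/
noncomputable def eIdem (n : ℕ) (β : I → ℕ) : Alg C n := ∑ ν ∈ seqs β n, Ee C ν

/-- `β + α_i`. -/
def addA (β : I → ℕ) (i : I) : I → ℕ := fun j => β j + if j = i then 1 else 0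

/-- The idempotent `e(β, α_i)` of `R(n+1)` (sum over `ν ∈ I^{β+α_i}` with `ν_{n+1} = i`). -/
noncomputable def eR (n : ℕ) (β : I → ℕ) (i : I) : Alg C (n + 1) :=
  ∑ ν ∈ (seqs (addA β i) (n + 1)).filter (fun ν => ν (Fin.last n) = i), Ee C ν

/-- The idempotent `e(α_i, β)` of `R(n+1)` (sum over `ν ∈ I^{β+α_i}` with `ν_1 = i`). -/
noncomputable def eL (n : ℕ) (β : I → ℕ) (i : I) : Alg C (n + 1) :=
  ∑ ν ∈ (seqs (addA β i) (n + 1)).filter (fun ν => ν 0 = i), Ee C ν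

/-- The idempotent `e(β - α_i, α_i)` of `R(n)`: sum over `ν ∈ I^β` with last entry `i`;
this is `0` when the coefficient of `α_i` in `β` is `0` or `n = 0`. -/
noncomputable def eD (n : ℕ) (β : I → ℕ) (i : I) : Alg C n :=
  ∑ ν ∈ (seqs β n).filter (fun ν => if h : 0 < n then ν ⟨n - 1, Nat.sub_lt h one_pos⟩ = i
      else False), Ee C ν

/-- The relations defining `R(β) = R(n)e(β)` (a unital ring with unit the image of
`e(β)`): the KLR relations together with the relation `e(β) = 1`. -/
inductive URel (n : ℕ) (β : I → ℕ) : FA k I n → FA k I n → Prop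
  | base : ∀ {x y : FA k I n}, Rel C n x y → URel n β x y
  | unit : URel n β (∑ ν ∈ seqs β n, ge k ν) 1

/-- The algebra `R(β)`, realized as the quotient of `R(n)` identifying `e(β)` with `1`. -/
abbrev bAlg (n : ℕ) (β : I → ℕ) : Type := RingQuot (URel C n β)

/-- The canonical projection `R(n) → R(β)`. -/
noncomputable def toB {n : ℕ} {β : I → ℕ} : Alg C n →ₐ[k] bAlg C n β :=
  RingQuot.liftAlgHom (S := k)
    ⟨RingQuot.mkAlgHom k (URel C n β),
      fun _ _ h => RingQuot.mkAlgHom_rel k (URel.base h)⟩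

/-- The element `a^Λ(x_1)` at the level of the free algebra. -/
noncomputable def aLamF (Λ : I → ℕ) (n : ℕ) (β : I → ℕ) : FA k I n :=
  if h : 0 < n then
    ∑ ν ∈ seqs β n, (gx k (⟨0, h⟩ : Fin n)) ^ (Λ (ν ⟨0, h⟩)) * ge k ν
  else 0

/-- The element `a^Λ(x_1)` of `R(β)`. -/
noncomputable def aLam (Λ : I → ℕ) (n : ℕ) (β : I → ℕ) : bAlg C n β :=
  RingQuot.mkAlgHom k (URel C n β) (aLamF Λ n β)

/-- The relations defining the cyclotomic quotient `R^Λ(β)`. -/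
inductive CRel (Λ : I → ℕ) (n : ℕ) (β : I → ℕ) : FA k I n → FA k I n → Prop
  | base : ∀ {x y : FA k I n}, Rel C n x y → CRel Λ n β x y
  | unit : CRel Λ n β (∑ ν ∈ seqs β n, ge k ν) 1
  | cyc : CRel Λ n β (aLamF Λ n β) 0

/-- The cyclotomic KLR algebra `R^Λ(β)`. -/
abbrev cAlg (Λ : I → ℕ) (n : ℕ) (β : I → ℕ) : Type := RingQuot (CRel C Λ n β)

/-- The canonical projection `R(β) → R^Λ(β)`. -/
noncomputable def toC {Λ : I → ℕ} {n : ℕ} {β : I → ℕ} : bAlg C n β →ₐ[k] cAlg C Λ n β :=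
  RingQuot.liftAlgHom (S := k)
    ⟨RingQuot.mkAlgHom k (CRel C Λ n β),
      fun _ _ h => by
        cases h with
        | base hb => exact RingQuot.mkAlgHom_rel k (CRel.base hb)
        | unit => exact RingQuot.mkAlgHom_rel k CRel.unit⟩

/-- The canonical projection `R(n) → R^Λ(β)`. -/
noncomputable def toCB (Λ : I → ℕ) {n : ℕ} {β : I → ℕ} : Alg C n →ₐ[k] cAlg C Λ n β :=
  (toC C).comp (toB C)

end KLR
namespace KLR

variable {k : Type} [Field k] {I : Type} [Fintype I] [DecidableEq I] (C : CartanDatum k I)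

section Homs

/-- Characterization of the non-unital algebra homomorphism `R(n) → R(n+1)` adding `i`
on the right: `e(ν) ↦ e(ν∗(i))`, `x_a ↦ x_a e(…,α_i)`, `τ_l ↦ τ_l e(…,α_i)`,
where the relevant idempotent is supplied as `e`. -/
def IsUpR {n : ℕ} (i : I) (e : Alg C (n + 1)) (φ : Alg C n →ₙₐ[k] Alg C (n + 1)) : Prop :=
  (∀ ν : Fin n → I, φ (Ee C ν) = Ee C (Fin.snoc ν i)) ∧
  (∀ a : Fin n, φ (Xx C a) = Xx C a.castSucc * e) ∧
  (∀ (l : ℕ) (h : l + 1 < n), φ (Tt C l h) = Tt C l (Nat.lt_succ_of_lt h) * e)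

/-- Characterization of the non-unital algebra homomorphism `R(n) → R(n+1)` adding `i`
on the left: `e(ν) ↦ e((i)∗ν)`, `x_a ↦ x_{a+1} e(α_i,…)`, `τ_l ↦ τ_{l+1} e(α_i,…)`. -/
def IsUpL {n : ℕ} (i : I) (e : Alg C (n + 1)) (φ : Alg C n →ₙₐ[k] Alg C (n + 1)) : Prop :=
  (∀ ν : Fin n → I, φ (Ee C ν) = Ee C (Fin.cons i ν)) ∧
  (∀ a : Fin n, φ (Xx C a) = Xx C a.succ * e) ∧
  (∀ (l : ℕ) (h : l + 1 < n), φ (Tt C l h) = Tt C (l + 1) (Nat.succ_lt_succ h) * e)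

/-- Characterization of the non-unital homomorphism `R(β) → R(β+α_i)` (right version). -/
def IsUpRb {n : ℕ} {β γ' : I → ℕ} (i : I)
    (φ : bAlg C n β →ₙₐ[k] bAlg C (n + 1) γ') : Prop :=
  (∀ ν : Fin n → I, φ (toB C (Ee C ν)) = toB C (Ee C (Fin.snoc ν i))) ∧
  (∀ a : Fin n, φ (toB C (Xx C a)) = toB C (Xx C a.castSucc * eR C n β i)) ∧
  (∀ (l : ℕ) (h : l + 1 < n),
    φ (toB C (Tt C l h)) = toB C (Tt C l (Nat.lt_succ_of_lt h) * eR C n β i))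

/-- Characterization of the non-unital homomorphism `R(β) → R(β+α_i)` (left version). -/
def IsUpLb {n : ℕ} {β γ' : I → ℕ} (i : I)
    (φ : bAlg C n β →ₙₐ[k] bAlg C (n + 1) γ') : Prop :=
  (∀ ν : Fin n → I, φ (toB C (Ee C ν)) = toB C (Ee C (Fin.cons i ν))) ∧
  (∀ a : Fin n, φ (toB C (Xx C a)) = toB C (Xx C a.succ * eL C n β i)) ∧
  (∀ (l : ℕ) (h : l + 1 < n),
    φ (toB C (Tt C l h)) = toB C (Tt C (l + 1) (Nat.succ_lt_succ h) * eL C n β i))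

/-- Characterization of the non-unital homomorphism `R^Λ(β) → R^Λ(β+α_i)` (right version). -/
def IsUpRc (Λ : I → ℕ) {n : ℕ} {β γ' : I → ℕ} (i : I)
    (φ : cAlg C Λ n β →ₙₐ[k] cAlg C Λ (n + 1) γ') : Prop :=
  (∀ ν : Fin n → I, φ (toCB C Λ (Ee C ν)) = toCB C Λ (Ee C (Fin.snoc ν i))) ∧
  (∀ a : Fin n, φ (toCB C Λ (Xx C a)) = toCB C Λ (Xx C a.castSucc * eR C n β i)) ∧
  (∀ (l : ℕ) (h : l + 1 < n),
    φ (toCB C Λ (Tt C l h)) = toCB C Λ (Tt C l (Nat.lt_succ_of_lt h) * eR C n β i))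

end Homs

section Tensor

open scoped TensorProduct

variable (S B M : Type) [Ring S] [Algebra k S] [Ring B] [Algebra k B]
  [AddCommGroup M] [Module k M] [Module S M] [IsScalarTower k S M]

variable (k) in
/-- The relation submodule defining the balanced tensor product `B ⊗_S M` where `S`
acts on `B` on the right through the (non-unital) homomorphism `φ : S → B`. -/
def TRel (φ : S →ₙₐ[k] B) : Submodule B (B ⊗[k] M) :=
  Submodule.span B {z | ∃ (b : B) (r : S) (m : M), z = (b * φ r) ⊗ₜ[k] m - b ⊗ₜ[k] (r • m)}

variable (k) in
/-- The balanced tensor product `B ⊗_S M` (over the homomorphism `φ : S → B`). -/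
abbrev OT (φ : S →ₙₐ[k] B) : Type := (B ⊗[k] M) ⧸ TRel k S B M φ

variable (k) in
/-- The canonical projection onto the balanced tensor product. -/
def OTmk (φ : S →ₙₐ[k] B) (z : B ⊗[k] M) : OT k S B M φ := Submodule.Quotient.mk z

end Tensor

section ESub

variable (A : Type) [Ring A] [Algebra k A] (N : Type) [AddCommGroup N] [Module k N]
  [Module A N] [IsScalarTower k A N]

variable (k) in
/-- Multiplication by `e` as a `k`-linear endomorphism of an `A`-module. -/
def eMap (e : A) : N →ₗ[k] N where
  toFun x := e • x
  map_add' x y := smul_add e x y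
  map_smul' c x := by
    simp only [RingHom.id_apply]
    rw [← algebraMap_smul A c x, ← mul_smul, ← Algebra.commutes, mul_smul, algebraMap_smul]

variable (k) in
/-- The `k`-submodule `eN` of an `A`-module `N`. -/
def eSub (e : A) : Submodule k N := LinearMap.range (eMap k A N e)

end ESub

section Grading

variable {A M : Type}

variable (k) in
/-- `𝒜` is an algebra grading of `A`. -/
def IsAlgGrading [Ring A] [Algebra k A] (𝒜 : ℤ → Submodule k A) : Prop :=
  (1 : A) ∈ 𝒜 0 ∧ (∀ {c₁ c₂ : ℤ} {a b : A}, a ∈ 𝒜 c₁ → b ∈ 𝒜 c₂ → a * b ∈ 𝒜 (c₁ + c₂)) ∧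
    DirectSum.IsInternal 𝒜

variable (k) in
/-- `gr` is a grading of the `A`-module `M` compatible with the algebra grading `𝒜`. -/
def IsModGrading [Ring A] [Algebra k A] [AddCommGroup M] [Module k M] [Module A M]
    (𝒜 : ℤ → Submodule k A) (gr : ℤ → Submodule k M) : Prop :=
  DirectSum.IsInternal gr ∧
    ∀ {c m : ℤ} {a : A} {x : M}, a ∈ 𝒜 c → x ∈ gr m → a • x ∈ gr (c + m)

end Grading

section KLRGrading

/-- The canonical grading property for `R(n)`-type quotients: images of `e(ν)` have degree 0,
`x_a e(ν)` has degree `(α_{ν_a}, α_{ν_a})`, and `τ_l e(ν)` has degree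
`-(α_{ν_l}, α_{ν_{l+1}})`.  Here `p : R(n) → A` is the canonical projection onto the
quotient under consideration. -/
def IsKLRGrading {n : ℕ} {A : Type} [Ring A] [Algebra k A] (p : Alg C n →ₐ[k] A)
    (𝒜 : ℤ → Submodule k A) : Prop :=
  IsAlgGrading k 𝒜 ∧
  (∀ ν : Fin n → I, p (Ee C ν) ∈ 𝒜 0) ∧
  (∀ (a : Fin n) (ν : Fin n → I), p (Xx C a * Ee C ν) ∈ 𝒜 (B C (ν a) (ν a))) ∧
  (∀ (l : ℕ) (h : l + 1 < n) (ν : Fin n → I),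
    p (Tt C l h * Ee C ν) ∈ 𝒜 (-(B C (ν ⟨l, Nat.lt_of_succ_lt h⟩) (ν ⟨l + 1, h⟩))))

end KLRGrading

end KLR
namespace KLR

open scoped TensorProduct

variable {k : Type} [Field k] {I : Type} [Fintype I] [DecidableEq I] (C : CartanDatum k I)

section IndGrading

variable (S B M : Type) [Ring S] [Algebra k S] [Ring B] [Algebra k B]
  [AddCommGroup M] [Module k M] [Module S M] [IsScalarTower k S M]

variable (k) in
/-- The induced grading on the balanced tensor product `B ⊗_S M`. -/
def otGr (φ : S →ₙₐ[k] B) (𝒜 : ℤ → Submodule k B) (gr : ℤ → Submodule k M)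
    (c : ℤ) : Submodule k (OT k S B M φ) :=
  Submodule.span k {z | ∃ (c₁ c₂ : ℤ) (b : B) (m : M),
    c₁ + c₂ = c ∧ b ∈ 𝒜 c₁ ∧ m ∈ gr c₂ ∧ z = OTmk k S B M φ (b ⊗ₜ[k] m)}

end IndGrading

section ESubGrading

variable (A N : Type) [Ring A] [Algebra k A] [AddCommGroup N] [Module k N]
  [Module A N] [IsScalarTower k A N]

variable (k) in
/-- The induced grading on the submodule `eN ⊆ N`. -/
def eSubGr (e : A) (gr : ℤ → Submodule k N) (c : ℤ) : Submodule k ↥(eSub k A N e) :=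
  (gr c).comap (eSub k A N e).subtype

end ESubGrading

section Instances

variable (n : ℕ) (β : I → ℕ) (Λ : I → ℕ)

noncomputable instance : Module (bAlg C n β) (cAlg C Λ n β) :=
  Module.compHom _ (toC C (Λ := Λ) (n := n) (β := β)).toRingHom

instance : IsScalarTower k (bAlg C n β) (cAlg C Λ n β) := by
  constructor
  intro c s m
  show (toC C (c • s)) * m = c • (toC C s * m)
  rw [map_smul, Algebra.smul_mul_assoc]

end Instances


end KLR
namespace KLR

open scoped TensorProduct

variable {k : Type} [Field k] {I : Type} [Fintype I] [DecidableEq I] (C : CartanDatum k I)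

/-- `⟨h_i, β⟩ = Σ_j k_j a_{ij}`. -/
def pairH (i : I) (β : I → ℕ) : ℤ := ∑ j, (β j : ℤ) * C.a i j

/-- `(α_i, β) = Σ_j k_j (α_i, α_j)`. -/
def pairB (i : I) (β : I → ℕ) : ℤ := ∑ j, (β j : ℤ) * B C i j

/-- The ordered product `τ_1 τ_2 ⋯ τ_n` in `R(β+α_i)`-type quotients. -/
noncomputable def tauProd (n : ℕ) (γ : I → ℕ) : bAlg C (n + 1) γ :=
  (List.ofFn (fun l : Fin n => toB C (Tt C l.val (Nat.succ_lt_succ l.isLt)))).prod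

/-- The right ideal `Ae` as a `k`-submodule. -/
noncomputable def rId {A : Type} [Ring A] [Algebra k A] (e : A) : Submodule k A :=
  LinearMap.range (LinearMap.mulRight k e)

/-- The left ideal `eA` as a `k`-submodule. -/
noncomputable def lId {A : Type} [Ring A] [Algebra k A] (e : A) : Submodule k A :=
  LinearMap.range (LinearMap.mulLeft k e)

variable (k) in
/-- Characterization of the module structure on `eN` over `S'` acting through
the (non-unital) homomorphism `φ : S' → A`. -/
def IsEAction {A N S' : Type} [Ring A] [Algebra k A] [AddCommGroup N] [Module k N]
    [Module A N] [IsScalarTower k A N] [Ring S'] [Algebra k S']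
    (e : A) (φ : S' →ₙₐ[k] A) (inst : Module S' ↥(eSub k A N e)) : Prop :=
  letI := inst
  ∀ (r : S') (x : ↥(eSub k A N e)), ((r • x : ↥(eSub k A N e)) : N) = φ r • (x : N)

end KLR

namespace KLR

variable {k : Type} [Field k] {I : Type} [Fintype I] [DecidableEq I] (C : CartanDatum k I)

/-- The image of `e(β,α_i)` in `R(β+α_i)`. -/
noncomputable def eRb (n : ℕ) (β : I → ℕ) (i : I) : bAlg C (n + 1) (addA β i) :=
  toB C (eR C n β i)

/-- The image of `e(α_i,β)` in `R(β+α_i)`. -/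
noncomputable def eLb (n : ℕ) (β : I → ℕ) (i : I) : bAlg C (n + 1) (addA β i) :=
  toB C (eL C n β i)

/-- The image of `e(β-α_i,α_i)` in `R(β)`. -/
noncomputable def eDb (n : ℕ) (β : I → ℕ) (i : I) : bAlg C n β :=
  toB C (eD C n β i)

/-- The image of `e(β,α_i)` in `R^Λ(β+α_i)`. -/
noncomputable def eRc (Λ : I → ℕ) (n : ℕ) (β : I → ℕ) (i : I) :
    cAlg C Λ (n + 1) (addA β i) :=
  toCB C Λ (eR C n β i)

/-- The image of `e(β-α_i,α_i)` in `R^Λ(β)`. -/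
noncomputable def eDc (Λ : I → ℕ) (n : ℕ) (β : I → ℕ) (i : I) : cAlg C Λ n β :=
  toCB C Λ (eD C n β i)

end KLR

namespace KLR

variable {k : Type} [Field k] {I : Type} [Fintype I] [DecidableEq I]

variable (k) in
/-- Bundled data of the canonical module structure on `eN` over `S'`, acting through
the non-unital homomorphism `φ : S' → A`, together with its scalar-tower property. -/
structure EData {A S' : Type} (N : Type) [Ring A] [Algebra k A] [AddCommGroup N]
    [Module k N] [Module A N] [IsScalarTower k A N] [Ring S'] [Algebra k S']
    (e : A) (φ : S' →ₙₐ[k] A) : Type where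
  inst : Module S' ↥(eSub k A N e)
  compat : IsEAction k e φ inst
  tower : letI := inst; IsScalarTower k S' ↥(eSub k A N e)

end KLR


namespace KLRProof

section Laurent

variable (k : Type) [Field k] (M : Type) [AddCommGroup M] [Module k M]

/-- Laurent series in `t⁻¹` with coefficients in `M`. -/
def VV : Submodule k (ℤ → M) where
  carrier := {f | ∃ N : ℤ, ∀ d, N < d → f d = 0}
  add_mem' := by
    rintro f g ⟨N, hN⟩ ⟨N', hN'⟩
    refine ⟨max N N', fun d hd => ?_⟩
    have h1 : N < d := lt_of_le_of_lt (le_max_left _ _) hd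
    have h2 : N' < d := lt_of_le_of_lt (le_max_right _ _) hd
    simp [hN d h1, hN' d h2]
  zero_mem' := ⟨0, fun _ _ => rfl⟩
  smul_mem' := by
    rintro c f ⟨N, hN⟩
    exact ⟨N, fun d hd => by simp [hN d hd]⟩

variable {k M}

/-- Coefficientwise action of an endomorphism of `M`. -/
def mapV : Module.End k M →ₐ[k] Module.End k (VV k M) where
  toFun u :=
    { toFun := fun f => ⟨fun d => u (f.1 d), by
        obtain ⟨N, hN⟩ := f.2
        exact ⟨N, fun d hd => by simp [hN d hd]⟩⟩
      map_add' := fun f g => by ext d; simp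
      map_smul' := fun c f => by ext d; simp }
  map_one' := by ext f d; rfl
  map_mul' u v := by ext f d; rfl
  map_zero' := by ext f d; rfl
  map_add' u v := by ext f d; rfl
  commutes' c := by ext f d; rfl

@[simp] lemma mapV_apply (u : Module.End k M) (f : VV k M) (d : ℤ) :
    (mapV u f).1 d = u (f.1 d) := rfl

variable (k M) in
/-- Multiplication by `t`. -/
def tV : Module.End k (VV k M) where
  toFun f := ⟨fun d => f.1 (d - 1), by
        obtain ⟨N, hN⟩ := f.2
        exact ⟨N + 1, fun d hd => hN _ (by omega)⟩⟩
  map_add' := fun f g => by ext d; simp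
  map_smul' := fun c f => by ext d; simp

@[simp] lemma tV_apply (f : VV k M) (d : ℤ) : (tV k M f).1 d = f.1 (d - 1) := rfl

lemma tV_pow_apply (p : ℕ) (f : VV k M) (d : ℤ) : ((tV k M ^ p) f).1 d = f.1 (d - p) := by
  induction p generalizing d with
  | zero => simp
  | succ p ih =>
    rw [pow_succ', Module.End.mul_apply, tV_apply, ih]
    have : d - 1 - (p : ℤ) = d - ((p + 1 : ℕ) : ℤ) := by push_cast; ring
    rw [this]

lemma tV_comm (u : Module.End k M) : tV k M * mapV u = mapV u * tV k M := by
  ext f d; rfl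

/-- an element of `VV` which is nonzero has a top coefficient. -/
lemma exists_top (f : VV k M) (hf : f ≠ 0) : ∃ N : ℤ, f.1 N ≠ 0 ∧ ∀ d, N < d → f.1 d = 0 := by
  obtain ⟨N, hN⟩ := f.2
  have hne : ∃ d, f.1 d ≠ 0 := by
    by_contra h
    push Not at h
    exact hf (by ext d; simpa using h d)
  have := Int.exists_greatest_of_bdd (P := fun d => f.1 d ≠ 0)
    ⟨N, fun z hz => by by_contra h; exact hz (hN z (by omega))⟩ hne
  obtain ⟨m, hm, h2⟩ := this
  exact ⟨m, hm, fun d hd => by by_contra h; exact absurd (h2 d h) (by omega)⟩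

lemma inj_of_top (A : Module.End k (VV k M)) (e : ℤ) (u : Module.End k M)
    (hu : Function.Injective u)
    (hA : ∀ (f : VV k M) (N : ℤ), (∀ d, N < d → f.1 d = 0) → (A f).1 (N + e) = u (f.1 N)) :
    Function.Injective A := by
  rw [injective_iff_map_eq_zero]
  intro f hf
  by_contra h
  obtain ⟨N, h1, h2⟩ := exists_top f h
  have := hA f N h2
  rw [hf] at this
  exact h1 (hu (by rw [← this]; simp))

lemma bij_sub (y : Module.End k M) : Function.Bijective (tV k M - mapV y) := by
  constructor
  · refine inj_of_top _ 1 1 (fun _ _ h => h) ?_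
    intro f N hf
    simp [hf (N + 1) (by omega)]
  · intro f
    obtain ⟨N, hN⟩ := f.2
    refine ⟨⟨fun d => ∑ j ∈ Finset.range (N - d).toNat, (y ^ j) (f.1 (d + 1 + j)), ⟨N, ?_⟩⟩, ?_⟩
    · intro d hd
      have : (N - d).toNat = 0 := by omega
      simp [this]
    · ext d
      simp only [LinearMap.sub_apply, AddSubgroupClass.coe_sub, Pi.sub_apply, tV_apply,
        mapV_apply, map_sum]
      by_cases hd : d ≤ N
      · have : (N - (d - 1)).toNat = (N - d).toNat + 1 := by omega
        rw [this, Finset.sum_range_succ']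
        simp only [pow_succ', Module.End.mul_apply]
        have : ∀ j : ℕ, d - 1 + 1 + ((j + 1 : ℕ) : ℤ) = d + 1 + j := by intro j; push_cast; ring
        simp only [this]
        simp
      · rw [Int.toNat_of_nonpos (by omega), Int.toNat_of_nonpos (by omega)]
        simp [hN d (by omega)]

/-- The inverse of `t - y`. -/
noncomputable def wV (y : Module.End k M) : Module.End k (VV k M) :=
  (LinearEquiv.ofBijective (tV k M - mapV y) (bij_sub y)).symm

lemma wV_left (y : Module.End k M) : wV y * (tV k M - mapV y) = 1 := by
  ext1 f
  exact (LinearEquiv.ofBijective (tV k M - mapV y) (bij_sub y)).symm_apply_apply f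

lemma wV_right (y : Module.End k M) : (tV k M - mapV y) * wV y = 1 := by
  ext1 f
  exact (LinearEquiv.ofBijective (tV k M - mapV y) (bij_sub y)).apply_symm_apply f

variable (k M) in
/-- constants. -/
def constV : M →ₗ[k] VV k M where
  toFun m := ⟨fun d => if d = 0 then m else 0, ⟨0, fun d hd => by simp [hd.ne']⟩⟩
  map_add' a b := by ext d; by_cases h : d = 0 <;> simp [h]
  map_smul' a b := by ext d; by_cases h : d = 0 <;> simp [h]

lemma constV_map (u : Module.End k M) (m : M) : mapV u (constV k M m) = constV k M (u m) := by
  ext d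
  by_cases h : d = 0 <;> simp [h, constV]

/-- polynomials embed in Laurent series -/
lemma poly_inj (N : ℕ) (m : ℕ → M)
    (h : ∑ j ∈ Finset.range N, (tV k M ^ j) (constV k M (m j)) = 0) :
    ∀ j < N, m j = 0 := by
  intro j hj
  have h1 := congrArg (fun f : VV k M => f.1 j) h
  simp only [AddSubmonoidClass.coe_finsetSum, Finset.sum_apply, tV_pow_apply] at h1
  rw [Finset.sum_eq_single j] at h1
  · simpa [constV] using h1
  · intro b _ hb
    have : (j : ℤ) - b ≠ 0 := by omega
    simp [constV, this]
  · intro h; simp [hj] at h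

end Laurent

end KLRProof

namespace KLRProof

set_option linter.unusedSectionVars false

open KLR

variable {k : Type} [Field k] {I : Type} [Fintype I] [DecidableEq I]

/-- colour of a strand, with default value. -/
def cl (i : I) {n : ℕ} (ν : Fin n → I) (l : ℕ) : I := if h : l < n then ν ⟨l, h⟩ else i

lemma cl_of_lt (i : I) {n : ℕ} (ν : Fin n → I) (l : ℕ) (h : l < n) : cl i ν l = ν ⟨l, h⟩ := by
  simp [cl, h]

/-- the transposed sequence. -/
def sw {n : ℕ} (l : ℕ) (h : l + 1 < n) (ν : Fin n → I) : Fin n → I :=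
  ν ∘ Equiv.swap (⟨l, Nat.lt_of_succ_lt h⟩ : Fin n) ⟨l + 1, h⟩

lemma cl_sw0 (i : I) {n : ℕ} (l : ℕ) (h : l + 1 < n) (ν : Fin n → I) :
    cl i (sw l h ν) l = cl i ν (l + 1) := by
  rw [cl_of_lt _ _ _ (by omega), cl_of_lt _ _ _ h]; simp [sw]

lemma cl_sw1 (i : I) {n : ℕ} (l : ℕ) (h : l + 1 < n) (ν : Fin n → I) :
    cl i (sw l h ν) (l + 1) = cl i ν l := by
  rw [cl_of_lt _ _ _ (by omega), cl_of_lt _ _ _ (by omega)]; simp [sw]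

lemma cl_sw2 (i : I) {n : ℕ} (l : ℕ) (h : l + 1 < n) (ν : Fin n → I) (m : ℕ)
    (h1 : m ≠ l) (h2 : m ≠ l + 1) :
    cl i (sw l h ν) m = cl i ν m := by
  by_cases hm : m < n
  · rw [cl_of_lt _ _ _ hm, cl_of_lt _ _ _ hm]
    simp only [sw, Function.comp]
    rw [Equiv.swap_apply_of_ne_of_ne] <;> simpa [Fin.ext_iff]
  · simp [cl, hm]

section Q

variable (C : CartanDatum k I) {A : Type} [Ring A] [Algebra k A]

lemma map_Qel {A' : Type} [Ring A'] [Algebra k A'] (f : A →ₐ[k] A') (i j : I) (u v : A) :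
    f (Qel C i j u v) = Qel C i j (f u) (f v) := by
  unfold Qel
  split_ifs
  · simp
  · simp only [map_sum]
    refine Finset.sum_congr rfl fun p _ => Finset.sum_congr rfl fun q _ => ?_
    split_ifs <;> simp

lemma map_Qdiff {A' : Type} [Ring A'] [Algebra k A'] (f : A →ₐ[k] A') (i j : I) (u v w : A) :
    f (Qdiff C i j u v w) = Qdiff C i j (f u) (f v) (f w) := by
  unfold Qdiff
  split_ifs
  · simp
  · simp only [map_sum]
    refine Finset.sum_congr rfl fun p _ => Finset.sum_congr rfl fun q _ => ?_
    split_ifs <;> simp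

lemma Qel_self (i : I) (u v : A) : Qel C i i u v = 0 := by simp [Qel]
lemma Qdiff_self (i : I) (u v w : A) : Qdiff C i i u v w = 0 := by simp [Qdiff]

lemma Qel_symm (i j : I) (u v : A) (h : u * v = v * u) : Qel C i j u v = Qel C j i v u := by
  unfold Qel
  by_cases hij : i = j
  · simp [hij]
  · rw [if_neg hij, if_neg (Ne.symm hij), Finset.sum_comm]
    refine Finset.sum_congr rfl fun p _ => Finset.sum_congr rfl fun q _ => ?_
    have h1 : (C.d i * (q : ℤ) + C.d j * (p : ℤ) = -(C.d i * C.a i j)) ↔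
        (C.d j * (p : ℤ) + C.d i * (q : ℤ) = -(C.d j * C.a j i)) := by
      rw [C.symmetrize i j, add_comm]
    by_cases h2 : (C.d j * (p : ℤ) + C.d i * (q : ℤ) = -(C.d j * C.a j i))
    · rw [if_pos h2, if_pos (h1.2 h2), C.t_symm, ((show Commute u v from h).pow_pow q p).eq]
    · rw [if_neg h2, if_neg (fun h => h2 (h1.1 h))]

lemma Qel_commute (i j : I) (u v z : A) (hu : Commute z u) (hv : Commute z v) :
    Commute z (Qel C i j u v) := by
  unfold Qel
  split_ifs
  · exact Commute.zero_right _
  · refine Commute.sum_right _ _ _ fun p _ => Commute.sum_right _ _ _ fun q _ => ?_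
    split_ifs
    · exact Commute.smul_right ((hu.pow_right _).mul_right (hv.pow_right _)) _
    · exact Commute.zero_right _

/-- abstract twisted commutation through `Q`. -/
lemma Qel_twist (i j : I) (u v u' v' z : A) (hu : z * u = u' * z) (hv : z * v = v' * z) :
    z * Qel C i j u v = Qel C i j u' v' * z := by
  unfold Qel
  split_ifs
  · simp
  · rw [Finset.mul_sum, Finset.sum_mul]
    refine Finset.sum_congr rfl fun p _ => ?_
    rw [Finset.mul_sum, Finset.sum_mul]
    refine Finset.sum_congr rfl fun q _ => ?_
    have h1 := (show SemiconjBy z u u' from hu).pow_right p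
    have h2 := (show SemiconjBy z v v' from hv).pow_right q
    split_ifs
    · rw [mul_smul_comm, smul_mul_assoc, (h1.mul_right h2).eq]
    · simp

lemma Qdiff_mul (i j : I) (u v w : A) (huw : Commute u w) :
    (u - w) * Qdiff C i j u v w = Qel C i j u v - Qel C i j w v := by
  unfold Qel Qdiff
  split_ifs
  · simp
  · rw [Finset.mul_sum, ← Finset.sum_sub_distrib]
    refine Finset.sum_congr rfl fun p _ => ?_
    rw [Finset.mul_sum, ← Finset.sum_sub_distrib]
    refine Finset.sum_congr rfl fun q _ => ?_
    split_ifs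
    · rw [mul_smul_comm, ← mul_assoc, huw.mul_geom_sum₂, ← smul_sub, sub_mul]
    · simp

/-- `τ f(y) - f(y') τ = - (f(y) - f(y'))/(y - y')` -/
lemma Qel_nil (i j : I) (y y' v z E : A) (h : (z * y - y' * z) * E = -E)
    (hE : Commute E y) (hEv : Commute E v) (hz : Commute z v)
    (hyy : Commute y y') :
    (z * Qel C i j y v - Qel C i j y' v * z) * E = - (Qdiff C i j y v y' * E) := by
  have key : ∀ p : ℕ, (z * y ^ p - y' ^ p * z) * E =
      -((∑ c ∈ Finset.range p, y ^ c * y' ^ (p - 1 - c)) * E) := by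
    intro p
    induction p with
    | zero => simp
    | succ p ih =>
      have e1 : (z * y ^ (p + 1) - y' ^ (p + 1) * z) * E
          = (z * y ^ p - y' ^ p * z) * E * y + y' ^ p * ((z * y - y' * z) * E) := by
        have : E * y = y * E := hE
        rw [mul_assoc (_ - _) E y, this]
        rw [pow_succ, pow_succ]; noncomm_ring
      rw [e1, ih, h, Finset.sum_range_succ', Nat.add_sub_cancel]
      have : E * y = y * E := hE
      have e2 : ∀ c ∈ Finset.range p, y ^ (c + 1) * y' ^ (p - (c + 1)) =
          y ^ c * y' ^ (p - 1 - c) * y := by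
        intro c hc
        have e3 : p - (c + 1) = p - 1 - c := by omega
        rw [e3, pow_succ, mul_assoc, mul_assoc, (hyy.pow_right _).eq]
      rw [Finset.sum_congr rfl e2, ← Finset.sum_mul]
      rw [neg_mul, mul_assoc _ E y, this]
      simp only [pow_zero, one_mul, Nat.sub_zero]
      noncomm_ring
  unfold Qel Qdiff
  split_ifs
  · simp
  · rw [Finset.mul_sum, Finset.sum_mul, ← Finset.sum_sub_distrib, Finset.sum_mul, Finset.sum_mul,
      ← Finset.sum_neg_distrib]
    refine Finset.sum_congr rfl fun p _ => ?_
    rw [Finset.mul_sum, Finset.sum_mul, ← Finset.sum_sub_distrib, Finset.sum_mul, Finset.sum_mul,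
      ← Finset.sum_neg_distrib]
    refine Finset.sum_congr rfl fun q _ => ?_
    split_ifs
    · rw [mul_smul_comm, smul_mul_assoc, ← smul_sub, smul_mul_assoc, smul_mul_assoc, ← smul_neg]
      congr 1
      have e1 : (z * (y ^ p * v ^ q) - y' ^ p * v ^ q * z) * E =
          (z * y ^ p - y' ^ p * z) * E * v ^ q := by
        rw [mul_assoc _ (v ^ q) z, ← (hz.pow_right q).eq, mul_assoc _ E, (hEv.pow_right q).eq]
        noncomm_ring
      rw [e1, key, neg_mul, mul_assoc, (hEv.pow_right q).eq, mul_assoc]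
    · simp

end Q

/-- A family of elements of an algebra satisfying the KLR relations. -/
structure KRel (C : CartanDatum k I) (n : ℕ) (i : I) (E : Type) [Ring E] [Algebra k E] where
  e : (Fin n → I) → E
  X : ℕ → E
  T : ℕ → E
  ee : ∀ ν ν', e ν * e ν' = if ν = ν' then e ν else 0
  esum : ∑ ν, e ν = 1
  xx : ∀ a b, X a * X b = X b * X a
  xe : ∀ a ν, X a * e ν = e ν * X a
  te : ∀ l (h : l + 1 < n) ν, T l * e ν = e (sw l h ν) * T l
  tt : ∀ l l', l + 1 < n → l' + 1 < n → l + 1 < l' ∨ l' + 1 < l → T l * T l' = T l' * T l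
  tsq : ∀ l, l + 1 < n → ∀ ν, T l ^ 2 * e ν =
    Qel C (cl i ν l) (cl i ν (l + 1)) (X l) (X (l + 1)) * e ν
  tx0 : ∀ l, l + 1 < n → ∀ ν, (T l * X l - X (l + 1) * T l) * e ν =
    if cl i ν l = cl i ν (l + 1) then - e ν else 0
  tx1 : ∀ l, l + 1 < n → ∀ ν, (T l * X (l + 1) - X l * T l) * e ν =
    if cl i ν l = cl i ν (l + 1) then e ν else 0
  tx2 : ∀ l, l + 1 < n → ∀ m, m ≠ l → m ≠ l + 1 → T l * X m = X m * T l
  braid : ∀ l, l + 2 < n → ∀ ν,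
    (T (l + 1) * T l * T (l + 1) - T l * T (l + 1) * T l) * e ν =
    if cl i ν l = cl i ν (l + 2) then
      Qdiff C (cl i ν l) (cl i ν (l + 1)) (X l) (X (l + 1)) (X (l + 2)) * e ν else 0

section ofHom

variable {C : CartanDatum k I} {n : ℕ} {E : Type} [Ring E] [Algebra k E]

/-- From an algebra homomorphism to a family satisfying the relations. -/
noncomputable def KRel.ofHom (i : I) (ρ : Alg C n →ₐ[k] E) : KRel C n i E := by
  let ψ : FA k I n →ₐ[k] E := ρ.comp (RingQuot.mkAlgHom k (Rel C n))
  have hψ : ∀ {x y : FA k I n}, Rel C n x y → ψ x = ψ y := fun h => by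
    simp only [ψ, AlgHom.comp_apply]
    rw [RingQuot.mkAlgHom_rel k h]
  refine KRel.mk (fun ν => ρ (Ee C ν)) (fun a => if h : a < n then ρ (Xx C ⟨a, h⟩) else 0)
    (fun l => if h : l + 1 < n then ρ (Tt C l h) else 0) ?_ ?_ ?_ ?_ ?_ ?_ ?_ ?_ ?_ ?_ ?_
  all_goals
    have q1 : ∀ ν, ρ (Ee C ν) = ψ (ge k ν) := fun ν => rfl
    have q2 : ∀ ν, ρ (Xx C ν) = ψ (gx k ν) := fun ν => rfl
    have q3 : ∀ l h, ρ (Tt C l h) = ψ (gt k l h) := fun l h => rfl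
    simp only [q1, q2, q3]
  · intro ν ν'
    have := hψ (Rel.ee (C := C) ν ν')
    rw [map_mul] at this
    rw [this]; split_ifs <;> simp
  · have := hψ (Rel.esum (C := C) (n := n))
    simpa using this
  · intro a b
    by_cases ha : a < n
    · by_cases hb : b < n
      · have := hψ (Rel.xx (C := C) ⟨a, ha⟩ ⟨b, hb⟩)
        simpa [ha, hb] using this
      · simp [hb]
    · simp [ha]
  · intro a ν
    by_cases ha : a < n
    · have := hψ (Rel.xe (C := C) ⟨a, ha⟩ ν)
      simpa [ha] using this
    · simp [ha]
  · intro l h ν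
    have := hψ (Rel.taue (C := C) l h ν)
    simpa [h, sw] using this
  · intro l l' h h' hh
    have := hψ (Rel.tautau (C := C) l h l' h' hh)
    simpa [h, h'] using this
  · intro l h ν
    have := hψ (Rel.tausq (C := C) l h ν)
    rw [map_mul, map_mul, map_pow, map_Qel] at this
    simpa [h, cl, Nat.lt_of_succ_lt h] using this
  · intro l h ν
    have := hψ (Rel.taux (C := C) l h ⟨l, Nat.lt_of_succ_lt h⟩ ν)
    rw [map_mul, map_sub, map_mul, map_mul, Equiv.swap_apply_left] at this
    simp only [h, Nat.lt_of_succ_lt h, cl, dif_pos]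
    rw [this]
    split_ifs <;> simp_all
  · intro l h ν
    have := hψ (Rel.taux (C := C) l h ⟨l + 1, h⟩ ν)
    rw [map_mul, map_sub, map_mul, map_mul, Equiv.swap_apply_right] at this
    simp only [h, Nat.lt_of_succ_lt h, cl, dif_pos]
    rw [this]
    split_ifs <;> simp_all
  · intro l h m h1 h2
    by_cases hm : m < n
    · simp only [h, hm, dif_pos]
      rw [← sub_eq_zero, ← mul_one (_ - _)]
      have h1' := hψ (Rel.esum (C := C) (n := n))
      rw [map_one] at h1'
      rw [← h1', map_sum, Finset.mul_sum]
      refine Finset.sum_eq_zero fun ν _ => ?_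
      have := hψ (Rel.taux (C := C) l h ⟨m, hm⟩ ν)
      rw [map_mul, map_sub, map_mul, map_mul, Equiv.swap_apply_of_ne_of_ne (by simpa [Fin.ext_iff])
        (by simpa [Fin.ext_iff])] at this
      rw [this]
      simp [h1, h2]
    · simp [hm]
  · intro l h ν
    have := hψ (Rel.braid (C := C) l h ν)
    simp only [map_mul, map_sub] at this
    have h1 : l + 1 + 1 < n := h
    simp only [h1, Nat.lt_of_succ_lt h, Nat.lt_of_succ_lt (Nat.lt_of_succ_lt h), cl, dif_pos, h]
    rw [this]
    split_ifs
    · rw [map_mul, map_Qdiff]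
    · simp

end ofHom

end KLRProof

namespace KLRProof

set_option linter.unusedSectionVars false

open KLR

variable {k : Type} [Field k] {I : Type} [Fintype I] [DecidableEq I]

/-- KLR relations with an extra commuting variable `t` such that all `t - x_l` are invertible. -/
structure Sh (C : CartanDatum k I) (n : ℕ) (i : I) (E : Type) [Ring E] [Algebra k E]
    extends KRel C n i E where
  t : E
  w : ℕ → E
  t_e : ∀ ν, Commute t (e ν)
  t_X : ∀ a, Commute t (X a)
  t_T : ∀ l, Commute t (T l)
  w_l : ∀ l, w l * (t - X l) = 1
  w_r : ∀ l, (t - X l) * w l = 1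

namespace Sh

variable {C : CartanDatum k I} {n : ℕ} {i : I} {E : Type} [Ring E] [Algebra k E]
  (S : Sh C n i E)

/-- The commutative subalgebra (bicommutant). -/
def PP : Subalgebra k E :=
  Subalgebra.centralizer k (Subalgebra.centralizer k
    (insert S.t (Set.range S.X ∪ Set.range S.e)) : Set E)

lemma PP_comm {a b : E} (ha : a ∈ S.PP) (hb : b ∈ S.PP) : Commute a b := by
  unfold PP at ha hb
  rw [Subalgebra.mem_centralizer_iff] at ha hb
  refine hb a ?_
  rw [SetLike.mem_coe, Subalgebra.mem_centralizer_iff]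
  intro g hg
  refine ha g ?_
  rw [SetLike.mem_coe, Subalgebra.mem_centralizer_iff]
  intro g' hg'
  have heq : ∀ ν ν', S.e ν * S.e ν' = S.e ν' * S.e ν := by
    intro ν ν'
    rw [S.ee, S.ee]
    by_cases h : ν = ν'
    · simp [h]
    · simp [h, Ne.symm h]
  rcases hg with rfl | ⟨a, rfl⟩ | ⟨ν, rfl⟩ <;> rcases hg' with rfl | ⟨b, rfl⟩ | ⟨ν', rfl⟩
  · rfl
  · exact (S.t_X b).symm
  · exact (S.t_e ν').symm
  · exact (S.t_X a)
  · exact S.xx _ _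
  · exact (S.xe _ _).symm
  · exact S.t_e _
  · exact S.xe _ _
  · exact heq _ _

lemma gen_mem {a : E} (ha : a ∈ insert S.t (Set.range S.X ∪ Set.range S.e)) : a ∈ S.PP := by
  unfold PP
  rw [Subalgebra.mem_centralizer_iff]
  intro g hg
  rw [SetLike.mem_coe, Subalgebra.mem_centralizer_iff] at hg
  exact (hg a ha).symm

lemma t_mem : S.t ∈ S.PP := S.gen_mem (by simp)
lemma X_mem (a : ℕ) : S.X a ∈ S.PP := S.gen_mem (by simp)
lemma e_mem (ν : Fin n → I) : S.e ν ∈ S.PP := S.gen_mem (by simp)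

lemma w_comm (l : ℕ) (z : E) (h1 : Commute z S.t) (h2 : Commute z (S.X l)) :
    Commute z (S.w l) := by
  have h3 : Commute z (S.t - S.X l) := h1.sub_right h2
  have h4 : z * S.w l = S.w l * (S.t - S.X l) * z * S.w l := by rw [S.w_l, one_mul]
  rw [Commute, SemiconjBy, h4, mul_assoc (S.w l), ← h3.eq, mul_assoc, mul_assoc, S.w_r, mul_one]

lemma w_mem (l : ℕ) : S.w l ∈ S.PP := by
  unfold PP
  rw [Subalgebra.mem_centralizer_iff]
  intro g hg
  rw [SetLike.mem_coe, Subalgebra.mem_centralizer_iff] at hg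
  exact S.w_comm l g (hg _ (by simp)).symm (hg _ (by simp)).symm

lemma Qel_mem (a b : I) {u v : E} (hu : u ∈ S.PP) (hv : v ∈ S.PP) : Qel C a b u v ∈ S.PP := by
  unfold Qel
  split_ifs
  · exact zero_mem _
  · refine sum_mem fun p _ => sum_mem fun q _ => ?_
    split_ifs
    · exact Subalgebra.smul_mem _ (mul_mem (pow_mem hu _) (pow_mem hv _)) _
    · exact zero_mem _

lemma Qdiff_mem (a b : I) {u v w : E} (hu : u ∈ S.PP) (hv : v ∈ S.PP) (hw : w ∈ S.PP) :
    Qdiff C a b u v w ∈ S.PP := by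
  unfold Qdiff
  split_ifs
  · exact zero_mem _
  · refine sum_mem fun p _ => sum_mem fun q _ => ?_
    split_ifs
    · exact Subalgebra.smul_mem _ (mul_mem (sum_mem fun c _ =>
        mul_mem (pow_mem hu _) (pow_mem hw _)) (pow_mem hv _)) _
    · exact zero_mem _

/-- element which is `c ν` on the `ν` component. -/
def diag (c : (Fin n → I) → E) : E := ∑ ν, c ν * S.e ν

lemma diag_mul_e (c : (Fin n → I) → E) (ν) : S.diag c * S.e ν = c ν * S.e ν := by
  unfold diag
  rw [Finset.sum_mul, Finset.sum_eq_single ν]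
  · rw [mul_assoc, S.ee, if_pos rfl]
  · intro ν' _ h
    rw [mul_assoc, S.ee, if_neg h, mul_zero]
  · simp

lemma diag_mem (c : (Fin n → I) → E) (hc : ∀ ν, c ν ∈ S.PP) : S.diag c ∈ S.PP :=
  sum_mem fun ν _ => mul_mem (hc ν) (S.e_mem ν)

lemma ext_e {A B : E} (h : ∀ ν, A * S.e ν = B * S.e ν) : A = B := by
  rw [← mul_one A, ← mul_one B, ← S.esum, Finset.mul_sum, Finset.mul_sum]
  exact Finset.sum_congr rfl fun ν _ => h ν

lemma diag_mul (c d : (Fin n → I) → E) (hd : ∀ ν, d ν ∈ S.PP) :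
    S.diag c * S.diag d = S.diag (fun ν => c ν * d ν) := by
  refine S.ext_e fun ν => ?_
  rw [mul_assoc, diag_mul_e, diag_mul_e, (S.PP_comm (hd ν) (S.e_mem ν)).eq, ← mul_assoc,
    diag_mul_e, mul_assoc, mul_assoc, (S.PP_comm (hd ν) (S.e_mem ν)).eq]

lemma diag_twist (l : ℕ) (hl : l + 1 < n) (c c' d : (Fin n → I) → E)
    (h : ∀ ν, (S.T l * c ν - c' (sw l hl ν) * S.T l) * S.e ν = d ν * S.e ν) :
    S.T l * S.diag c = S.diag c' * S.T l + S.diag d := by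
  refine S.ext_e fun ν => ?_
  rw [add_mul, diag_mul_e, mul_assoc, diag_mul_e, mul_assoc, S.te l hl, ← mul_assoc (S.diag c'),
    diag_mul_e, ← h ν, mul_assoc (c' _), ← S.te l hl]
  noncomm_ring

/-- `h_l`. -/
def hh (l : ℕ) : E := S.diag fun ν => if cl i ν l = i then S.w l else 0
/-- `Q̂_l`. -/
def Qh (l : ℕ) : E := S.diag fun ν => Qel C i (cl i ν l) S.t (S.X l)
/-- `D_l`. -/
def DD (l : ℕ) : E := S.diag fun ν => if cl i ν l = cl i ν (l + 1) then
  Qdiff C (cl i ν l) i (S.X l) S.t (S.X (l + 1)) else 0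
/-- `q_l`. -/
def qq (l : ℕ) : E := S.Qh l - S.hh l * S.hh l

lemma hh_mem (l : ℕ) : S.hh l ∈ S.PP := S.diag_mem _ fun ν => by
  split_ifs
  · exact S.w_mem l
  · exact zero_mem _
lemma Qh_mem (l : ℕ) : S.Qh l ∈ S.PP := S.diag_mem _ fun ν => S.Qel_mem _ _ S.t_mem (S.X_mem l)
lemma DD_mem (l : ℕ) : S.DD l ∈ S.PP := S.diag_mem _ fun ν => by
  split_ifs
  · exact S.Qdiff_mem _ _ (S.X_mem _) S.t_mem (S.X_mem _)
  · exact zero_mem _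
lemma qq_mem (l : ℕ) : S.qq l ∈ S.PP := sub_mem (S.Qh_mem l) (mul_mem (S.hh_mem l) (S.hh_mem l))

/-- conjugating a twisted commutation relation by inverses -/
lemma inv_twist (a b l : ℕ) (ν : Fin n → I) (c : E)
    (h : (S.T l * S.X a - S.X b * S.T l) * S.e ν = c * S.e ν) (hc : c ∈ S.PP) :
    (S.T l * S.w a - S.w b * S.T l) * S.e ν = c * S.w a * S.w b * S.e ν := by
  have h1 : S.T l * S.w a * S.e ν = S.w b * (S.t - S.X b) * (S.T l * S.w a * S.e ν) := by
    rw [S.w_l, one_mul]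
  have h2 : S.w b * S.T l * S.e ν = S.w b * S.T l * ((S.t - S.X a) * S.w a) * S.e ν := by
    rw [S.w_r, mul_one]
  have h3 : S.w a * S.e ν = S.e ν * S.w a := S.PP_comm (S.w_mem a) (S.e_mem ν)
  rw [sub_mul, h1, h2]
  have h4 : S.w b * (S.t - S.X b) * (S.T l * S.w a * S.e ν) -
      S.w b * S.T l * ((S.t - S.X a) * S.w a) * S.e ν
      = S.w b * (((S.T l * S.X a - S.X b * S.T l) * S.e ν) * S.w a) +
        S.w b * ((S.t * S.T l - S.T l * S.t) * S.w a * S.e ν) := by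
    rw [mul_assoc (_ - _) (S.e ν), ← h3]
    noncomm_ring
  rw [h4, (S.t_T l).eq, sub_self, h, mul_assoc c, ← h3]
  have h5 : S.w b * (c * (S.w a * S.e ν)) = c * S.w a * S.e ν * S.w b := by
    rw [← mul_assoc c]
    exact S.PP_comm (S.w_mem b) (mul_mem (mul_mem hc (S.w_mem a)) (S.e_mem ν))
  rw [h5, mul_assoc _ (S.e ν), (S.PP_comm (S.e_mem ν) (S.w_mem b)).eq]
  simp [mul_assoc]

lemma F1 (l : ℕ) (hl : l + 1 < n) :
    S.T l * S.hh l = S.hh (l + 1) * S.T l - S.hh l * S.hh (l + 1) := by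
  rw [sub_eq_add_neg]
  have : -(S.hh l * S.hh (l + 1)) = S.diag (fun ν =>
      -((if cl i ν l = i then S.w l else 0) * (if cl i ν (l + 1) = i then S.w (l + 1) else 0))) := by
    unfold hh
    rw [diag_mul]
    · simp [diag]
    · intro ν; split_ifs
      · exact S.w_mem _
      · exact zero_mem _
  rw [this]
  refine S.diag_twist l hl _ _ _ fun ν => ?_
  rw [cl_sw1]
  by_cases h1 : cl i ν l = i
  · rw [if_pos h1, if_pos h1]
    by_cases h2 : cl i ν (l + 1) = i
    · rw [if_pos h2]
      have := S.inv_twist l (l + 1) l ν (-1) (by rw [S.tx0 l hl, if_pos (h1.trans h2.symm)]; simp)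
        (neg_mem (one_mem _))
      rw [this]; simp
    · rw [if_neg h2]
      have := S.inv_twist l (l + 1) l ν 0 (by
        rw [S.tx0 l hl, if_neg (fun h => h2 (h.symm.trans h1))]; simp) (zero_mem _)
      rw [this]; simp
  · simp [h1]

lemma F1' (l : ℕ) (hl : l + 1 < n) :
    S.T l * S.hh (l + 1) = S.hh l * S.T l + S.hh l * S.hh (l + 1) := by
  have : (S.hh l * S.hh (l + 1)) = S.diag (fun ν =>
      ((if cl i ν l = i then S.w l else 0) * (if cl i ν (l + 1) = i then S.w (l + 1) else 0))) := by
    unfold hh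
    rw [diag_mul]
    · intro ν; split_ifs
      · exact S.w_mem _
      · exact zero_mem _
  rw [this]
  refine S.diag_twist l hl _ _ _ fun ν => ?_
  rw [cl_sw0]
  by_cases h1 : cl i ν (l + 1) = i
  · rw [if_pos h1, if_pos h1]
    by_cases h2 : cl i ν l = i
    · rw [if_pos h2]
      have := S.inv_twist (l + 1) l l ν 1 (by rw [S.tx1 l hl, if_pos (h2.trans h1.symm)]; simp)
        (one_mem _)
      rw [this, one_mul, (S.PP_comm (S.w_mem l) (S.w_mem (l + 1))).eq]
    · rw [if_neg h2]
      have := S.inv_twist (l + 1) l l ν 0 (by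
        rw [S.tx1 l hl, if_neg (fun h => h2 (h.trans h1))]; simp) (zero_mem _)
      rw [this]; simp
  · simp [h1]

lemma F1o (l m : ℕ) (hl : l + 1 < n) (h1 : m ≠ l) (h2 : m ≠ l + 1) :
    S.T l * S.hh m = S.hh m * S.T l := by
  have := S.diag_twist l hl (fun ν => if cl i ν m = i then S.w m else 0)
    (fun ν => if cl i ν m = i then S.w m else 0) 0 (fun ν => by
      rw [cl_sw2 i l hl ν m h1 h2]
      split_ifs
      · have := S.w_comm m (S.T l) (S.t_T l).symm (S.tx2 l hl m h1 h2)
        rw [this.eq]; simp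
      · simp)
  unfold hh
  rw [this]; simp [diag]

lemma F3o (l m : ℕ) (hl : l + 1 < n) (h1 : m ≠ l) (h2 : m ≠ l + 1) :
    S.T l * S.Qh m = S.Qh m * S.T l := by
  have := S.diag_twist l hl (fun ν => Qel C i (cl i ν m) S.t (S.X m))
    (fun ν => Qel C i (cl i ν m) S.t (S.X m)) 0 (fun ν => by
      rw [cl_sw2 i l hl ν m h1 h2, Qel_twist C _ _ _ _ S.t (S.X m) (S.T l) (S.t_T l).symm.eq
        (S.tx2 l hl m h1 h2)]
      simp)
  unfold Qh
  rw [this]; simp [diag]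

lemma qqo (l m : ℕ) (hl : l + 1 < n) (h1 : m ≠ l) (h2 : m ≠ l + 1) :
    S.T l * S.qq m = S.qq m * S.T l := by
  unfold qq
  have a1 := S.F1o l m hl h1 h2
  have a2 := S.F3o l m hl h1 h2
  rw [mul_sub, sub_mul, a2, ← mul_assoc, a1, mul_assoc, a1, mul_assoc]

/-- on components with different colours, `τ_l x_a e(ν) = x_b τ_l e(ν)` propagates to `Q` -/
lemma Qel_ne_twist (a b l : ℕ) (j : I) (ν : Fin n → I)
    (h : (S.T l * S.X a - S.X b * S.T l) * S.e ν = 0) :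
    (S.T l * Qel C i j S.t (S.X a) - Qel C i j S.t (S.X b) * S.T l) * S.e ν = 0 := by
  have h1 : Commute (S.e ν) (S.X a) := S.PP_comm (S.e_mem ν) (S.X_mem a)
  have h2 : Commute (S.e ν) (S.t) := S.PP_comm (S.e_mem ν) (S.t_mem)
  have := Qel_twist C i j S.t (S.X a) S.t (S.X b) (S.T l * S.e ν)
    (by rw [mul_assoc, h2.eq, ← mul_assoc, ← mul_assoc, (S.t_T l).eq])
    (by rw [mul_assoc, h1.eq, ← mul_assoc, ← mul_assoc, ← sub_eq_zero, ← sub_mul, h])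
  rw [mul_assoc, (Qel_commute C i j _ _ _ h2 h1).eq, ← mul_assoc, ← mul_assoc] at this
  rw [sub_mul, this, sub_self]

lemma F3 (l : ℕ) (hl : l + 1 < n) :
    S.T l * S.Qh l = S.Qh (l + 1) * S.T l - S.DD l := by
  have hD : -S.DD l = S.diag (fun ν => -(if cl i ν l = cl i ν (l + 1) then
     Qdiff C (cl i ν l) i (S.X l) S.t (S.X (l + 1)) else 0)) := by
    simp [DD, diag]
  rw [sub_eq_add_neg, hD]
  refine S.diag_twist l hl _ _ _ fun ν => ?_
  rw [cl_sw1]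
  by_cases h : cl i ν l = cl i ν (l + 1)
  · rw [if_pos h, Qel_symm C _ _ _ _ (S.t_X l).eq, Qel_symm C _ _ _ _ (S.t_X (l + 1)).eq]
    rw [Qel_nil C (cl i ν l) i (S.X l) (S.X (l + 1)) S.t (S.T l) (S.e ν)]
    · simp
    · rw [S.tx0 l hl, if_pos h]
    · exact S.PP_comm (S.e_mem _) (S.X_mem _)
    · exact S.PP_comm (S.e_mem _) S.t_mem
    · exact (S.t_T l).symm
    · exact S.xx _ _
  · rw [if_neg h, S.Qel_ne_twist l (l + 1) l _ ν (by rw [S.tx0 l hl, if_neg h])]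
    simp

lemma Qdiff_swap (a b : I) (u v w : E) (h : Commute u w) :
    Qdiff C a b u v w = Qdiff C a b w v u := by
  unfold Qdiff
  split_ifs
  · rfl
  · refine Finset.sum_congr rfl fun p _ => Finset.sum_congr rfl fun q _ => ?_
    have : ∑ c ∈ Finset.range p, u ^ c * w ^ (p - 1 - c) =
        ∑ c ∈ Finset.range p, w ^ c * u ^ (p - 1 - c) := by
      rw [← Finset.sum_range_reflect]
      refine Finset.sum_congr rfl fun c hc => ?_
      have hc := Finset.mem_range.1 hc
      have : p - 1 - (p - 1 - c) = c := by omega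
      rw [this, (h.pow_pow _ _).eq]
    rw [this]

lemma F3' (l : ℕ) (hl : l + 1 < n) :
    S.T l * S.Qh (l + 1) = S.Qh l * S.T l + S.DD l := by
  refine S.diag_twist l hl _ _ _ fun ν => ?_
  rw [cl_sw0]
  by_cases h : cl i ν l = cl i ν (l + 1)
  · rw [if_pos h, Qel_symm C _ _ _ _ (S.t_X l).eq, Qel_symm C _ _ _ _ (S.t_X (l + 1)).eq]
    have := Qel_nil C (cl i ν (l + 1)) i (S.X (l + 1)) (S.X l) S.t (-S.T l) (S.e ν) (by
        have h0 := (S.tx1 l hl ν).trans (if_pos h)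
        have h1 : (-S.T l * S.X (l + 1) - S.X l * -S.T l) * S.e ν =
          -((S.T l * S.X (l + 1) - S.X l * S.T l) * S.e ν) := by noncomm_ring
        rw [h1, h0])
      (S.PP_comm (S.e_mem _) (S.X_mem _)) (S.PP_comm (S.e_mem _) S.t_mem) (S.t_T l).symm.neg_left
      (S.xx _ _)
    rw [h, Qdiff_swap _ _ _ _ _ (S.xx _ _)]
    rw [← neg_inj, ← this]; noncomm_ring
  · rw [if_neg h, S.Qel_ne_twist (l + 1) l l _ ν (by rw [S.tx1 l hl, if_neg h])]
    simp

lemma F2a (l : ℕ) (hl : l + 1 < n) :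
    S.hh (l + 1) * (S.Qh l - S.T l * S.T l) = S.diag (fun ν => if cl i ν (l + 1) = i then
      Qdiff C i (cl i ν l) S.t (S.X l) (S.X (l + 1)) else 0) := by
  refine S.ext_e fun ν => ?_
  rw [diag_mul_e, mul_assoc, sub_mul, ← pow_two, S.tsq l hl]
  unfold Qh
  rw [diag_mul_e, ← sub_mul]
  have hm : Qel C i (cl i ν l) S.t (S.X l) - Qel C (cl i ν l) (cl i ν (l + 1)) (S.X l) (S.X (l + 1))
    ∈ S.PP := sub_mem (S.Qel_mem _ _ S.t_mem (S.X_mem _)) (S.Qel_mem _ _ (S.X_mem _) (S.X_mem _))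
  rw [(S.PP_comm hm (S.e_mem ν)).eq, ← mul_assoc]
  unfold hh
  rw [diag_mul_e, mul_assoc, ← (S.PP_comm hm (S.e_mem ν)).eq, ← mul_assoc]
  split_ifs with h
  · congr 1
    rw [h, Qel_symm C (cl i ν l) i _ _ (S.xx _ _), ← Qdiff_mul, ← mul_assoc, S.w_l, one_mul]
    exact S.t_X _
  · simp

lemma F2b (l : ℕ) (hl : l + 1 < n) :
    S.hh l * (S.Qh (l + 1) - S.T l * S.T l) = S.diag (fun ν => if cl i ν l = i then
      Qdiff C i (cl i ν (l + 1)) (S.X l) (S.X (l + 1)) S.t else 0) := by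
  refine S.ext_e fun ν => ?_
  rw [diag_mul_e, mul_assoc, sub_mul, ← pow_two, S.tsq l hl]
  unfold Qh
  rw [diag_mul_e, ← sub_mul]
  have hm : Qel C i (cl i ν (l + 1)) S.t (S.X (l + 1)) -
      Qel C (cl i ν l) (cl i ν (l + 1)) (S.X l) (S.X (l + 1))
    ∈ S.PP := sub_mem (S.Qel_mem _ _ S.t_mem (S.X_mem _)) (S.Qel_mem _ _ (S.X_mem _) (S.X_mem _))
  rw [(S.PP_comm hm (S.e_mem ν)).eq, ← mul_assoc]
  unfold hh
  rw [diag_mul_e, mul_assoc, ← (S.PP_comm hm (S.e_mem ν)).eq, ← mul_assoc]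
  split_ifs with h
  · congr 1
    rw [h, Qdiff_swap _ _ _ _ _ (S.t_X l).symm, ← Qdiff_mul, ← mul_assoc, S.w_l, one_mul]
    exact S.t_X _
  · simp

end Sh

end KLRProof

namespace KLRProof

set_option linter.unusedSectionVars false
set_option linter.unusedSimpArgs false

section abstractBraid

variable {E : Type} [Ring E]

/-- the noncommutative identities behind the braid relation -/
lemma braid_ids (T h h' Q Q' D : E)
    (r1 : T * h = h' * T - h * h') (r2 : T * h' = h * T + h * h')
    (r3 : T * Q = Q' * T - D) (r4 : T * Q' = Q * T + D)
    (c1 : h' * h = h * h') (c2 : Q * h = h * Q) (c3 : Q * h' = h' * Q) (c4 : Q' * h = h * Q')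
    (c5 : Q' * h' = h' * Q') (c6 : Q' * Q = Q * Q') (c7 : D * h = h * D) (c8 : D * h' = h' * D)
    (c9 : D * Q = Q * D) (c10 : D * Q' = Q' * D) :
    (-(T * h * T) + (Q - h * h) * h' - h * T * h = h' * (Q - T * T)) ∧
    (-(T * (Q - h * h) * h') + h * T * (Q - h * h) + (Q - h * h) * h' * h = 0) ∧
    (T * (Q - h * h) * (Q' - h' * h') - (Q - h * h) * (Q' - h' * h') * T = 0) ∧
    ((Q' - h' * h') * T - T * (Q - h * h) + h' * h * h' + h * h' * h = D) ∧
    ((Q' - h' * h') * T * h' - h' * h * (Q' - h' * h') - h * (Q' - h' * h') * T = 0) ∧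
    (h * (Q' - h' * h') + h' * T * h' - T * h' * T = h * (Q' - T * T)) := by
  have a1 : ∀ z, T * (h * z) = h' * (T * z) - h * (h' * z) := fun z => by
    rw [← mul_assoc, r1]; noncomm_ring
  have a2 : ∀ z, T * (h' * z) = h * (T * z) + h * (h' * z) := fun z => by
    rw [← mul_assoc, r2]; noncomm_ring
  have a3 : ∀ z, T * (Q * z) = Q' * (T * z) - D * z := fun z => by
    rw [← mul_assoc, r3]; noncomm_ring
  have a4 : ∀ z, T * (Q' * z) = Q * (T * z) + D * z := fun z => by
    rw [← mul_assoc, r4]; noncomm_ring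
  have d1 : ∀ z, h' * (h * z) = h * (h' * z) := fun z => by rw [← mul_assoc, c1, mul_assoc]
  have d2 : ∀ z, Q * (h * z) = h * (Q * z) := fun z => by rw [← mul_assoc, c2, mul_assoc]
  have d3 : ∀ z, Q * (h' * z) = h' * (Q * z) := fun z => by rw [← mul_assoc, c3, mul_assoc]
  have d4 : ∀ z, Q' * (h * z) = h * (Q' * z) := fun z => by rw [← mul_assoc, c4, mul_assoc]
  have d5 : ∀ z, Q' * (h' * z) = h' * (Q' * z) := fun z => by rw [← mul_assoc, c5, mul_assoc]
  have d6 : ∀ z, Q' * (Q * z) = Q * (Q' * z) := fun z => by rw [← mul_assoc, c6, mul_assoc]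
  have d7 : ∀ z, D * (h * z) = h * (D * z) := fun z => by rw [← mul_assoc, c7, mul_assoc]
  have d8 : ∀ z, D * (h' * z) = h' * (D * z) := fun z => by rw [← mul_assoc, c8, mul_assoc]
  have d9 : ∀ z, D * (Q * z) = Q * (D * z) := fun z => by rw [← mul_assoc, c9, mul_assoc]
  have d10 : ∀ z, D * (Q' * z) = Q' * (D * z) := fun z => by rw [← mul_assoc, c10, mul_assoc]
  have key : h * (h' * Q') - h' * D = h * (h' * Q) - h * D := by
    have e1 : T * (Q * h') = T * (h' * Q) := by rw [c3]
    rw [a3, a2, r2, r3] at e1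
    simp only [mul_add, mul_sub, d4, c8, c5] at e1
    have e2 : h * (Q' * T) + h * (h' * Q') - h' * D = h * (Q' * T) - h * D + h * (h' * Q) := e1
    calc h * (h' * Q') - h' * D
        = (h * (Q' * T) + h * (h' * Q') - h' * D) - h * (Q' * T) := by abel
      _ = _ := by rw [e2]; abel
  refine ⟨?_, ?_, ?_, ?_, ?_, ?_⟩
  on_goal 2 =>
    have e3 : -(h * (h' * Q')) + h' * D - h * D + h * (h' * Q) = 0 := by
      calc _ = -(h * (h' * Q') - h' * D) + (h * (h' * Q) - h * D) := by abel
        _ = 0 := by rw [key]; abel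
    simp only [mul_add, add_mul, mul_sub, sub_mul, mul_assoc, mul_neg, neg_mul,
      r1, r2, r3, r4, c1, c2, c3, c4, c5, c6, c7, c8, c9, c10,
      a1, a2, a3, a4, d1, d2, d3, d4, d5, d6, d7, d8, d9, d10]
    rw [← e3]
    abel
  all_goals
    simp only [mul_add, add_mul, mul_sub, sub_mul, mul_assoc, mul_neg, neg_mul,
      r1, r2, r3, r4, c1, c2, c3, c4, c5, c6, c7, c8, c9, c10,
      a1, a2, a3, a4, d1, d2, d3, d4, d5, d6, d7, d8, d9, d10]
    abel

end abstractBraid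

open KLR

variable {k : Type} [Field k] {I : Type} [Fintype I] [DecidableEq I]

namespace Sh

variable {C : CartanDatum k I} {n : ℕ} {i : I} {E : Type} [Ring E] [Algebra k E]
  (S : Sh C n i E)

lemma braid_all (l : ℕ) (hl : l + 1 < n) :
    (-(S.T l * S.hh l * S.T l) + S.qq l * S.hh (l + 1) - S.hh l * S.T l * S.hh l
      = S.hh (l + 1) * (S.Qh l - S.T l * S.T l)) ∧
    (-(S.T l * S.qq l * S.hh (l + 1)) + S.hh l * S.T l * S.qq l
      + S.qq l * S.hh (l + 1) * S.hh l = 0) ∧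
    (S.T l * S.qq l * S.qq (l + 1) - S.qq l * S.qq (l + 1) * S.T l = 0) ∧
    (S.qq (l + 1) * S.T l - S.T l * S.qq l + S.hh (l + 1) * S.hh l * S.hh (l + 1)
      + S.hh l * S.hh (l + 1) * S.hh l = S.DD l) ∧
    (S.qq (l + 1) * S.T l * S.hh (l + 1) - S.hh (l + 1) * S.hh l * S.qq (l + 1)
      - S.hh l * S.qq (l + 1) * S.T l = 0) ∧
    (S.hh l * S.qq (l + 1) + S.hh (l + 1) * S.T l * S.hh (l + 1)
      - S.T l * S.hh (l + 1) * S.T l = S.hh l * (S.Qh (l + 1) - S.T l * S.T l)) :=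
  braid_ids _ _ _ _ _ _ (S.F1 l hl) (S.F1' l hl) (S.F3 l hl) (S.F3' l hl)
    (S.PP_comm (S.hh_mem _) (S.hh_mem _)) (S.PP_comm (S.Qh_mem _) (S.hh_mem _))
    (S.PP_comm (S.Qh_mem _) (S.hh_mem _)) (S.PP_comm (S.Qh_mem _) (S.hh_mem _))
    (S.PP_comm (S.Qh_mem _) (S.hh_mem _)) (S.PP_comm (S.Qh_mem _) (S.Qh_mem _))
    (S.PP_comm (S.DD_mem _) (S.hh_mem _)) (S.PP_comm (S.DD_mem _) (S.hh_mem _))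
    (S.PP_comm (S.DD_mem _) (S.Qh_mem _)) (S.PP_comm (S.DD_mem _) (S.Qh_mem _))

end Sh

end KLRProof

namespace KLRProof

set_option linter.unusedSectionVars false
set_option linter.unusedSimpArgs false

open KLR

variable {k : Type} [Field k] {I : Type} [Fintype I] [DecidableEq I]

/-- delete the entry at position `a`. -/
def del (i : I) {n : ℕ} (ν : Fin (n + 1) → I) (a : ℕ) : Fin n → I :=
  fun b => cl i ν (if b.1 < a then b.1 else b.1 + 1)

lemma cl_del_lt (i : I) {n : ℕ} (ν : Fin (n + 1) → I) (a b : ℕ) (h : b < a) (ha : a ≤ n) :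
    cl i (del i ν a) b = cl i ν b := by
  rw [cl_of_lt _ _ _ (by omega : b < n)]
  simp [del, h]

lemma cl_del_ge (i : I) {n : ℕ} (ν : Fin (n + 1) → I) (a b : ℕ) (h : a ≤ b) :
    cl i (del i ν a) b = cl i ν (b + 1) := by
  by_cases hb : b < n
  · rw [cl_of_lt _ _ _ hb]
    simp [del, Nat.not_lt.2 h]
  · simp [cl, hb]

lemma cl_ext (i : I) {n : ℕ} {ν ν' : Fin n → I} (h : ∀ b, b < n → cl i ν b = cl i ν' b) :
    ν = ν' := by
  funext b
  have := h b.1 b.2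
  rwa [cl_of_lt _ _ _ b.2, cl_of_lt _ _ _ b.2] at this

lemma cl_del (i : I) {n : ℕ} (ν : Fin (n + 1) → I) (a b : ℕ) (ha : a ≤ n) :
    cl i (del i ν a) b = cl i ν (if b < a then b else b + 1) := by
  split_ifs with h
  · exact cl_del_lt i ν a b h ha
  · exact cl_del_ge i ν a b (by omega)

lemma cl_sw (i : I) {n : ℕ} (l : ℕ) (h : l + 1 < n) (ν : Fin n → I) (m : ℕ) :
    cl i (sw l h ν) m = cl i ν (if m = l then l + 1 else if m = l + 1 then l else m) := by
  split_ifs with h1 h2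
  · subst h1; exact cl_sw0 _ _ h _
  · subst h2; exact cl_sw1 _ _ h _
  · exact cl_sw2 _ _ h _ _ h1 h2

lemma del_sw_lt (i : I) {n : ℕ} (ν : Fin (n + 1) → I) (a l : ℕ) (hl : l + 1 + 1 < n + 1)
    (hl' : l + 1 < n) (h : a < l + 1) :
    del i (sw (l + 1) hl ν) a = sw l hl' (del i ν a) := by
  refine cl_ext i fun b hb => ?_
  rw [cl_del _ _ _ _ (by omega), cl_sw, cl_sw, cl_del _ _ _ _ (by omega)]
  congr 1
  split_ifs <;> omega

lemma del_sw_gt (i : I) {n : ℕ} (ν : Fin (n + 1) → I) (a l : ℕ) (hl : l + 1 < n + 1)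
    (hl' : l + 1 < n) (h : l + 1 < a) (ha : a ≤ n) :
    del i (sw l hl ν) a = sw l hl' (del i ν a) := by
  refine cl_ext i fun b hb => ?_
  rw [cl_del _ _ _ _ (by omega), cl_sw, cl_sw, cl_del _ _ _ _ (by omega)]
  congr 1
  split_ifs <;> omega

lemma del_sw_0 (i : I) {n : ℕ} (ν : Fin (n + 1) → I) (l : ℕ) (hl : l + 1 < n + 1) :
    del i (sw l hl ν) l = del i ν (l + 1) := by
  refine cl_ext i fun b hb => ?_
  rw [cl_del _ _ _ _ (by omega), cl_sw, cl_del _ _ _ _ (by omega)]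
  congr 1
  split_ifs <;> omega

lemma del_sw_1 (i : I) {n : ℕ} (ν : Fin (n + 1) → I) (l : ℕ) (hl : l + 1 < n + 1) :
    del i (sw l hl ν) (l + 1) = del i ν l := by
  refine cl_ext i fun b hb => ?_
  rw [cl_del _ _ _ _ (by omega), cl_sw, cl_del _ _ _ _ (by omega)]
  congr 1
  split_ifs <;> omega

lemma del_eq (i : I) {n : ℕ} (ν : Fin (n + 1) → I) (l : ℕ) (hl : l + 1 < n + 1)
    (h : cl i ν l = cl i ν (l + 1)) : del i ν l = del i ν (l + 1) := by
  refine cl_ext i fun b hb => ?_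
  rw [cl_del _ _ _ _ (by omega), cl_del _ _ _ _ (by omega)]
  by_cases h1 : b < l
  · rw [if_pos h1, if_pos (by omega)]
  · by_cases h2 : b = l
    · subst h2; simp [h]
    · rw [if_neg h1, if_neg (by omega)]

lemma del_inj (i : I) {n : ℕ} (ν ν' : Fin (n + 1) → I) (a : ℕ) (ha : a ≤ n)
    (h : del i ν a = del i ν' a) (h1 : cl i ν a = cl i ν' a) : ν = ν' := by
  refine cl_ext i fun b hb => ?_
  rcases lt_trichotomy b a with h2 | h2 | h2
  · have := congrFun h ⟨b, by omega⟩
    simpa [del, h2] using this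
  · subst h2; exact h1
  · have := congrFun h ⟨b - 1, by omega⟩
    have e1 : ¬ (b - 1 < a) := by omega
    have e2 : b - 1 + 1 = b := by omega
    simpa [del, e1, e2] using this

namespace Sh

variable {C : CartanDatum k I} {n : ℕ} {i : I} {V : Type} [AddCommGroup V] [Module k V]
  (S : Sh C n i (Module.End k V))

/-- action of `e(ν)`. -/
def eN (ν : Fin (n + 1) → I) (f : ℕ → V) (a : ℕ) : V :=
  if a ≤ n ∧ cl i ν a = i then S.e (del i ν a) (f a) else 0

/-- coefficient of the action of `x_c`. -/
def XX (a c : ℕ) : Module.End k V := if c < a then S.X c else if c = a then S.t else S.X (c - 1)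

/-- action of `x_c`. -/
def XN (c : ℕ) (f : ℕ → V) (a : ℕ) : V := S.XX a c (f a)

/-- action of `τ_l`. -/
def TN (l : ℕ) (f : ℕ → V) (a : ℕ) : V :=
  if a < l then S.T (l - 1) (f a)
  else if a = l then - S.hh l (f l) + S.qq l (f (l + 1))
  else if a = l + 1 then f l + S.hh l (f (l + 1))
  else S.T l (f a)

lemma TN_lt (l : ℕ) (f : ℕ → V) (a : ℕ) (h : a < l) : S.TN l f a = S.T (l - 1) (f a) := by
  simp [TN, h]
lemma TN_0 (l : ℕ) (f : ℕ → V) : S.TN l f l = - S.hh l (f l) + S.qq l (f (l + 1)) := by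
  simp [TN]
lemma TN_1 (l : ℕ) (f : ℕ → V) : S.TN l f (l + 1) = f l + S.hh l (f (l + 1)) := by
  simp [TN]
lemma TN_gt (l : ℕ) (f : ℕ → V) (a : ℕ) (h : l + 1 < a) : S.TN l f a = S.T l (f a) := by
  unfold TN
  rw [if_neg (by omega), if_neg (by omega), if_neg (by omega)]

lemma XX_lt (a c : ℕ) (h : c < a) : S.XX a c = S.X c := by simp [XX, h]
lemma XX_eq (a : ℕ) : S.XX a a = S.t := by simp [XX]
lemma XX_gt (a c : ℕ) (h : a < c) : S.XX a c = S.X (c - 1) := by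
  unfold XX; rw [if_neg (by omega), if_neg (by omega)]
lemma XX_mem (a c : ℕ) : S.XX a c ∈ S.PP := by
  unfold XX
  split_ifs
  · exact S.X_mem _
  · exact S.t_mem
  · exact S.X_mem _

lemma app {A B : Module.End k V} (h : A = B) (v : V) : A v = B v := by rw [h]
lemma app2 {A B A' B' : Module.End k V} (h : A * B = A' * B') (v : V) : A (B v) = A' (B' v) :=
  app h v

lemma hh_e (l : ℕ) (μ : Fin n → I) :
    S.hh l * S.e μ = if cl i μ l = i then S.w l * S.e μ else 0 := by
  unfold hh
  rw [diag_mul_e]; split_ifs <;> simp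

lemma ee_N (ν ν' : Fin (n + 1) → I) (f : ℕ → V) (a : ℕ) :
    S.eN ν (S.eN ν' f) a = if ν = ν' then S.eN ν f a else 0 := by
  unfold eN
  by_cases h : ν = ν'
  · subst h
    by_cases h1 : a ≤ n ∧ cl i ν a = i
    · simp only [h1, and_self, if_true]
      have := app2 (show S.e (del i ν a) * S.e (del i ν a) = 1 * S.e (del i ν a) by
        rw [S.ee]; simp) (f a)
      simpa using this
    · simp [h1]
  · rw [if_neg h]
    by_cases h1 : a ≤ n ∧ cl i ν a = i
    · by_cases h2 : cl i ν' a = i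
      · have h3 : del i ν a ≠ del i ν' a := fun h3 => h (del_inj i ν ν' a h1.1 h3 (h1.2.trans h2.symm))
        simp only [h1, h2, and_self, if_true]
        have := app2 (show S.e (del i ν a) * S.e (del i ν' a) = 0 * 0 by
          rw [S.ee]; simp [h3]) (f a)
        simpa using this
      · simp [h2]
    · simp [h1]

lemma xx_N (c d : ℕ) (f : ℕ → V) : S.XN c (S.XN d f) = S.XN d (S.XN c f) := by
  funext a
  exact app2 (S.PP_comm (S.XX_mem a c) (S.XX_mem a d)) (f a)

lemma xe_N (c : ℕ) (ν) (f : ℕ → V) : S.XN c (S.eN ν f) = S.eN ν (S.XN c f) := by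
  funext a
  unfold eN XN
  by_cases h : a ≤ n ∧ cl i ν a = i
  · simp only [if_pos h]
    exact app2 (S.PP_comm (S.XX_mem a c) (S.e_mem _)) (f a)
  · simp only [if_neg h, map_zero]

lemma te_N (l : ℕ) (hl : l + 1 < n + 1) (ν) (f : ℕ → V) (a : ℕ) (ha : a ≤ n) :
    S.TN l (S.eN ν f) a = S.eN (sw l hl ν) (S.TN l f) a := by
  rcases lt_trichotomy a l with h | h | h
  · obtain ⟨l, rfl⟩ : ∃ l', l = l' + 1 := ⟨l - 1, by omega⟩
    have hl' : l + 1 < n := by omega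
    rw [S.TN_lt _ _ _ h]
    unfold eN
    rw [cl_sw2 _ _ _ _ _ (by omega) (by omega), S.TN_lt _ _ _ h, Nat.add_sub_cancel]
    split_ifs with h1
    · rw [del_sw_lt i ν a l hl hl' h]
      exact app2 (S.te l hl' _) (f a)
    · simp
  · subst h
    rw [TN_0]
    have e1 : a + 1 ≤ n := by omega
    simp only [eN, ha, e1, true_and, cl_sw0, del_sw_0, TN_0]
    have k1 : ∀ v, S.qq a (S.e (del i ν (a + 1)) v) = S.e (del i ν (a + 1)) (S.qq a v) :=
      fun v => app2 (S.PP_comm (S.qq_mem _) (S.e_mem _)) v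
    have k2 : ∀ v, S.hh a (S.e (del i ν (a + 1)) v) = S.e (del i ν (a + 1)) (S.hh a v) :=
      fun v => app2 (S.PP_comm (S.hh_mem _) (S.e_mem _)) v
    have z1 : cl i ν (a + 1) ≠ i → ∀ v, S.hh a (S.e (del i ν a) v) = 0 := fun h v => by
      have := app (S.hh_e a (del i ν a)) v
      rwa [cl_del_ge _ _ _ _ le_rfl, if_neg h] at this
    have z2 : cl i ν a ≠ i → ∀ v, S.hh a (S.e (del i ν (a + 1)) v) = 0 := fun h v => by
      have := app (S.hh_e a (del i ν (a + 1))) v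
      rwa [cl_del_lt _ _ _ _ (by omega) (by omega), if_neg h] at this
    by_cases h1 : cl i ν a = i <;> by_cases h2 : cl i ν (a + 1) = i
    · simp only [h1, h2, if_true]
      rw [del_eq i ν a hl (h1.trans h2.symm), k1, k2]; simp
    · simp [h1, h2, z1]
    · simp [h1, h2, k1, ← k2, z2]
    · simp [h1, h2]
  · by_cases h' : a = l + 1
    · subst h'
      rw [TN_1]
      have e1 : l ≤ n := by omega
      simp only [eN, ha, e1, true_and, cl_sw1, del_sw_1, TN_1]
      have k2 : ∀ v, S.hh l (S.e (del i ν l) v) = S.e (del i ν l) (S.hh l v) :=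
        fun v => app2 (S.PP_comm (S.hh_mem _) (S.e_mem _)) v
      have z1 : cl i ν (l + 1) ≠ i → ∀ v, S.hh l (S.e (del i ν l) v) = 0 := fun h v => by
        have := app (S.hh_e l (del i ν l)) v
        rwa [cl_del_ge _ _ _ _ le_rfl, if_neg h] at this
      have z2 : cl i ν l ≠ i → ∀ v, S.hh l (S.e (del i ν (l + 1)) v) = 0 := fun h v => by
        have := app (S.hh_e l (del i ν (l + 1))) v
        rwa [cl_del_lt _ _ _ _ (by omega) (by omega), if_neg h] at this
      by_cases h1 : cl i ν l = i <;> by_cases h2 : cl i ν (l + 1) = i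
      · simp only [h1, h2, if_true]
        rw [← del_eq i ν l hl (h1.trans h2.symm), k2]; simp
      · simp [h1, h2, ← k2, z1]
      · simp [h1, h2, z2]
      · simp [h1, h2]
    · have h : l + 1 < a := by omega
      have hl' : l + 1 < n := by omega
      rw [S.TN_gt _ _ _ h]
      unfold eN
      rw [cl_sw2 _ _ _ _ _ (by omega) (by omega), S.TN_gt _ _ _ h]
      split_ifs with h1
      · rw [del_sw_gt i ν a l hl hl' h ha]
        exact app2 (S.te l hl' _) (f a)
      · simp

lemma tt_N_aux (l l' : ℕ) (hl : l' + 1 < n + 1) (h : l + 1 < l')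
    (f : ℕ → V) (a : ℕ) (ha : a ≤ n) :
    S.TN l (S.TN l' f) a = S.TN l' (S.TN l f) a := by
  by_cases h1 : a < l
  · rw [S.TN_lt _ _ _ h1, S.TN_lt l' _ _ (by omega), S.TN_lt l' _ _ (by omega), S.TN_lt _ _ _ h1]
    exact app2 (S.tt _ _ (by omega) (by omega) (by omega)) _
  by_cases h2 : a = l
  · subst h2
    rw [TN_0, S.TN_lt l' _ _ (by omega), S.TN_lt l' _ _ (by omega), S.TN_lt l' _ _ (by omega), TN_0,
      map_add, map_neg]
    rw [app2 (S.F1o (l' - 1) a (by omega) (by omega) (by omega)) (f a),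
      app2 (S.qqo (l' - 1) a (by omega) (by omega) (by omega)) _]
  by_cases h3 : a = l + 1
  · subst h3
    rw [TN_1, S.TN_lt l' _ _ (by omega), S.TN_lt l' _ _ (by omega), S.TN_lt l' _ _ (by omega), TN_1,
      map_add]
    rw [app2 (S.F1o (l' - 1) l (by omega) (by omega) (by omega)) _]
  rw [S.TN_gt l _ _ (by omega)]
  by_cases h4 : a < l'
  · rw [S.TN_lt l' _ _ (by omega), S.TN_lt l' _ _ (by omega), S.TN_gt l _ _ (by omega)]
    exact app2 (S.tt _ _ (by omega) (by omega) (by omega)) _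
  by_cases h5 : a = l'
  · subst h5
    rw [TN_0, TN_0, S.TN_gt l _ _ (by omega), S.TN_gt l _ _ (by omega),
      map_add, map_neg]
    rw [app2 (S.F1o l a (by omega) (by omega) (by omega)) (f a),
      app2 (S.qqo l a (by omega) (by omega) (by omega)) _]
  by_cases h6 : a = l' + 1
  · subst h6
    rw [TN_1, TN_1, S.TN_gt l _ _ (by omega), S.TN_gt l _ _ (by omega), map_add]
    rw [app2 (S.F1o l l' (by omega) (by omega) (by omega)) _]
  · rw [S.TN_gt l' _ _ (by omega), S.TN_gt l' _ _ (by omega), S.TN_gt l _ _ (by omega)]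
    exact app2 (S.tt _ _ (by omega) (by omega) (by omega)) _

lemma eN_pos {ν : Fin (n + 1) → I} {a : ℕ} (f : ℕ → V) (h : a ≤ n) (h1 : cl i ν a = i) :
    S.eN ν f a = S.e (del i ν a) (f a) := by simp [eN, h, h1]

end Sh

end KLRProof

namespace KLRProof

set_option linter.unusedSectionVars false
set_option linter.unusedSimpArgs false

open KLR

variable {k : Type} [Field k] {I : Type} [Fintype I] [DecidableEq I]

namespace Sh

variable {C : CartanDatum k I} {n : ℕ} {i : I} {V : Type} [AddCommGroup V] [Module k V]
  (S : Sh C n i (Module.End k V))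

lemma eN_cases (ν : Fin (n + 1) → I) (f : ℕ → V) (a : ℕ) :
    S.eN ν f a = 0 ∨ (a ≤ n ∧ cl i ν a = i ∧ S.eN ν f a = S.e (del i ν a) (f a)) := by
  by_cases h : a ≤ n ∧ cl i ν a = i
  · right; exact ⟨h.1, h.2, by simp [eN, h]⟩
  · left; simp [eN, h]

lemma tsq_N0 (l : ℕ) (f : ℕ → V) :
    S.TN l (S.TN l f) l = S.Qh l (f l) := by
  rw [TN_0, TN_0, TN_1]
  have h1 : S.hh l (S.qq l (f (l + 1))) = S.qq l (S.hh l (f (l + 1))) :=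
    app2 (S.PP_comm (S.hh_mem _) (S.qq_mem _)) _
  have h2 : S.qq l (f l) = S.Qh l (f l) - S.hh l (S.hh l (f l)) := rfl
  simp only [map_add, map_neg, h1, h2]
  abel

lemma tsq_N1 (l : ℕ) (f : ℕ → V) :
    S.TN l (S.TN l f) (l + 1) = S.Qh l (f (l + 1)) := by
  rw [TN_1, TN_0, TN_1]
  have h2 : ∀ v, S.qq l v = S.Qh l v - S.hh l (S.hh l v) := fun _ => rfl
  simp only [map_add, map_neg, h2]
  abel

lemma tsq_N (l : ℕ) (hl : l + 1 < n + 1) (ν) (f : ℕ → V) (a : ℕ) (ha : a ≤ n) :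
    S.TN l (S.TN l (S.eN ν f)) a =
      Qel C (cl i ν l) (cl i ν (l + 1)) (S.XX a l) (S.XX a (l + 1)) (S.eN ν f a) := by
  by_cases h1 : a < l
  · obtain ⟨l, rfl⟩ : ∃ l', l = l' + 1 := ⟨l - 1, by omega⟩
    rw [S.TN_lt _ _ _ h1, S.TN_lt _ _ _ h1, S.XX_gt _ _ (by omega), S.XX_gt _ _ (by omega)]
    rcases S.eN_cases ν f a with h | ⟨_, h2, h⟩
    · rw [h]; simp
    · rw [h, ← cl_del_ge i ν a l (by omega), ← cl_del_ge i ν a (l + 1) (by omega)]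
      have := app (S.tsq l (by omega) (del i ν a)) (f a)
      rw [pow_two] at this
      exact this
  by_cases h2 : a = l
  · subst h2
    rw [tsq_N0, XX_eq, XX_gt _ _ _ (by omega)]
    rcases S.eN_cases ν f a with h | ⟨_, h2, h⟩
    · rw [h]; simp
    · rw [h, h2, ← cl_del_ge i ν a a le_rfl]
      exact app (S.diag_mul_e _ _) (f a)
  by_cases h3 : a = l + 1
  · subst h3
    rw [tsq_N1, XX_eq, XX_lt _ _ _ (by omega)]
    rcases S.eN_cases ν f (l + 1) with h | ⟨_, h2, h⟩
    · rw [h]; simp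
    · rw [h, h2, ← cl_del_lt i ν (l + 1) l (by omega) ha, Qel_symm C _ _ _ _ (S.t_X _).symm]
      exact app (S.diag_mul_e _ _) _
  · rw [S.TN_gt _ _ _ (by omega), S.TN_gt _ _ _ (by omega), S.XX_lt _ _ (by omega),
      S.XX_lt _ _ (by omega)]
    rcases S.eN_cases ν f a with h | ⟨_, h2, h⟩
    · rw [h]; simp
    · rw [h, ← cl_del_lt i ν a l (by omega) ha, ← cl_del_lt i ν a (l + 1) (by omega) ha]
      have := app (S.tsq l (by omega) (del i ν a)) (f a)
      rw [pow_two] at this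
      exact this

lemma hh_inv (l : ℕ) (μ : Fin n → I) (v : V) :
    S.hh l (S.t (S.e μ v)) - S.hh l (S.X l (S.e μ v)) =
      if cl i μ l = i then S.e μ v else 0 := by
  have h1 : S.hh l * (S.t - S.X l) * S.e μ = if cl i μ l = i then S.e μ else 0 := by
    rw [(S.PP_comm (S.hh_mem l) (sub_mem S.t_mem (S.X_mem l))).eq, mul_assoc, hh_e]
    split_ifs
    · rw [← mul_assoc, S.w_r, one_mul]
    · simp
  have := app h1 v
  rw [Module.End.mul_apply, Module.End.mul_apply, LinearMap.sub_apply, map_sub] at this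
  rw [this]; split_ifs <;> rfl

lemma tx0_N (l : ℕ) (hl : l + 1 < n + 1) (ν) (f : ℕ → V) (a : ℕ) (ha : a ≤ n) :
    S.TN l (S.XN l (S.eN ν f)) a - S.XN (l + 1) (S.TN l (S.eN ν f)) a =
      if cl i ν l = cl i ν (l + 1) then - S.eN ν f a else 0 := by
  unfold XN
  by_cases h1 : a < l
  · obtain ⟨l, rfl⟩ : ∃ l', l = l' + 1 := ⟨l - 1, by omega⟩
    rw [S.TN_lt _ _ _ h1, S.TN_lt _ _ _ h1, S.XX_gt _ _ (by omega), S.XX_gt _ _ (by omega)]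
    rcases S.eN_cases ν f a with h | ⟨_, h2, h⟩
    · rw [h]; simp
    · rw [h, ← cl_del_ge i ν a l (by omega), ← cl_del_ge i ν a (l + 1) (by omega)]
      have := app (S.tx0 l (by omega) (del i ν a)) (f a)
      split_ifs at this ⊢ <;> exact this
  by_cases h2 : a = l
  · subst h2
    rw [TN_0, TN_0, XX_eq, S.XX_gt a (a + 1) (by omega), S.XX_lt (a + 1) a (by omega), Nat.add_sub_cancel,
      map_add, map_neg]
    rw [app2 (S.PP_comm (S.X_mem a) (S.qq_mem a)) _, app2 (S.PP_comm (S.X_mem a) (S.hh_mem a)) _]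
    rcases S.eN_cases ν f a with h | ⟨_, h2, h⟩
    · rw [h]; simp
    · have := S.hh_inv a (del i ν a) (f a)
      rw [← h, cl_del_ge i ν a a le_rfl] at this
      rw [h2]
      simp only [eq_comm (a := i)]
      have e : (if cl i ν (a + 1) = i then - S.eN ν f a else 0) =
        - (if cl i ν (a + 1) = i then S.eN ν f a else 0) := by split_ifs <;> simp
      rw [e, ← this]; abel
  by_cases h3 : a = l + 1
  · subst h3
    rw [TN_1, TN_1, XX_eq, XX_eq, XX_lt _ _ _ (by omega), map_add]
    rw [app2 (S.PP_comm S.t_mem (S.hh_mem l)) _]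
    rcases S.eN_cases ν f (l + 1) with h | ⟨_, h2, h⟩
    · rw [h]; simp
    · have := S.hh_inv l (del i ν (l + 1)) (f (l + 1))
      rw [← h, cl_del_lt i ν (l + 1) l (by omega) (by omega)] at this
      rw [h2]
      have e : (if cl i ν l = i then - S.eN ν f (l + 1) else 0) =
        - (if cl i ν l = i then S.eN ν f (l + 1) else 0) := by split_ifs <;> simp
      rw [e, ← this]; abel
  · rw [S.TN_gt _ _ _ (by omega), S.TN_gt _ _ _ (by omega), S.XX_lt _ _ (by omega),
      S.XX_lt _ _ (by omega)]
    rcases S.eN_cases ν f a with h | ⟨_, h2, h⟩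
    · rw [h]; simp
    · rw [h, ← cl_del_lt i ν a l (by omega) ha, ← cl_del_lt i ν a (l + 1) (by omega) ha]
      have := app (S.tx0 l (by omega) (del i ν a)) (f a)
      split_ifs at this ⊢ <;> exact this

lemma tx1_N (l : ℕ) (hl : l + 1 < n + 1) (ν) (f : ℕ → V) (a : ℕ) (ha : a ≤ n) :
    S.TN l (S.XN (l + 1) (S.eN ν f)) a - S.XN l (S.TN l (S.eN ν f)) a =
      if cl i ν l = cl i ν (l + 1) then S.eN ν f a else 0 := by
  unfold XN
  by_cases h1 : a < l
  · obtain ⟨l, rfl⟩ : ∃ l', l = l' + 1 := ⟨l - 1, by omega⟩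
    rw [S.TN_lt _ _ _ h1, S.TN_lt _ _ _ h1, S.XX_gt _ _ (by omega), S.XX_gt _ _ (by omega)]
    rcases S.eN_cases ν f a with h | ⟨_, h2, h⟩
    · rw [h]; simp
    · rw [h, ← cl_del_ge i ν a l (by omega), ← cl_del_ge i ν a (l + 1) (by omega)]
      have := app (S.tx1 l (by omega) (del i ν a)) (f a)
      split_ifs at this ⊢ <;> exact this
  by_cases h2 : a = l
  · subst h2
    rw [TN_0, TN_0, XX_eq, XX_gt _ _ _ (by omega), XX_eq, Nat.add_sub_cancel,
      map_add, map_neg]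
    rw [app2 (S.PP_comm S.t_mem (S.qq_mem a)) _, app2 (S.PP_comm S.t_mem (S.hh_mem a)) _]
    rcases S.eN_cases ν f a with h | ⟨_, h2, h⟩
    · rw [h]; simp
    · have := S.hh_inv a (del i ν a) (f a)
      rw [← h, cl_del_ge i ν a a le_rfl] at this
      rw [h2]
      simp only [eq_comm (a := i)]
      rw [← this]; abel
  by_cases h3 : a = l + 1
  · subst h3
    rw [TN_1, TN_1, XX_eq, XX_gt _ _ _ (by omega), XX_lt _ _ _ (by omega), Nat.add_sub_cancel,
      map_add]
    rw [app2 (S.PP_comm (S.X_mem l) (S.hh_mem l)) _]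
    rcases S.eN_cases ν f (l + 1) with h | ⟨_, h2, h⟩
    · rw [h]; simp
    · have := S.hh_inv l (del i ν (l + 1)) (f (l + 1))
      rw [← h, cl_del_lt i ν (l + 1) l (by omega) (by omega)] at this
      rw [h2]
      rw [← this]; abel
  · rw [S.TN_gt _ _ _ (by omega), S.TN_gt _ _ _ (by omega), S.XX_lt _ _ (by omega),
      S.XX_lt _ _ (by omega)]
    rcases S.eN_cases ν f a with h | ⟨_, h2, h⟩
    · rw [h]; simp
    · rw [h, ← cl_del_lt i ν a l (by omega) ha, ← cl_del_lt i ν a (l + 1) (by omega) ha]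
      have := app (S.tx1 l (by omega) (del i ν a)) (f a)
      split_ifs at this ⊢ <;> exact this

lemma XX_T (a l m : ℕ) (hl : l + 1 < n + 1) (h1 : m ≠ l) (h2 : m ≠ l + 1) (h : l + 1 < a)
    (ha : a ≤ n) : S.T l * S.XX a m = S.XX a m * S.T l := by
  unfold XX
  split_ifs
  · exact S.tx2 l (by omega) _ h1 h2
  · exact (S.t_T l).symm
  · exact S.tx2 l (by omega) _ (by omega) (by omega)

lemma XX_T' (a l m : ℕ) (hl : l + 1 + 1 < n + 1) (h1 : m ≠ l + 1) (h2 : m ≠ l + 2)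
    (h : a < l + 1) : S.T l * S.XX a m = S.XX a m * S.T l := by
  unfold XX
  split_ifs
  · exact S.tx2 l (by omega) _ (by omega) (by omega)
  · exact (S.t_T l).symm
  · exact S.tx2 l (by omega) _ (by omega) (by omega)

lemma tx2_N (l m : ℕ) (hl : l + 1 < n + 1) (hm1 : m ≠ l) (hm2 : m ≠ l + 1)
    (f : ℕ → V) (a : ℕ) (ha : a ≤ n) :
    S.TN l (S.XN m f) a = S.XN m (S.TN l f) a := by
  unfold XN
  by_cases h1 : a < l
  · obtain ⟨l, rfl⟩ : ∃ l', l = l' + 1 := ⟨l - 1, by omega⟩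
    rw [S.TN_lt _ _ _ h1, S.TN_lt _ _ _ h1]
    exact app2 (S.XX_T' a l m hl hm1 hm2 h1) _
  have hx : S.XX (l + 1) m = S.XX l m := by
    unfold XX
    by_cases h : m < l
    · rw [if_pos h, if_pos (by omega)]
    · rw [if_neg h, if_neg (by omega), if_neg (by omega), if_neg (by omega)]
  by_cases h2 : a = l
  · subst h2
    rw [TN_0, TN_0, hx, map_add, map_neg, app2 (S.PP_comm (S.XX_mem a m) (S.qq_mem a)) _,
      app2 (S.PP_comm (S.XX_mem a m) (S.hh_mem a)) _]
  by_cases h3 : a = l + 1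
  · subst h3
    rw [TN_1, TN_1, hx, map_add, app2 (S.PP_comm (S.XX_mem l m) (S.hh_mem l)) _]
  · rw [S.TN_gt _ _ _ (by omega), S.TN_gt _ _ _ (by omega)]
    exact app2 (S.XX_T a l m hl hm1 hm2 (by omega) ha) _

end Sh

end KLRProof

namespace KLRProof

set_option linter.unusedSectionVars false
set_option linter.unusedSimpArgs false

open KLR

variable {k : Type} [Field k] {I : Type} [Fintype I] [DecidableEq I]

namespace Sh

variable {C : CartanDatum k I} {n : ℕ} {i : I} {V : Type} [AddCommGroup V] [Module k V]
  (S : Sh C n i (Module.End k V))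

lemma braid_N0 (l : ℕ) (hl : l + 1 < n) (f : ℕ → V) :
    S.TN (l + 1) (S.TN l (S.TN (l + 1) f)) l - S.TN l (S.TN (l + 1) (S.TN l f)) l =
      (S.hh (l + 1) * (S.Qh l - S.T l * S.T l)) (f l) := by
  obtain ⟨b1, b2, b3, -, -, -⟩ := S.braid_all l hl
  have c1 := app b1 (f l)
  have c2 := app b2 (f (l + 1))
  have c3 := app b3 (f (l + 1 + 1))
  rw [← c1]
  simp only [S.TN_lt (l + 1) _ l (by omega), S.TN_gt l _ (l + 1 + 1) (by omega), TN_0, TN_1,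
    Nat.add_sub_cancel, map_add, map_neg, LinearMap.add_apply, LinearMap.sub_apply,
    LinearMap.neg_apply, Module.End.mul_apply, LinearMap.zero_apply] at c2 c3 ⊢
  linear_combination (norm := module) c2 + c3

lemma braid_N1 (l : ℕ) (hl : l + 1 < n) (f : ℕ → V) :
    S.TN (l + 1) (S.TN l (S.TN (l + 1) f)) (l + 1) - S.TN l (S.TN (l + 1) (S.TN l f)) (l + 1) =
      S.DD l (f (l + 1)) := by
  obtain ⟨-, -, -, b1, b2, -⟩ := S.braid_all l hl
  have c1 := app b1 (f (l + 1))
  have c2 := app b2 (f (l + 1 + 1))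
  have c3 := app (S.F1 l hl) (f l)
  rw [← c1]
  simp only [S.TN_lt (l + 1) _ l (by omega), S.TN_gt l _ (l + 1 + 1) (by omega), TN_0, TN_1,
    Nat.add_sub_cancel, map_add, map_neg, LinearMap.add_apply, LinearMap.sub_apply,
    LinearMap.neg_apply, Module.End.mul_apply, LinearMap.zero_apply] at c2 c3 ⊢
  linear_combination (norm := module) c2 + c3

lemma braid_N2 (l : ℕ) (hl : l + 1 < n) (f : ℕ → V) :
    S.TN (l + 1) (S.TN l (S.TN (l + 1) f)) (l + 1 + 1)
      - S.TN l (S.TN (l + 1) (S.TN l f)) (l + 1 + 1) =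
      (S.hh l * (S.Qh (l + 1) - S.T l * S.T l)) (f (l + 1 + 1)) := by
  obtain ⟨-, -, -, -, -, b1⟩ := S.braid_all l hl
  have c1 := app b1 (f (l + 1 + 1))
  have c3 := app (S.F1 l hl) (f (l + 1))
  rw [← c1]
  simp only [S.TN_lt (l + 1) _ l (by omega), S.TN_gt l _ (l + 1 + 1) (by omega), TN_0, TN_1,
    Nat.add_sub_cancel, map_add, map_neg, LinearMap.add_apply, LinearMap.sub_apply,
    LinearMap.neg_apply, Module.End.mul_apply, LinearMap.zero_apply] at c3 ⊢
  linear_combination (norm := module) (-1 : k) • c3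

lemma diag_e (c : (Fin n → I) → Module.End k V) (ν) (v : V) :
    S.diag c (S.e ν v) = (c ν) (S.e ν v) := app (S.diag_mul_e c ν) v

lemma braid_N (l : ℕ) (hl : l + 2 < n + 1) (ν) (f : ℕ → V) (a : ℕ) (ha : a ≤ n) :
    S.TN (l + 1) (S.TN l (S.TN (l + 1) (S.eN ν f))) a
      - S.TN l (S.TN (l + 1) (S.TN l (S.eN ν f))) a =
      if cl i ν l = cl i ν (l + 2) then
        Qdiff C (cl i ν l) (cl i ν (l + 1)) (S.XX a l) (S.XX a (l + 1)) (S.XX a (l + 2))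
          (S.eN ν f a) else 0 := by
  by_cases h1 : a < l
  · obtain ⟨l, rfl⟩ : ∃ l', l = l' + 1 := ⟨l - 1, by omega⟩
    simp only [S.TN_lt (l + 1) _ a h1, S.TN_lt (l + 1 + 1) _ a (by omega), Nat.add_sub_cancel,
      S.XX_gt a (l + 1) (by omega), S.XX_gt a (l + 1 + 1) (by omega),
      S.XX_gt a (l + 1 + 2) (by omega)]
    rcases S.eN_cases ν f a with h | ⟨_, h2, h⟩
    · rw [h]; simp
    · rw [h, ← cl_del_ge i ν a l (by omega), ← cl_del_ge i ν a (l + 1) (by omega),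
        ← cl_del_ge i ν a (l + 2) (by omega)]
      have := app (S.braid l (by omega) (del i ν a)) (f a)
      split_ifs at this ⊢ <;> exact this
  by_cases h2 : a = l
  · subst h2
    rw [braid_N0 _ _ (by omega), F2a _ _ (by omega)]
    rcases S.eN_cases ν f a with h | ⟨_, h2, h⟩
    · rw [h]; simp
    · rw [h, XX_eq, S.XX_gt _ _ (by omega), S.XX_gt _ _ (by omega), h2]
      rw [diag_e, cl_del_ge i ν a a le_rfl, cl_del_ge i ν a (a + 1) (by omega)]
      simp only [eq_comm (a := i)]
      split_ifs <;> rfl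
  by_cases h3 : a = l + 1
  · subst h3
    rw [braid_N1 _ _ (by omega)]
    rcases S.eN_cases ν f (l + 1) with h | ⟨_, h2, h⟩
    · rw [h]; simp
    · rw [h, XX_eq, S.XX_lt _ _ (by omega), S.XX_gt _ _ (by omega), h2]
      unfold DD
      rw [diag_e, cl_del_ge i ν _ _ le_rfl, cl_del_lt i ν (l + 1) l (by omega) (by omega)]
      split_ifs <;> rfl
  by_cases h4 : a = l + 1 + 1
  · subst h4
    rw [braid_N2 _ _ (by omega), F2b _ _ (by omega)]
    rcases S.eN_cases ν f (l + 1 + 1) with h | ⟨_, h2, h⟩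
    · rw [h]; simp
    · rw [h, XX_eq, S.XX_lt _ _ (by omega), S.XX_lt _ _ (by omega), h2]
      rw [diag_e, cl_del_lt i ν (l + 1 + 1) l (by omega) (by omega),
        cl_del_lt i ν (l + 1 + 1) (l + 1) (by omega) (by omega)]
      split_ifs with h5 <;> simp [h5]
  · simp only [S.TN_gt (l + 1) _ a (by omega), S.TN_gt l _ a (by omega),
      S.XX_lt a (l + 1) (by omega), S.XX_lt a l (by omega),
      S.XX_lt a (l + 2) (by omega)]
    rcases S.eN_cases ν f a with h | ⟨_, h2, h⟩
    · rw [h]; simp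
    · rw [h, ← cl_del_lt i ν a l (by omega) ha, ← cl_del_lt i ν a (l + 1) (by omega) ha,
        ← cl_del_lt i ν a (l + 2) (by omega) ha]
      have := app (S.braid l (by omega) (del i ν a)) (f a)
      split_ifs at this ⊢ <;> exact this

end Sh

end KLRProof

namespace KLRProof

set_option linter.unusedSectionVars false
set_option linter.unusedSimpArgs false

open KLR

variable {k : Type} [Field k] {I : Type} [Fintype I] [DecidableEq I]

lemma content_insertNth {n : ℕ} (a : Fin (n + 1)) (i : I) (ν : Fin n → I) :
    content (Fin.insertNth a i ν : Fin (n + 1) → I) = addA (content ν) i := by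
  funext j
  simp only [content, addA, Finset.card_filter]
  rw [Fin.sum_univ_succAbove _ a]
  simp only [Fin.insertNth_apply_same, Fin.insertNth_apply_succAbove]
  rw [add_comm]
  simp only [eq_comm (a := i)]

lemma addA_inj {β β' : I → ℕ} {i : I} (h : addA β i = addA β' i) : β = β' := by
  funext j
  have := congrFun h j
  simpa [addA] using this

lemma mem_seqs {m : ℕ} (β : I → ℕ) (ν : Fin m → I) : ν ∈ seqs β m ↔ content ν = β := by
  simp [seqs]

lemma insertNth_mem {n : ℕ} (a : Fin (n + 1)) (i : I) (ν : Fin n → I) (β : I → ℕ) :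
    (Fin.insertNth a i ν : Fin (n + 1) → I) ∈ seqs (addA β i) (n + 1) ↔ ν ∈ seqs β n := by
  rw [mem_seqs, mem_seqs, content_insertNth]
  exact ⟨addA_inj, fun h => by rw [h]⟩

lemma del_eq_removeNth (i : I) {n : ℕ} (ν : Fin (n + 1) → I) (a : Fin (n + 1)) :
    del i ν a.1 = fun b => ν (a.succAbove b) := by
  funext b
  simp only [del]
  split_ifs with h
  · rw [cl_of_lt _ _ _ (by omega), Fin.succAbove_of_castSucc_lt _ _ (by simpa [Fin.lt_def] using h)]
    rfl
  · rw [cl_of_lt _ _ _ (by omega), Fin.succAbove_of_le_castSucc _ _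
      (by simpa [Fin.le_def] using h)]
    rfl

/-- sums over sequences with a marked entry `i`. -/
lemma sum_marked {n : ℕ} (i : I) (a : Fin (n + 1)) (s : Finset (Fin (n + 1) → I))
    (s' : Finset (Fin n → I)) (h : ∀ ν, (Fin.insertNth a i ν : Fin (n + 1) → I) ∈ s ↔ ν ∈ s')
    {W : Type} [AddCommMonoid W] (F : (Fin (n + 1) → I) → W) :
    ∑ ν ∈ s.filter (fun ν => ν a = i), F ν = ∑ ν ∈ s', F (Fin.insertNth a i ν) := by
  symm
  refine Finset.sum_bij (fun ν _ => Fin.insertNth a i ν) ?_ ?_ ?_ ?_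
  · intro ν hν
    simp [h, hν]
  · intro ν _ ν' _ hh
    funext b
    have := congrFun hh (a.succAbove b)
    simpa using this
  · intro ν hν
    rw [Finset.mem_filter] at hν
    have e : (Fin.insertNth a i (fun b => ν (a.succAbove b)) : Fin (n + 1) → I) = ν := by
      rw [← hν.2]
      exact Fin.insertNth_self_removeNth a ν
    refine ⟨fun b => ν (a.succAbove b), ?_, e⟩
    rw [← h, e]; exact hν.1
  · intros; rfl

variable (k) in
/-- functions supported on `0..n`. -/
def NS (n : ℕ) (V : Type) [AddCommGroup V] [Module k V] : Submodule k (ℕ → V) where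
  carrier := {f | ∀ a, n < a → f a = 0}
  add_mem' hf hg a ha := by simp [hf a ha, hg a ha]
  zero_mem' a _ := rfl
  smul_mem' c f hf a ha := by simp [hf a ha]

namespace Sh

variable {C : CartanDatum k I} {n : ℕ} {i : I} {V : Type} [AddCommGroup V] [Module k V]
  (S : Sh C n i (Module.End k V))

lemma sum_eN (a : ℕ) (ha : a ≤ n) (s : Finset (Fin (n + 1) → I)) (s' : Finset (Fin n → I))
    (h : ∀ ν, (Fin.insertNth (⟨a, by omega⟩ : Fin (n + 1)) i ν : Fin (n + 1) → I) ∈ s ↔ ν ∈ s')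
    (f : ℕ → V) :
    ∑ ν ∈ s, S.eN ν f a = ∑ ν ∈ s', S.e ν (f a) := by
  have e1 : ∑ ν ∈ s, S.eN ν f a =
      ∑ ν ∈ s.filter (fun ν => ν ⟨a, by omega⟩ = i), S.e (del i ν a) (f a) := by
    rw [Finset.sum_filter]
    refine Finset.sum_congr rfl fun ν _ => ?_
    unfold eN
    rw [cl_of_lt _ _ _ (by omega : a < n + 1)]
    simp [ha]
  rw [e1, sum_marked i _ s s' h]
  refine Finset.sum_congr rfl fun ν _ => ?_
  congr 2
  have := del_eq_removeNth i (Fin.insertNth (⟨a, by omega⟩ : Fin (n + 1)) i ν) ⟨a, by omega⟩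
  rw [this]
  funext b
  simp

/-- `e(ν)` as an operator. -/
def eO (ν : Fin (n + 1) → I) : Module.End k (NS k n V) where
  toFun f := ⟨S.eN ν f.1, fun a ha => by
    unfold eN; rw [if_neg (by omega)]⟩
  map_add' f g := by
    ext a
    change S.eN ν (f.1 + g.1) a = S.eN ν f.1 a + S.eN ν g.1 a
    unfold eN
    split_ifs <;> simp
  map_smul' c f := by
    ext a
    change S.eN ν (c • f.1) a = c • S.eN ν f.1 a
    unfold eN
    split_ifs <;> simp

/-- `x_c` as an operator. -/
def xO (c : ℕ) : Module.End k (NS k n V) where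
  toFun f := ⟨S.XN c f.1, fun a ha => by simp [XN, f.2 a ha]⟩
  map_add' f g := by
    ext a
    change S.XX a c (f.1 a + g.1 a) = _
    rw [map_add]; rfl
  map_smul' r f := by
    ext a
    change S.XX a c (r • f.1 a) = _
    rw [map_smul]; rfl

/-- `τ_l` as an operator. -/
def tO (l : ℕ) (hl : l + 1 < n + 1) : Module.End k (NS k n V) where
  toFun f := ⟨S.TN l f.1, fun a ha => by
    rw [S.TN_gt _ _ _ (by omega), f.2 a ha, map_zero]⟩
  map_add' f g := by
    ext a
    change S.TN l (f.1 + g.1) a = S.TN l f.1 a + S.TN l g.1 a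
    unfold TN
    split_ifs <;> simp <;> abel
  map_smul' c f := by
    ext a
    change S.TN l (c • f.1) a = c • S.TN l f.1 a
    unfold TN
    split_ifs <;> simp

lemma xO_pow (c p : ℕ) (g : NS k n V) (a : ℕ) :
    (((S.xO c) ^ p) g).1 a = ((S.XX a c) ^ p) (g.1 a) := by
  induction p generalizing g with
  | zero => simp
  | succ p ih => rw [pow_succ, pow_succ, Module.End.mul_apply, ih]; rfl

lemma NS_sum {ι' : Type} (s : Finset ι') (F : ι' → NS k n V) (a : ℕ) :
    (∑ j ∈ s, F j).1 a = ∑ j ∈ s, (F j).1 a := by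
  rw [AddSubmonoidClass.coe_finsetSum, Finset.sum_apply]

lemma Qel_xO (p q : I) (c d : ℕ) (g : NS k n V) (a : ℕ) :
    (Qel C p q (S.xO c) (S.xO d) g).1 a = Qel C p q (S.XX a c) (S.XX a d) (g.1 a) := by
  unfold Qel
  split_ifs
  · rfl
  · simp only [LinearMap.sum_apply, NS_sum]
    refine Finset.sum_congr rfl fun u _ => Finset.sum_congr rfl fun v _ => ?_
    split_ifs
    · change C.t p q u v • (((S.xO c) ^ u) (((S.xO d) ^ v) g)).1 a = _
      rw [xO_pow, xO_pow]; rfl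
    · rfl

lemma Qdiff_xO (p q : I) (c d e : ℕ) (g : NS k n V) (a : ℕ) :
    (Qdiff C p q (S.xO c) (S.xO d) (S.xO e) g).1 a =
      Qdiff C p q (S.XX a c) (S.XX a d) (S.XX a e) (g.1 a) := by
  unfold Qdiff
  split_ifs
  · rfl
  · simp only [LinearMap.sum_apply, NS_sum]
    refine Finset.sum_congr rfl fun u _ => Finset.sum_congr rfl fun v _ => ?_
    split_ifs
    · change C.t p q u v • ((∑ c' ∈ Finset.range u, S.xO c ^ c' * S.xO e ^ (u - 1 - c'))
        (((S.xO d) ^ v) g)).1 a = C.t p q u v • ((∑ c' ∈ Finset.range u, S.XX a c ^ c' *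
          S.XX a e ^ (u - 1 - c')) ((S.XX a d ^ v) (g.1 a)))
      congr 1
      simp only [LinearMap.sum_apply, NS_sum, Module.End.mul_apply, xO_pow]
    · rfl

/-- the action of the free algebra. -/
noncomputable def actF : FA k I (n + 1) →ₐ[k] Module.End k (NS k n V) :=
  FreeAlgebra.lift k (fun g => match g with
    | Gen.e ν => S.eO ν
    | Gen.x a => S.xO a.1
    | Gen.tau l h => S.tO l h)

lemma actF_e (ν) : S.actF (ge k ν) = S.eO ν := by simp [actF, ge]
lemma actF_x (a) : S.actF (gx k a) = S.xO a.1 := by simp [actF, gx]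
lemma actF_t (l h) : S.actF (gt k l h) = S.tO l h := by simp [actF, gt]

lemma NS_ext {A B : Module.End k (NS k n V)}
    (h : ∀ (f : NS k n V) (a : ℕ), a ≤ n → (A f).1 a = (B f).1 a) : A = B := by
  refine LinearMap.ext fun f => Subtype.ext (funext fun a => ?_)
  by_cases ha : a ≤ n
  · exact h f a ha
  · rw [(A f).2 a (by omega), (B f).2 a (by omega)]

lemma actF_rel {x y : FA k I (n + 1)} (h : Rel C (n + 1) x y) : S.actF x = S.actF y := by
  induction h with
  | ee ν ν' =>
    rw [map_mul, actF_e, actF_e]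
    refine NS_ext fun f a ha => ?_
    have e1 := S.ee_N ν ν' f.1 a
    change S.eN ν (S.eN ν' f.1) a = _
    rw [e1]
    split_ifs
    · rw [actF_e]; rfl
    · rw [map_zero]; rfl
  | esum =>
    simp only [map_sum, actF_e, map_one]
    refine NS_ext fun f a ha => ?_
    rw [LinearMap.sum_apply, NS_sum]
    change ∑ ν, S.eN ν f.1 a = f.1 a
    rw [S.sum_eN a ha Finset.univ Finset.univ (by simp)]
    rw [← LinearMap.sum_apply, S.esum]; rfl
  | xx a b =>
    simp only [map_mul, actF_x]
    exact NS_ext fun f c hc => congrFun (S.xx_N _ _ f.1) c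
  | xe a ν =>
    simp only [map_mul, actF_x, actF_e]
    exact NS_ext fun f c hc => congrFun (S.xe_N _ _ f.1) c
  | taue l h ν =>
    simp only [map_mul, actF_t, actF_e]
    exact NS_ext fun f c hc => S.te_N l h ν f.1 c hc
  | tautau l h l' h' hh =>
    simp only [map_mul, actF_t]
    refine NS_ext fun f c hc => ?_
    rcases hh with hh | hh
    · exact S.tt_N_aux l l' h' hh f.1 c hc
    · exact (S.tt_N_aux l' l h hh f.1 c hc).symm
  | tausq l h ν =>
    rw [map_mul, map_pow, map_mul, map_Qel (A := FA k I (n + 1)) (A' := Module.End k (NS k n V)) C S.actF, actF_t, actF_e, actF_x, actF_x]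
    refine NS_ext fun f c hc => ?_
    rw [Module.End.mul_apply, Module.End.mul_apply, Qel_xO, pow_two]
    have := S.tsq_N l h ν f.1 c hc
    rw [cl_of_lt _ _ _ (by omega : l < n + 1), cl_of_lt _ _ _ h] at this
    exact this
  | taux l h m ν =>
    rw [map_mul, map_sub, map_mul, map_mul, actF_t, actF_x, actF_x, actF_e]
    refine NS_ext fun f c hc => ?_
    change S.TN l (S.XN m.1 (S.eN ν f.1)) c - S.XN _ (S.TN l (S.eN ν f.1)) c = _
    by_cases h1 : m = ⟨l, Nat.lt_of_succ_lt h⟩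
    · have := S.tx0_N l h ν f.1 c hc
      rw [cl_of_lt _ _ _ (by omega : l < n + 1), cl_of_lt _ _ _ h] at this
      rw [h1, Equiv.swap_apply_left]
      dsimp only
      rw [this]
      simp only [true_and]
      by_cases h2 : ν ⟨l, Nat.lt_of_succ_lt h⟩ = ν ⟨l + 1, h⟩
      · rw [if_pos h2, if_pos h2, map_neg, actF_e]; rfl
      · rw [if_neg h2, if_neg h2, if_neg (fun hh => h2 hh.2), map_zero]; rfl
    · by_cases h2 : m = ⟨l + 1, h⟩
      · have := S.tx1_N l h ν f.1 c hc
        rw [cl_of_lt _ _ _ (by omega : l < n + 1), cl_of_lt _ _ _ h] at this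
        rw [h2, Equiv.swap_apply_right]
        dsimp only
        rw [this]
        simp only [true_and]
        by_cases h3 : ν ⟨l, Nat.lt_of_succ_lt h⟩ = ν ⟨l + 1, h⟩
        · rw [if_pos h3, if_neg (by simp [Fin.ext_iff]), if_pos h3, actF_e]; rfl
        · rw [if_neg h3, if_neg (fun hh => h3 hh.2), if_neg h3, map_zero]; rfl
      · rw [Equiv.swap_apply_of_ne_of_ne h1 h2, if_neg (fun hh => h1 hh.1),
          if_neg (fun hh => h2 hh.1), map_zero]
        rw [S.tx2_N l m.1 h (fun hh => h1 (Fin.ext hh)) (fun hh => h2 (Fin.ext hh)) _ c hc, sub_self]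
        rfl
  | braid l h ν =>
    simp only [map_mul, map_sub, actF_t, actF_e]
    refine NS_ext fun f c hc => ?_
    have := S.braid_N l h ν f.1 c hc
    rw [cl_of_lt _ _ _ (by omega : l < n + 1), cl_of_lt _ _ _ h,
      cl_of_lt _ _ _ (by omega : l + 1 < n + 1)] at this
    refine this.trans ?_
    split_ifs
    · rw [map_mul, map_Qdiff (A := FA k I (n + 1)) (A' := Module.End k (NS k n V)) C S.actF, actF_x, actF_x, actF_x, actF_e, Module.End.mul_apply, Qdiff_xO]
      rfl
    · rw [map_zero]; rfl

/-- the action of `R(β + α_i)`. -/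
noncomputable def act {β : I → ℕ} (hβ : ∑ ν ∈ seqs β n, S.e ν = 1) :
    bAlg C (n + 1) (addA β i) →ₐ[k] Module.End k (NS k n V) :=
  RingQuot.liftAlgHom (S := k) ⟨S.actF, fun x y h => by
    cases h with
    | base hb => exact S.actF_rel hb
    | unit =>
      simp only [map_sum, actF_e, map_one]
      refine NS_ext fun f a ha => ?_
      rw [LinearMap.sum_apply, NS_sum]
      change ∑ ν ∈ _, S.eN ν f.1 a = f.1 a
      rw [S.sum_eN a ha _ (seqs β n) (fun ν => insertNth_mem _ _ _ _)]
      rw [← LinearMap.sum_apply, hβ]; rfl⟩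

end Sh

end KLRProof

namespace KLRProof

set_option linter.unusedSectionVars false
set_option linter.unusedSimpArgs false

open KLR
open scoped TensorProduct

section Span

variable {k E N : Type} [Field k] [Ring E] [Algebra k E] [AddCommGroup N] [Module k N]
  [Module E N] [IsScalarTower k E N]

/-- a `k`-submodule stable under an element of the algebra. -/
def Stab (b : E) (W : Submodule k N) : Prop := ∀ w ∈ W, b • w ∈ W

lemma stab_adjoin {G : Set E} {W : Submodule k N} (h : ∀ g ∈ G, Stab g W) {b : E}
    (hb : b ∈ Algebra.adjoin k G) : Stab b W := by
  induction hb using Algebra.adjoin_induction with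
  | mem x hx => exact h x hx
  | algebraMap r => intro w hw; rw [algebraMap_smul]; exact W.smul_mem _ hw
  | add x y _ _ hx hy => intro w hw; rw [add_smul]; exact W.add_mem (hx w hw) (hy w hw)
  | mul x y _ _ hx hy => intro w hw; rw [mul_smul]; exact hx _ (hy w hw)

variable (U : ℕ → E) (P0 : Submodule k N)

/-- the increasing chain of subspaces. -/
def WW : ℕ → Submodule k N
  | 0 => P0
  | d + 1 => WW d ⊔ (WW d).map (Algebra.lsmul k k N (U d))

/-- the words `U_{d-1} ⋯ U_0`. -/
def zz : ℕ → E
  | 0 => 1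
  | d + 1 => U d * zz d

lemma WW_le (d : ℕ) : WW U P0 d ≤ WW U P0 (d + 1) := le_sup_left

lemma WW_U (d : ℕ) {w : N} (hw : w ∈ WW U P0 d) : U d • w ∈ WW U P0 (d + 1) :=
  (le_sup_right : _ ≤ WW U P0 (d + 1)) ⟨w, hw, rfl⟩

lemma stab_succ {b : E} {d : ℕ} (h1 : ∀ w ∈ WW U P0 d, b • w ∈ WW U P0 (d + 1))
    (h2 : ∀ w ∈ WW U P0 d, b • U d • w ∈ WW U P0 (d + 1)) : Stab b (WW U P0 (d + 1)) := by
  intro w hw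
  obtain ⟨w1, hw1, w2, hw2, rfl⟩ := Submodule.mem_sup.1 hw
  obtain ⟨w3, hw3, rfl⟩ := hw2
  rw [smul_add]
  exact Submodule.add_mem _ (h1 _ hw1) (h2 _ hw3)

/-- hypotheses for the spanning lemma. -/
structure SpanHyp (n : ℕ) (G : Set E) : Prop where
  tg : ∀ l < n, ∀ g ∈ G, ∃ p ∈ Algebra.adjoin k G, ∃ q ∈ Algebra.adjoin k G,
    g * U l = U l * p + q
  sq : ∀ l < n, U l * U l ∈ Algebra.adjoin k G
  far : ∀ l < n, ∀ l' < n, l + 1 < l' → U l * U l' = U l' * U l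
  br : ∀ l, l + 1 < n → U l * U (l + 1) * U l - U (l + 1) * U l * U (l + 1) ∈ Algebra.adjoin k G
  g0 : ∀ g ∈ G, Stab g P0
  t0 : ∀ l, 0 < l → l < n → Stab (U l) P0

variable {U P0} {n : ℕ} {G : Set E}

lemma SpanHyp.stab (H : SpanHyp (k := k) U P0 n G)
    (d : ℕ) (hd : d ≤ n) :
    (∀ g ∈ G, Stab g (WW U P0 d)) ∧ (∀ l < n, l ≠ d → Stab (U l) (WW U P0 d)) := by
  induction d using Nat.strong_induction_on with
  | _ d ih =>
  cases d with
  | zero => exact ⟨H.g0, fun l hl h0 => H.t0 l (by omega) hl⟩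
  | succ d =>
    obtain ⟨hG, hT⟩ := ih d (by omega) (by omega)
    have hP : ∀ p ∈ Algebra.adjoin k G, Stab p (WW U P0 d) := fun p hp => stab_adjoin hG hp
    refine ⟨fun g hg => stab_succ _ _ (fun w hw => WW_le _ _ _ (hG g hg w hw)) ?_, ?_⟩
    · intro w hw
      obtain ⟨p, hp, q, hq, e⟩ := H.tg d (by omega) g hg
      rw [← mul_smul, e, add_smul, mul_smul]
      exact Submodule.add_mem _ (WW_U _ _ _ (hP p hp w hw)) (WW_le _ _ _ (hP q hq w hw))
    · intro l hl hld
      rcases lt_trichotomy l d with h | h | h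
      · by_cases h' : l + 1 = d
        · subst h'
          obtain ⟨hG', hT'⟩ := ih l (by omega) (by omega)
          have hT0 := hT l hl (by omega)
          refine stab_succ _ _ (fun w hw => WW_le _ _ _ (hT0 w hw)) ?_
          intro w hw
          obtain ⟨w1, hw1, w2, hw2, rfl⟩ := Submodule.mem_sup.1 hw
          obtain ⟨w3, hw3, rfl⟩ := hw2
          rw [smul_add, smul_add]
          refine Submodule.add_mem _ ?_ ?_
          · exact WW_le _ _ _ (WW_U _ _ _ (hT' (l + 1) (by omega) (by omega) _ hw1))
          · change U l • U (l + 1) • U l • w3 ∈ _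
            have e : U l • U (l + 1) • U l • w3 = U (l + 1) • U l • U (l + 1) • w3 +
                (U l * U (l + 1) * U l - U (l + 1) * U l * U (l + 1)) • w3 := by
              rw [sub_smul]; simp only [mul_smul]; abel
            rw [e]
            refine Submodule.add_mem _ ?_ ?_
            · exact WW_U _ _ _ (WW_U _ _ _ (hT' (l + 1) (by omega) (by omega) _ hw3))
            · exact WW_le _ _ _ (hP _ (H.br l (by omega)) _ (WW_le _ _ _ hw3))
        · refine stab_succ _ _ (fun w hw => WW_le _ _ _ (hT l hl (by omega) w hw)) ?_
          intro w hw
          rw [← mul_smul, H.far l hl d (by omega) (by omega), mul_smul]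
          exact WW_U _ _ _ (hT l hl (by omega) w hw)
      · subst h
        refine stab_succ _ _ (fun w hw => WW_U _ _ _ hw) ?_
        intro w hw
        rw [← mul_smul]
        exact WW_le _ _ _ (hP _ (H.sq l hl) _ hw)
      · refine stab_succ _ _ (fun w hw => WW_le _ _ _ (hT l hl (by omega) w hw)) ?_
        intro w hw
        rw [← mul_smul, ← H.far d (by omega) l hl (by omega), mul_smul]
        exact WW_U _ _ _ (hT l hl (by omega) w hw)

lemma SpanHyp.stab_top (H : SpanHyp (k := k) U P0 n G) :
    (∀ g ∈ G, Stab g (WW U P0 n)) ∧ (∀ l < n, Stab (U l) (WW U P0 n)) :=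
  ⟨(H.stab n le_rfl).1, fun l hl => (H.stab n le_rfl).2 l hl (by omega)⟩

lemma SpanHyp.decomp (H : SpanHyp (k := k) U P0 n G)
    (d : ℕ) (hd : d < n) :
    WW U P0 (d + 1) = WW U P0 d ⊔ P0.map (Algebra.lsmul k k N (zz U (d + 1))) := by
  cases d with
  | zero => simp [WW, zz]
  | succ d =>
    apply le_antisymm
    · refine sup_le le_sup_left ?_
      rw [SpanHyp.decomp H d (by omega)]
      rintro _ ⟨w, hw, rfl⟩
      obtain ⟨w1, hw1, w2, hw2, rfl⟩ := Submodule.mem_sup.1 hw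
      obtain ⟨w3, hw3, rfl⟩ := hw2
      rw [map_add]
      refine Submodule.add_mem_sup ?_ ?_
      · exact Submodule.mem_sup_left ((H.stab d (by omega)).2 (d + 1) hd (by omega) _ hw1)
      · refine ⟨w3, hw3, ?_⟩
        rw [zz, map_mul]; rfl
    · refine sup_le le_sup_left ?_
      have : P0.map (Algebra.lsmul k k N (zz U (d + 1))) ≤ WW U P0 (d + 1) := by
        rw [SpanHyp.decomp H d (by omega)]; exact le_sup_right
      rintro _ ⟨w, hw, rfl⟩
      rw [zz, map_mul]
      exact WW_U _ _ _ (this ⟨w, hw, rfl⟩)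

variable {N' V : Type} [AddCommGroup N'] [Module k N'] [AddCommGroup V] [Module k V]

/-- normal form of elements in the top space. -/
lemma SpanHyp.nf (H : SpanHyp (k := k) U P0 n G)
    (d : ℕ) (hd : d ≤ n) (w : N) (hw : w ∈ WW U P0 d) :
    ∃ p : ℕ → N, (∀ b, p b ∈ P0) ∧ w = ∑ b ∈ Finset.range (d + 1), zz U b • p b := by
  induction d generalizing w with
  | zero => exact ⟨fun _ => w, fun _ => hw, by simp [zz]⟩
  | succ d ih =>
    rw [H.decomp d (by omega)] at hw
    obtain ⟨w1, hw1, w2, hw2, rfl⟩ := Submodule.mem_sup.1 hw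
    obtain ⟨w3, hw3, rfl⟩ := hw2
    obtain ⟨p, hp, rfl⟩ := ih (by omega) w1 hw1
    refine ⟨fun b => if b = d + 1 then w3 else p b, fun b => ?_, ?_⟩
    · dsimp only; split_ifs
      · exact hw3
      · exact hp b
    · rw [Finset.sum_range_succ _ (d + 1)]
      dsimp only
      rw [if_pos rfl]
      congr 1
      refine Finset.sum_congr rfl fun b hb => ?_
      rw [if_neg (by rw [Finset.mem_range] at hb; omega)]

lemma SpanHyp.inj (H : SpanHyp (k := k) U P0 n G)
    (Ψ : N →ₗ[k] N') (c : ℕ → N' →ₗ[k] V)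
    (h0 : ∀ d d', d' < d → d ≤ n → ∀ p ∈ P0, c d (Ψ (zz U d' • p)) = 0)
    (h1 : ∀ d ≤ n, ∀ p ∈ P0, c d (Ψ (zz U d • p)) = 0 → p = 0)
    (w : N) (hw : w ∈ WW U P0 n) (hΨ : Ψ w = 0) : w = 0 := by
  obtain ⟨p, hp, rfl⟩ := H.nf n le_rfl w hw
  have key : ∀ d ≤ n + 1, (∑ b ∈ Finset.range d, zz U b • p b) =
      ∑ b ∈ Finset.range (n + 1), zz U b • p b := by
    intro d hd
    refine Nat.decreasingInduction' (fun e he1 he2 ih => ?_) hd rfl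
    rw [← ih, Finset.sum_range_succ, left_eq_add]
    have h2 : c e (Ψ (∑ b ∈ Finset.range (e + 1), zz U b • p b)) = 0 := by
      rw [ih, hΨ, map_zero]
    rw [map_sum, map_sum, Finset.sum_range_succ, Finset.sum_eq_zero, zero_add] at h2
    · rw [h1 e (by omega) _ (hp e) h2, smul_zero]
    · intro b hb
      exact h0 e b (Finset.mem_range.1 hb) (by omega) _ (hp b)
  rw [← key 0 (by omega)]; simp

end Span

section OTs

variable {k S B M : Type} [Field k] [Ring S] [Algebra k S] [Ring B] [Algebra k B]
  [AddCommGroup M] [Module k M] [Module S M] [IsScalarTower k S M] (φ : S →ₙₐ[k] B)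
  {N : Type} [AddCommGroup N] [Module k N] [Module B N] [IsScalarTower k B N]

/-- maps out of the balanced tensor product. -/
noncomputable def otLift (j : M →ₗ[k] N) (hj : ∀ (r : S) (m : M), j (r • m) = φ r • j m) :
    OT k S B M φ →ₗ[B] N :=
  Submodule.liftQ _ (TensorProduct.AlgebraTensorModule.lift
    (LinearMap.toSpanSingleton B (M →ₗ[k] N) j)) (by
    unfold TRel
    rw [Submodule.span_le]
    rintro _ ⟨b, r, m, rfl⟩
    simp [hj, mul_smul])

lemma otLift_mk (j : M →ₗ[k] N) (hj) (b : B) (m : M) :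
    otLift φ j hj (OTmk k S B M φ (b ⊗ₜ[k] m)) = b • j m := by
  simp [otLift, OTmk]

/-- the map `m ↦ 1 ⊗ m`. -/
noncomputable def otJ : M →ₗ[k] OT k S B M φ where
  toFun m := OTmk k S B M φ (1 ⊗ₜ[k] m)
  map_add' a b := by rw [TensorProduct.tmul_add]; rfl
  map_smul' c a := by rw [TensorProduct.tmul_smul]; rfl

lemma OTmk_eq (b : B) (m : M) : OTmk k S B M φ (b ⊗ₜ[k] m) = b • otJ φ m := by
  change _ = OTmk k S B M φ (b • (1 ⊗ₜ[k] m))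
  rw [TensorProduct.smul_tmul', smul_eq_mul, mul_one]

lemma otJ_smul (r : S) (m : M) : otJ φ (r • m) = φ r • otJ φ m := by
  rw [← OTmk_eq]
  symm
  refine (Submodule.Quotient.eq _).2 ?_
  refine Submodule.subset_span ⟨1, r, m, by rw [one_mul]⟩

lemma otLift_J (j : M →ₗ[k] N) (hj) (m : M) : otLift φ j hj (otJ φ m) = j m := by
  have := otLift_mk φ j hj 1 m
  rwa [one_smul] at this

lemma ot_induction (W : Submodule k (OT k S B M φ)) (h : ∀ (b : B) (m : M), b • otJ φ m ∈ W)
    (z : OT k S B M φ) : z ∈ W := by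
  obtain ⟨y, rfl⟩ := Submodule.Quotient.mk_surjective _ z
  induction y using TensorProduct.induction_on with
  | zero => exact W.zero_mem
  | tmul b m => have := h b m; rwa [← OTmk_eq] at this
  | add x y hx hy => exact W.add_mem hx hy

lemma ot_hom_ext {f g : OT k S B M φ →ₗ[B] N} (h : ∀ m, f (otJ φ m) = g (otJ φ m)) (z) :
    f z = g z := by
  refine ot_induction φ (LinearMap.eqLocus (f.restrictScalars k) (g.restrictScalars k)) ?_ z
  intro b m
  change f _ = g _
  rw [map_smul, map_smul, h]

end OTs

/-- a module through a homomorphism to endomorphisms. -/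
def ModOf {k B V : Type} [Field k] [Ring B] [Algebra k B] [AddCommGroup V] [Module k V]
    (_ : B →ₐ[k] Module.End k V) : Type := V

section ModOf

variable {k B V : Type} [Field k] [Ring B] [Algebra k B] [AddCommGroup V] [Module k V]
    (ρ : B →ₐ[k] Module.End k V)

instance : AddCommGroup (ModOf ρ) := inferInstanceAs (AddCommGroup V)
instance : Module k (ModOf ρ) := inferInstanceAs (Module k V)
noncomputable instance : Module B (ModOf ρ) :=
  Module.compHom (R := Module.End k V) V ρ.toRingHom

instance : IsScalarTower k B (ModOf ρ) := by
  constructor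
  intro c b v
  change ρ (c • b) v = c • ρ b v
  rw [map_smul]; rfl

lemma ModOf_smul (b : B) (v : ModOf ρ) : b • v = ρ b v := rfl

end ModOf

end KLRProof

namespace KLRProof

set_option linter.unusedSectionVars false
set_option linter.unusedSimpArgs false

open KLR

variable {k : Type} [Field k] {I : Type} [Fintype I] [DecidableEq I]

namespace Sh

lemma qq_mul_e {C : CartanDatum k I} {n : ℕ} {i : I} {E : Type} [Ring E] [Algebra k E]
    (S : Sh C n i E) (l : ℕ) (ν : Fin n → I) : S.qq l * S.e ν =
    (if cl i ν l = i then -(S.w l * S.w l) else Qel C i (cl i ν l) S.t (S.X l)) * S.e ν := by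
  unfold Sh.qq
  rw [sub_mul, mul_assoc (S.hh l)]
  unfold Sh.Qh Sh.hh
  rw [S.diag_mul_e, S.diag_mul_e]
  by_cases hc : cl i ν l = i
  · rw [hc, Qel_self, if_pos rfl, zero_mul, zero_sub, (S.PP_comm (S.w_mem l) (S.e_mem ν)).eq,
      ← mul_assoc, S.diag_mul_e, if_pos hc, mul_assoc, (S.PP_comm (S.e_mem ν) (S.w_mem l)).eq,
      ← mul_assoc, if_pos rfl, neg_mul]
  · rw [if_neg hc, zero_mul, mul_zero, sub_zero, if_neg hc]

lemma e_of_w {C : CartanDatum k I} {n : ℕ} {i : I} {E : Type} [Ring E] [Algebra k E]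
    (S : Sh C n i E) (l : ℕ) (ν : Fin n → I) : S.e ν =
    -((S.t - S.X l) * (S.t - S.X l)) * (-(S.w l * S.w l) * S.e ν) := by
  have h4 : -((S.t - S.X l) * (S.t - S.X l)) * (-(S.w l * S.w l) * S.e ν) =
    (S.t - S.X l) * ((S.t - S.X l) * S.w l) * S.w l * S.e ν := by noncomm_ring
  rw [h4, S.w_r, mul_one, S.w_r, one_mul]

end Sh

section SM

variable (C : CartanDatum k I) (n : ℕ) (β : I → ℕ) (i : I)
  (M : Type) [AddCommGroup M] [Module k M] [Module (bAlg C n β) M]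
  [IsScalarTower k (bAlg C n β) M]

/-- the action of `R(n)` on `M`. -/
noncomputable def rM : Alg C n →ₐ[k] Module.End k M :=
  (Algebra.lsmul k k M).comp (toB C (β := β))

lemma rM_apply (r : Alg C n) (m : M) : rM C n β M r m = (toB C r : bAlg C n β) • m := rfl

/-- the operators on `M`. -/
noncomputable def KM : KRel C n i (Module.End k M) := KRel.ofHom i (rM C n β M)

/-- the operators on `M((t⁻¹))`. -/
noncomputable def SM : Sh C n i (Module.End k (VV k M)) :=
  { (KRel.ofHom i (mapV.comp (rM C n β M)) : KRel C n i (Module.End k (VV k M))) with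
    t := tV k M
    w := fun l => wV ((KM C n β i M).X l)
    t_e := fun ν => tV_comm (rM C n β M (Ee C ν))
    t_X := fun a => by
      simp only [KRel.ofHom]
      split_ifs
      · exact tV_comm _
      · exact Commute.zero_right _
    t_T := fun a => by
      simp only [KRel.ofHom]
      split_ifs
      · exact tV_comm _
      · exact Commute.zero_right _
    w_l := fun l => by
      have := wV_left ((KM C n β i M).X l)
      simp only [KRel.ofHom, KM] at this ⊢
      split_ifs with h
      · simpa [h] using this
      · simpa [h] using this
    w_r := fun l => by
      have := wV_right ((KM C n β i M).X l)
      simp only [KRel.ofHom, KM] at this ⊢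
      split_ifs with h
      · simpa [h] using this
      · simpa [h] using this }

lemma SM_t : (SM C n β i M).t = tV k M := rfl
lemma SM_e (ν) : (SM C n β i M).e ν = mapV ((KM C n β i M).e ν) := rfl
lemma SM_X (a) : (SM C n β i M).X a = mapV ((KM C n β i M).X a) := by
  simp only [SM, KM, KRel.ofHom]
  split_ifs <;> simp
lemma SM_T (a) : (SM C n β i M).T a = mapV ((KM C n β i M).T a) := by
  simp only [SM, KM, KRel.ofHom]
  split_ifs <;> simp

lemma toB_sum : ∑ ν ∈ seqs β n, (toB C (Ee C ν) : bAlg C n β) = 1 := by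
  have := RingQuot.mkAlgHom_rel k (URel.unit (C := C) (n := n) (β := β))
  rw [map_sum, map_one] at this
  rw [← this]
  refine Finset.sum_congr rfl fun ν _ => ?_
  simp [toB, Ee]

lemma SM_sum : ∑ ν ∈ seqs β n, (SM C n β i M).e ν = 1 := by
  have : ∀ ν, (SM C n β i M).e ν = (mapV.comp (Algebra.lsmul k k M)) (toB C (Ee C ν) : bAlg C n β) :=
    fun ν => rfl
  simp only [this]
  rw [← map_sum, toB_sum, map_one]

lemma Qel_inj (j : I) (hj : i ≠ j) (y : Module.End k M) :
    Function.Injective (Qel C i j (tV k M) (mapV y) : Module.End k (VV k M)) := by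
  refine inj_of_top _ (-(C.a i j)) (C.t i j (-(C.a i j)).toNat 0 • 1) ?_ ?_
  · intro a b hab
    exact smul_right_injective M (C.t_lead i j hj) hab
  · intro f N hf
    have ha := C.a_nonpos i j hj
    have hsum : ∀ {ι' : Type} (s : Finset ι') (F : ι' → VV k M) (a : ℤ),
      (∑ j ∈ s, F j).1 a = ∑ j ∈ s, (F j).1 a := by
      intro ι' s F a
      rw [AddSubmonoidClass.coe_finsetSum, Finset.sum_apply]
    unfold Qel
    rw [if_neg hj]
    simp only [LinearMap.sum_apply, hsum]
    rw [Finset.sum_eq_single (-(C.a i j)).toNat, Finset.sum_eq_single 0, if_pos]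
    · rw [pow_zero, mul_one]
      change C.t i j _ 0 • ((tV k M ^ _) f).1 _ = _
      rw [tV_pow_apply, show N + -(C.a i j) - ((-(C.a i j)).toNat : ℤ) = N by omega]
      rfl
    · push_cast
      rw [Int.toNat_of_nonneg (by omega)]
      ring
    · intro q _ hq
      rw [if_neg]
      · rfl
      · rw [Int.toNat_of_nonneg (by omega)]
        intro h
        have h1 : C.d j * (q : ℤ) = 0 := by linarith
        rcases mul_eq_zero.1 h1 with h2 | h2
        · exact absurd h2 (C.d_pos j).ne'
        · exact hq (by exact_mod_cast h2)
    · intro h; simp at h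
    · intro p hp hp'
      rw [Finset.mem_range] at hp
      refine Finset.sum_eq_zero fun q _ => ?_
      split_ifs
      · change C.t i j p q • ((tV k M ^ p) ((mapV y ^ q) f)).1 _ = _
        rw [tV_pow_apply, ← map_pow, mapV_apply, hf _ (by omega), map_zero, smul_zero]
      · rfl
    · intro h; simp at h

lemma qq_inj (l : ℕ) : Function.Injective ((SM C n β i M).qq l) := by
  set S := SM C n β i M with hS
  rw [injective_iff_map_eq_zero]
  intro f hf
  have h1 : ∀ ν, S.e ν f = 0 := by
    intro ν
    have h2 : (S.qq l * S.e ν) f = 0 := by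
      rw [(S.PP_comm (S.qq_mem l) (S.e_mem ν)).eq, Module.End.mul_apply, hf, map_zero]
    rw [S.qq_mul_e] at h2
    by_cases hc : cl i ν l = i
    · rw [if_pos hc] at h2
      rw [S.e_of_w l ν, Module.End.mul_apply]
      exact (congrArg _ h2).trans (map_zero _)
    · rw [if_neg hc] at h2
      refine Qel_inj C i M (cl i ν l) (Ne.symm hc) ((KM C n β i M).X l) ?_
      rw [map_zero, ← SM_X]
      exact h2
  have h2 : f = (∑ ν, S.e ν) f := by rw [S.esum]; rfl
  rw [h2, LinearMap.sum_apply]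
  exact Finset.sum_eq_zero fun ν _ => h1 ν

end SM

namespace Sh

variable {C : CartanDatum k I} {n : ℕ} {i : I} {E : Type} [Ring E] [Algebra k E]
  (S : Sh C n i E)

/-- `q_{n-d} ⋯ q_{n-1}`. -/
def qz : ℕ → E
  | 0 => 1
  | d + 1 => S.qq (n - 1 - d) * qz d

lemma qz_mem (d : ℕ) : S.qz d ∈ S.PP := by
  induction d with
  | zero => exact one_mem _
  | succ d ih => exact mul_mem (S.qq_mem _) ih

lemma qz_T0 (l : ℕ) (hl : l + 1 < n) (d : ℕ) (hd : d + l + 2 ≤ n) : Commute (S.T l) (S.qz d) := by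
  induction d with
  | zero => exact Commute.one_right _
  | succ d ih =>
    exact Commute.mul_right (S.qqo l _ hl (by omega) (by omega)) (ih (by omega))

lemma qz_T (l : ℕ) (hl : l + 1 < n) (d : ℕ) (hd : n ≤ d + l) (hd' : d ≤ n) :
    Commute (S.T l) (S.qz d) := by
  induction d with
  | zero => omega
  | succ d ih =>
    by_cases h : n ≤ d + l
    · exact Commute.mul_right (S.qqo l _ hl (by omega) (by omega)) (ih h (by omega))
    · obtain ⟨d', rfl⟩ : ∃ d', d = d' + 1 := ⟨d - 1, by omega⟩
      unfold qz
      unfold qz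
      rw [show n - 1 - (d' + 1) = l by omega, show n - 1 - d' = l + 1 by omega, ← mul_assoc]
      refine Commute.mul_right ?_ (S.qz_T0 l hl d' (by omega))
      have := (S.braid_all l hl).2.2.1
      rw [sub_eq_zero, mul_assoc] at this
      exact this

end Sh

end KLRProof

namespace KLRProof

set_option linter.unusedSectionVars false
set_option linter.unusedSimpArgs false

open KLR

variable {k : Type} [Field k] {I : Type} [Fintype I] [DecidableEq I]

section gen

variable {C : CartanDatum k I} {n : ℕ} {β : I → ℕ}

lemma bAlg_ind {p : bAlg C n β → Prop} (he : ∀ ν, p (toB C (Ee C ν)))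
    (hx : ∀ a, p (toB C (Xx C a))) (ht : ∀ l h, p (toB C (Tt C l h)))
    (hz : p 0) (ha : ∀ x y, p x → p y → p (x + y)) (hm : ∀ x y, p x → p y → p (x * y))
    (hs : ∀ (c : k) x, p x → p (c • x)) (r : bAlg C n β) : p r := by
  obtain ⟨y, rfl⟩ := RingQuot.mkAlgHom_surjective k (URel C n β) r
  have hsum : ∀ (s : Finset (Fin n → I)), p (∑ ν ∈ s, (toB C (Ee C ν))) := by
    intro s
    exact Finset.sum_induction _ p ha hz (fun ν _ => he ν)
  induction y using FreeAlgebra.induction with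
  | grade0 c =>
    rw [AlgHom.commutes, Algebra.algebraMap_eq_smul_one, ← toB_sum]
    exact hs _ _ (hsum _)
  | grade1 g =>
    cases g with
    | e ν => have := he ν; simpa [toB, Ee, ge] using this
    | x a => have := hx a; simpa [toB, Xx, gx] using this
    | tau l h => have := ht l h; simpa [toB, Tt, gt] using this
  | mul a b ha' hb' => rw [map_mul]; exact hm _ _ ha' hb'
  | add a b ha' hb' => rw [map_add]; exact ha _ _ ha' hb'

lemma bAlg_stab {N : Type} [AddCommGroup N] [Module k N] [Module (bAlg C n β) N]
    [IsScalarTower k (bAlg C n β) N] {W : Submodule k N}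
    (he : ∀ ν, Stab (toB C (Ee C ν) : bAlg C n β) W) (hx : ∀ a, Stab (toB C (Xx C a) : bAlg C n β) W)
    (ht : ∀ l h, Stab (toB C (Tt C l h) : bAlg C n β) W) (b : bAlg C n β) : Stab b W := by
  refine bAlg_ind (p := fun b => Stab b W) he hx ht ?_ ?_ ?_ ?_ b
  · intro w _; rw [zero_smul]; exact W.zero_mem
  · intro x y hx hy w hw; rw [add_smul]; exact W.add_mem (hx w hw) (hy w hw)
  · intro x y hx hy w hw; rw [mul_smul]; exact hx _ (hy w hw)
  · intro c x hx w hw; rw [smul_assoc]; exact W.smul_mem _ (hx w hw)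

variable {M : Type} [AddCommGroup M] [Module k M] [Module (bAlg C n β) M]
  [IsScalarTower k (bAlg C n β) M] {i : I} {N : Type} [AddCommGroup N] [Module k N]
  [Module (bAlg C (n + 1) (addA β i)) N] [IsScalarTower k (bAlg C (n + 1) (addA β i)) N]
  (φ : bAlg C n β →ₙₐ[k] bAlg C (n + 1) (addA β i)) (j : M →ₗ[k] N)

lemma hj_of_gen (he : ∀ ν m, j ((toB C (Ee C ν) : bAlg C n β) • m) = φ (toB C (Ee C ν)) • j m)
    (hx : ∀ a m, j ((toB C (Xx C a) : bAlg C n β) • m) = φ (toB C (Xx C a)) • j m)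
    (ht : ∀ l h m, j ((toB C (Tt C l h) : bAlg C n β) • m) = φ (toB C (Tt C l h)) • j m)
    (r : bAlg C n β) (m : M) : j (r • m) = φ r • j m := by
  revert m
  refine bAlg_ind (p := fun r => ∀ m, j (r • m) = φ r • j m) he hx ht ?_ ?_ ?_ ?_ r
  · intro m; rw [zero_smul, map_zero, map_zero, zero_smul]
  · intro x y hx hy m; rw [add_smul, map_add, map_add, add_smul, hx, hy]
  · intro x y hx hy m; rw [mul_smul, hx, hy, map_mul, mul_smul]
  · intro c x hx m; rw [smul_assoc, j.map_smul, hx, map_smul φ c x, smul_assoc]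

lemma eR_eq : (eRb C n β i) = ∑ ν ∈ seqs β n, toB C (Ee C (Fin.snoc ν i : Fin (n + 1) → I)) := by
  unfold eRb eR
  rw [sum_marked i (Fin.last n) _ (seqs β n) (fun ν => insertNth_mem _ _ _ _)
    (fun ν => Ee C ν), map_sum]
  refine Finset.sum_congr rfl fun ν _ => ?_
  rw [Fin.insertNth_last']

lemma eL_eq : (eLb C n β i) = ∑ ν ∈ seqs β n, toB C (Ee C (Fin.cons i ν : Fin (n + 1) → I)) := by
  unfold eLb eL
  rw [sum_marked i 0 _ (seqs β n) (fun ν => insertNth_mem _ _ _ _)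
    (fun ν => Ee C ν), map_sum]
  refine Finset.sum_congr rfl fun ν _ => ?_
  rw [Fin.insertNth_zero']

lemma eR_smul (he : ∀ ν m, j ((toB C (Ee C ν) : bAlg C n β) • m) =
    (toB C (Ee C (Fin.snoc ν i)) : bAlg C (n + 1) (addA β i)) • j m) (m : M) :
    eRb C n β i • j m = j m := by
  rw [eR_eq, Finset.sum_smul]
  simp only [← he]
  rw [← map_sum, ← Finset.sum_smul, toB_sum, one_smul]

lemma eL_smul (he : ∀ ν m, j ((toB C (Ee C ν) : bAlg C n β) • m) =
    (toB C (Ee C (Fin.cons i ν)) : bAlg C (n + 1) (addA β i)) • j m) (m : M) :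
    eLb C n β i • j m = j m := by
  rw [eL_eq, Finset.sum_smul]
  simp only [← he]
  rw [← map_sum, ← Finset.sum_smul, toB_sum, one_smul]

lemma hjR (hφ : IsUpRb C i φ) (he : ∀ ν m, j ((toB C (Ee C ν) : bAlg C n β) • m) =
      (toB C (Ee C (Fin.snoc ν i)) : bAlg C (n + 1) (addA β i)) • j m)
    (hx : ∀ (a : Fin n) m, j ((toB C (Xx C a) : bAlg C n β) • m) =
      (toB C (Xx C a.castSucc) : bAlg C (n + 1) (addA β i)) • j m)
    (ht : ∀ l h m, j ((toB C (Tt C l h) : bAlg C n β) • m) =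
      (toB C (Tt C l (Nat.lt_succ_of_lt h)) : bAlg C (n + 1) (addA β i)) • j m)
    (r : bAlg C n β) (m : M) : j (r • m) = φ r • j m := by
  have h0 := eR_smul j he
  refine hj_of_gen φ j ?_ ?_ ?_ r m
  · intro ν m; rw [hφ.1, he]
  · intro ν m; rw [hφ.2.1, hx, map_mul, mul_smul]; erw [h0]
  · intro l h m; rw [hφ.2.2, ht, map_mul, mul_smul]; erw [h0]

lemma hjL (hφ : IsUpLb C i φ) (he : ∀ ν m, j ((toB C (Ee C ν) : bAlg C n β) • m) =
      (toB C (Ee C (Fin.cons i ν)) : bAlg C (n + 1) (addA β i)) • j m)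
    (hx : ∀ (a : Fin n) m, j ((toB C (Xx C a) : bAlg C n β) • m) =
      (toB C (Xx C a.succ) : bAlg C (n + 1) (addA β i)) • j m)
    (ht : ∀ l h m, j ((toB C (Tt C l h) : bAlg C n β) • m) =
      (toB C (Tt C (l + 1) (Nat.succ_lt_succ h)) : bAlg C (n + 1) (addA β i)) • j m)
    (r : bAlg C n β) (m : M) : j (r • m) = φ r • j m := by
  have h0 := eL_smul j he
  refine hj_of_gen φ j ?_ ?_ ?_ r m
  · intro ν m; rw [hφ.1, he]
  · intro ν m; rw [hφ.2.1, hx, map_mul, mul_smul]; erw [h0]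
  · intro l h m; rw [hφ.2.2, ht, map_mul, mul_smul]; erw [h0]

/-- conversely, a compatible map satisfies the generator relations. -/
lemma genR (hφ : IsUpRb C i φ) (hj : ∀ (r : bAlg C n β) (m : M), j (r • m) = φ r • j m) :
    (∀ ν m, j ((toB C (Ee C ν) : bAlg C n β) • m) =
      (toB C (Ee C (Fin.snoc ν i)) : bAlg C (n + 1) (addA β i)) • j m) ∧
    (∀ (a : Fin n) m, j ((toB C (Xx C a) : bAlg C n β) • m) =
      (toB C (Xx C a.castSucc) : bAlg C (n + 1) (addA β i)) • j m) ∧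
    (∀ l h m, j ((toB C (Tt C l h) : bAlg C n β) • m) =
      (toB C (Tt C l (Nat.lt_succ_of_lt h)) : bAlg C (n + 1) (addA β i)) • j m) := by
  have he : ∀ ν m, j ((toB C (Ee C ν) : bAlg C n β) • m) =
      (toB C (Ee C (Fin.snoc ν i)) : bAlg C (n + 1) (addA β i)) • j m := by
    intro ν m; rw [hj, hφ.1]
  have h0 := eR_smul j he
  refine ⟨he, ?_, ?_⟩
  · intro ν m; rw [hj, hφ.2.1, map_mul, mul_smul]; erw [h0]
  · intro l h m; rw [hj, hφ.2.2, map_mul, mul_smul]; erw [h0]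

lemma genL (hφ : IsUpLb C i φ) (hj : ∀ (r : bAlg C n β) (m : M), j (r • m) = φ r • j m) :
    (∀ ν m, j ((toB C (Ee C ν) : bAlg C n β) • m) =
      (toB C (Ee C (Fin.cons i ν)) : bAlg C (n + 1) (addA β i)) • j m) ∧
    (∀ (a : Fin n) m, j ((toB C (Xx C a) : bAlg C n β) • m) =
      (toB C (Xx C a.succ) : bAlg C (n + 1) (addA β i)) • j m) ∧
    (∀ l h m, j ((toB C (Tt C l h) : bAlg C n β) • m) =
      (toB C (Tt C (l + 1) (Nat.succ_lt_succ h)) : bAlg C (n + 1) (addA β i)) • j m) := by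
  have he : ∀ ν m, j ((toB C (Ee C ν) : bAlg C n β) • m) =
      (toB C (Ee C (Fin.cons i ν)) : bAlg C (n + 1) (addA β i)) • j m := by
    intro ν m; rw [hj, hφ.1]
  have h0 := eL_smul j he
  refine ⟨he, ?_, ?_⟩
  · intro ν m; rw [hj, hφ.2.1, map_mul, mul_smul]; erw [h0]
  · intro l h m; rw [hj, hφ.2.2, map_mul, mul_smul]; erw [h0]

end gen

end KLRProof

namespace KLRProof

set_option linter.unusedSectionVars false
set_option linter.unusedSimpArgs false

open KLR

variable {k : Type} [Field k] {I : Type} [Fintype I] [DecidableEq I]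

lemma del_snoc {n : ℕ} (i : I) (ν : Fin n → I) : del i (Fin.snoc ν i : Fin (n + 1) → I) n = ν := by
  have := del_eq_removeNth i (Fin.snoc ν i : Fin (n + 1) → I) (Fin.last n)
  rw [Fin.val_last] at this
  rw [this]
  funext b
  simp

lemma del_cons {n : ℕ} (i : I) (ν : Fin n → I) : del i (Fin.cons i ν : Fin (n + 1) → I) 0 = ν := by
  have := del_eq_removeNth i (Fin.cons i ν : Fin (n + 1) → I) 0
  rw [Fin.val_zero] at this
  rw [this]
  funext b
  simp

/-- `τ_l` in `R(β + α_i)`, indexed by naturals. -/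
noncomputable def tB (C : CartanDatum k I) (n : ℕ) (γ : I → ℕ) (l : ℕ) : bAlg C (n + 1) γ :=
  if h : l + 1 < n + 1 then toB C (Tt C l h) else 0

lemma ofFn_zz {E : Type} [Ring E] (n : ℕ) (f : ℕ → E) (d : ℕ) (hd : d ≤ n) :
    (List.ofFn (fun l : Fin d => f (n - d + l.1))).prod = zz (fun d => f (n - 1 - d)) d := by
  induction d with
  | zero => simp [zz]
  | succ d ih =>
    rw [List.ofFn_succ, List.prod_cons, zz, ← ih (by omega)]
    congr 1
    · congr 1
      simp
      omega
    · congr 2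
      funext l
      congr 1
      simp
      omega

lemma tauProd_eq (C : CartanDatum k I) (n : ℕ) (γ : I → ℕ) :
    tauProd C n γ = zz (fun d => tB C n γ (n - 1 - d)) n := by
  rw [← ofFn_zz n _ n le_rfl]
  unfold tauProd
  congr 2
  funext l
  rw [Nat.sub_self, zero_add, tB, dif_pos (by omega)]

lemma aLam_eq (C : CartanDatum k I) (Λ : I → ℕ) (n : ℕ) (γ : I → ℕ) (h : 0 < n) :
    aLam C Λ n γ = ∑ ν ∈ seqs γ n, (toB C (Xx C ⟨0, h⟩)) ^ (Λ (ν ⟨0, h⟩)) * toB C (Ee C ν) := by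
  unfold aLam aLamF
  rw [dif_pos h, map_sum]
  refine Finset.sum_congr rfl fun ν _ => ?_
  rw [map_mul, map_pow]
  simp [toB, Xx, Ee]

/-- functions supported at a point. -/
def sgl {k : Type} [Field k] {V : Type} [AddCommGroup V] [Module k V] {n : ℕ} (a : ℕ) (ha : a ≤ n) :
    V →ₗ[k] NS k n V where
  toFun v := ⟨fun b => if b = a then v else 0, fun b hb => by dsimp only; rw [if_neg (by omega)]⟩
  map_add' v w := by ext b; by_cases h : b = a <;> simp [h]
  map_smul' v w := by ext b; by_cases h : b = a <;> simp [h]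

lemma sgl_same {V : Type} [AddCommGroup V] [Module k V] {n : ℕ} (a : ℕ) (ha : a ≤ n) (v : V) :
    (sgl (k := k) a ha v).1 a = v := by simp [sgl]

lemma sgl_ne {V : Type} [AddCommGroup V] [Module k V] {n : ℕ} (a : ℕ) (ha : a ≤ n) (v : V) (b : ℕ)
    (h : b ≠ a) : (sgl (k := k) a ha v).1 b = 0 := by simp [sgl, h]

lemma sgl_eq {V : Type} [AddCommGroup V] [Module k V] {n : ℕ} (a : ℕ) (ha : a ≤ n) (v : V)
    (f : NS k n V) (h1 : f.1 a = v) (h2 : ∀ b, b ≠ a → f.1 b = 0) : f = sgl a ha v := by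
  refine Subtype.ext (funext fun b => ?_)
  by_cases h : b = a
  · subst h; rw [h1, sgl_same]
  · rw [h2 b h, sgl_ne _ _ _ _ h]

namespace Sh

variable {C : CartanDatum k I} {n : ℕ} {i : I} {V : Type} [AddCommGroup V] [Module k V]
  (S : Sh C n i (Module.End k V)) {β : I → ℕ} (hβ : ∑ ν ∈ seqs β n, S.e ν = 1)

lemma act_e (ν) : S.act hβ (toB C (Ee C ν)) = S.eO ν := by
  rw [← actF_e]; simp [act, toB, Ee]
lemma act_x (a) : S.act hβ (toB C (Xx C a)) = S.xO a.1 := by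
  rw [← actF_x]; simp [act, toB, Xx]
lemma act_t (l h) : S.act hβ (toB C (Tt C l h)) = S.tO l h := by
  rw [← actF_t]; simp [act, toB, Tt]
lemma act_tB (l) (h : l < n) (f) : (S.act hβ (tB C n _ l) f).1 = S.TN l f.1 := by
  rw [tB, dif_pos (by omega), act_t]; rfl

lemma x_sgl (a ha c v) : S.xO c (sgl a ha v) = sgl a ha (S.XX a c v) := by
  refine sgl_eq _ _ _ _ ?_ fun b hb => ?_
  · change S.XX a c ((sgl (k := k) a ha v).1 a) = _
    rw [sgl_same]
  · change S.XX b c ((sgl (k := k) a ha v).1 b) = _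
    rw [sgl_ne _ _ _ _ hb, map_zero]

lemma e_snoc (ν v) : S.eO (Fin.snoc ν i) (sgl n le_rfl v) = sgl n le_rfl (S.e ν v) := by
  refine sgl_eq _ _ _ _ ?_ fun b hb => ?_
  · change S.eN _ (sgl (k := k) n le_rfl v).1 n = _
    unfold eN
    rw [sgl_same, if_pos, del_snoc]
    refine ⟨le_rfl, ?_⟩
    rw [cl_of_lt _ _ _ (by omega)]
    exact Fin.snoc_last (α := fun _ => I) i ν
  · change S.eN _ (sgl (k := k) n le_rfl v).1 b = _
    unfold eN
    rw [sgl_ne _ _ _ _ hb, map_zero, ite_self]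

lemma e_cons (ν v) : S.eO (Fin.cons i ν) (sgl 0 (Nat.zero_le n) v) =
    sgl 0 (Nat.zero_le n) (S.e ν v) := by
  refine sgl_eq _ _ _ _ ?_ fun b hb => ?_
  · change S.eN _ (sgl (k := k) 0 (Nat.zero_le n) v).1 0 = _
    unfold eN
    rw [sgl_same, if_pos, del_cons]
    refine ⟨Nat.zero_le _, ?_⟩
    rw [cl_of_lt _ _ _ (by omega)]
    exact Fin.cons_zero (α := fun _ => I) i ν
  · change S.eN _ (sgl (k := k) 0 (Nat.zero_le n) v).1 b = _
    unfold eN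
    rw [sgl_ne _ _ _ _ hb, map_zero, ite_self]

lemma t_sgl_n (l hl v) (h : l + 1 < n) : S.tO l hl (sgl n le_rfl v) = sgl n le_rfl (S.T l v) := by
  refine sgl_eq _ _ _ _ ?_ fun b hb => ?_
  · change S.TN l (sgl (k := k) n le_rfl v).1 n = _
    rw [S.TN_gt _ _ _ (by omega), sgl_same]
  · change S.TN l (sgl (k := k) n le_rfl v).1 b = _
    unfold TN
    split_ifs <;> simp [sgl_ne _ _ _ _ hb, sgl_ne n le_rfl v l (by omega),
      sgl_ne n le_rfl v (l + 1) (by omega)]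

lemma t_sgl_0 (l hl v) : S.tO (l + 1) hl (sgl 0 (Nat.zero_le n) v) =
    sgl 0 (Nat.zero_le n) (S.T l v) := by
  refine sgl_eq _ _ _ _ ?_ fun b hb => ?_
  · change S.TN (l + 1) (sgl (k := k) 0 (Nat.zero_le n) v).1 0 = _
    rw [S.TN_lt _ _ _ (by omega), sgl_same]
    rfl
  · change S.TN (l + 1) (sgl (k := k) 0 (Nat.zero_le n) v).1 b = _
    unfold TN
    split_ifs <;> simp [sgl_ne _ _ _ _ hb, sgl_ne 0 (Nat.zero_le n) v (l + 1) (by omega),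
      sgl_ne 0 (Nat.zero_le n) v (l + 1 + 1) (by omega)]

lemma zR (v : V) (d : ℕ) (hd : d ≤ n) :
    (∀ a, a + d < n → (S.act hβ (zz (fun d => tB C n _ (n - 1 - d)) d) (sgl n le_rfl v)).1 a = 0) ∧
    (S.act hβ (zz (fun d => tB C n _ (n - 1 - d)) d) (sgl n le_rfl v)).1 (n - d) = S.qz d v := by
  induction d with
  | zero =>
    simp only [zz, map_one, Module.End.one_apply, qz]
    exact ⟨fun a ha => sgl_ne _ _ _ _ (by omega), sgl_same _ _ _⟩
  | succ d ih =>
    obtain ⟨h1, h2⟩ := ih (by omega)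
    set f := (S.act hβ (zz (fun d => tB C n _ (n - 1 - d)) d) (sgl n le_rfl v))
    rw [zz, map_mul, Module.End.mul_apply, S.act_tB hβ _ (by omega)]
    refine ⟨fun a ha => ?_, ?_⟩
    · rw [S.TN_lt _ _ _ (by omega)]
      rw [h1 a (by omega), map_zero]
    · rw [show n - (d + 1) = n - 1 - d by omega, S.TN_0, h1 _ (by omega), map_zero,
        show n - 1 - d + 1 = n - d by omega, h2]
      simp [qz]

lemma zL (v : V) (d : ℕ) (hd : d ≤ n) :
    (∀ a, d < a → (S.act hβ (zz (tB C n _) d) (sgl 0 (Nat.zero_le n) v)).1 a = 0) ∧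
    (S.act hβ (zz (tB C n _) d) (sgl 0 (Nat.zero_le n) v)).1 d = v := by
  induction d with
  | zero =>
    simp only [zz, map_one, Module.End.one_apply]
    exact ⟨fun a ha => sgl_ne _ _ _ _ (by omega), sgl_same _ _ _⟩
  | succ d ih =>
    obtain ⟨h1, h2⟩ := ih (by omega)
    set f := (S.act hβ (zz (tB C n _) d) (sgl 0 (Nat.zero_le n) v))
    rw [zz, map_mul, Module.End.mul_apply, S.act_tB hβ _ (by omega)]
    refine ⟨fun a ha => ?_, ?_⟩
    · rw [S.TN_gt _ _ _ (by omega)]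
      rw [h1 a (by omega), map_zero]
    · rw [S.TN_1, h2, h1 (d + 1) (by omega), map_zero, add_zero]

variable (Λ : I → ℕ)

lemma act_aLam (hcyc : ∀ h : 0 < n, ∑ ν ∈ seqs β n, S.X 0 ^ Λ (ν ⟨0, h⟩) * S.e ν = 0)
    (f : NS k n V) : S.act hβ (aLam C Λ (n + 1) (addA β i)) f =
      sgl 0 (Nat.zero_le n) ((S.t ^ Λ i) (f.1 0)) := by
  have key : ∀ a, (S.act hβ (aLam C Λ (n + 1) (addA β i)) f).1 a =
      ∑ ν ∈ seqs (addA β i) (n + 1), (S.XX a 0 ^ Λ (ν 0)) (S.eN ν f.1 a) := by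
    intro a
    rw [aLam_eq C Λ (n + 1) _ (Nat.succ_pos n), map_sum, LinearMap.sum_apply, NS_sum]
    refine Finset.sum_congr rfl fun ν _ => ?_
    rw [map_mul, map_pow, act_x, act_e, Module.End.mul_apply, xO_pow]
    rfl
  refine sgl_eq _ _ _ _ ?_ fun a ha => ?_
  · rw [key, XX_eq]
    have : ∀ ν ∈ seqs (addA β i) (n + 1), (S.t ^ Λ (ν 0)) (S.eN ν f.1 0) =
        (S.t ^ Λ i) (S.eN ν f.1 0) := by
      intro ν _
      unfold eN
      by_cases h : cl i ν 0 = i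
      · rw [cl_of_lt _ _ _ (by omega)] at h
        change ν 0 = i at h
        rw [h]
      · rw [if_neg (by tauto), map_zero, map_zero]
    rw [Finset.sum_congr rfl this, ← map_sum, S.sum_eN 0 (Nat.zero_le n) _ (seqs β n)
      (fun ν => insertNth_mem _ _ _ _), ← LinearMap.sum_apply, hβ]
    rfl
  · by_cases han : a ≤ n
    · have hn : 0 < n := by omega
      rw [key, S.XX_lt _ _ (by omega)]
      have e1 : ∀ ν ∈ seqs (addA β i) (n + 1), (S.X 0 ^ Λ (ν 0)) (S.eN ν f.1 a) =
          if ν ⟨a, by omega⟩ = i then (S.X 0 ^ Λ (ν 0)) (S.e (del i ν a) (f.1 a)) else 0 := by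
        intro ν _
        unfold eN
        rw [cl_of_lt _ _ _ (by omega : a < n + 1)]
        simp only [han, true_and]
        split_ifs <;> simp
      rw [Finset.sum_congr rfl e1, ← Finset.sum_filter, sum_marked i (⟨a, by omega⟩ : Fin (n + 1)) _
        (seqs β n) (fun ν => insertNth_mem _ _ _ _)
        (fun ν => (S.X 0 ^ Λ (ν 0)) (S.e (del i ν a) (f.1 a)))]
      have e2 : ∀ ν : Fin n → I, (Fin.insertNth (⟨a, by omega⟩ : Fin (n + 1)) i ν :
          Fin (n + 1) → I) 0 = ν ⟨0, hn⟩ := by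
        intro ν
        have : (0 : Fin (n + 1)) = (⟨a, by omega⟩ : Fin (n + 1)).succAbove ⟨0, hn⟩ := by
          rw [Fin.succAbove_of_castSucc_lt]
          · rfl
          · rw [Fin.lt_def]; simp; omega
        rw [this, Fin.insertNth_apply_succAbove]
      have e3 : ∀ ν : Fin n → I, del i (Fin.insertNth (⟨a, by omega⟩ : Fin (n + 1)) i ν :
          Fin (n + 1) → I) a = ν := by
        intro ν
        have := del_eq_removeNth i (Fin.insertNth (⟨a, by omega⟩ : Fin (n + 1)) i ν)
          ⟨a, by omega⟩
        rw [this]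
        funext b
        simp
      simp only [e2, e3]
      have := congrArg (fun A : Module.End k V => A (f.1 a)) (hcyc hn)
      simp only [LinearMap.sum_apply] at this
      exact this
    · exact (S.act hβ (aLam C Λ (n + 1) (addA β i)) f).2 a (by omega)

end Sh

end KLRProof

namespace KLRProof

set_option linter.unusedSectionVars false
set_option linter.unusedSimpArgs false

open KLR

variable {k : Type} [Field k] {I : Type} [Fintype I] [DecidableEq I]

section Psi

variable (C : CartanDatum k I) (n : ℕ) (β : I → ℕ) (i : I)
  (M : Type) [AddCommGroup M] [Module k M] [Module (bAlg C n β) M]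
  [IsScalarTower k (bAlg C n β) M]

/-- the shuffle module. -/
abbrev NN : Type := ModOf (k := k) (V := NS k n (VV k M)) ((SM C n β i M).act (SM_sum C n β i M))

lemma SM_e_const (ν) (m : M) : (SM C n β i M).e ν (constV k M m) =
    constV k M ((toB C (Ee C ν) : bAlg C n β) • m) := by
  rw [SM_e, constV_map]; rfl

lemma SM_X_const (a : Fin n) (m : M) : (SM C n β i M).X a.1 (constV k M m) =
    constV k M ((toB C (Xx C a) : bAlg C n β) • m) := by
  rw [SM_X, constV_map]
  simp only [KM, KRel.ofHom, a.2, dif_pos]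
  rfl

lemma SM_T_const (l h) (m : M) : (SM C n β i M).T l (constV k M m) =
    constV k M ((toB C (Tt C l h) : bAlg C n β) • m) := by
  rw [SM_T, constV_map]
  simp only [KM, KRel.ofHom, h, dif_pos]
  rfl

/-- insertion at the last slot. -/
noncomputable def jR : M →ₗ[k] NN C n β i M := (sgl (k := k) (V := VV k M) n le_rfl) ∘ₗ constV k M

lemma jR_apply (m) : jR C n β i M m = sgl (k := k) n le_rfl (constV k M m) := rfl

variable {C n β i}

lemma jR_hj {φR : bAlg C n β →ₙₐ[k] bAlg C (n + 1) (addA β i)} (hφR : IsUpRb C i φR)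
    (r : bAlg C n β) (m : M) : jR C n β i M (r • m) = φR r • jR C n β i M m := by
  refine hjR φR _ hφR ?_ ?_ ?_ r m
  · intro ν m
    rw [ModOf_smul, Sh.act_e, jR_apply, jR_apply, Sh.e_snoc, SM_e_const]
  · intro a m
    rw [ModOf_smul, Sh.act_x, jR_apply, jR_apply, Sh.x_sgl, ← SM_X_const C n β i, Sh.XX_lt]
    · rfl
    · exact a.2
  · intro l h m
    rw [ModOf_smul, Sh.act_t, jR_apply, jR_apply, Sh.t_sgl_n _ _ _ _ h, SM_T_const C n β i M l h]

variable (C n β i) (Λ : I → ℕ)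

/-- the operator relating both insertions. -/
noncomputable def uu : Module.End k (VV k M) := (SM C n β i M).t ^ Λ i * (SM C n β i M).qz n

lemma uu_mem : uu C n β i M Λ ∈ (SM C n β i M).PP :=
  mul_mem (pow_mem (SM C n β i M).t_mem _) ((SM C n β i M).qz_mem n)

/-- insertion at the first slot. -/
noncomputable def jL : M →ₗ[k] NN C n β i M :=
  (sgl (k := k) (V := VV k M) (n := n) 0 (Nat.zero_le n)) ∘ₗ (uu C n β i M Λ) ∘ₗ constV k M

lemma jL_apply (m) : jL C n β i M Λ m =
    sgl (k := k) (n := n) 0 (Nat.zero_le n) (uu C n β i M Λ (constV k M m)) := rfl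

variable {C n β i}

lemma end_comm {V : Type} [AddCommGroup V] [Module k V] {a b : Module.End k V} (h : Commute a b)
    (v : V) : a (b v) = b (a v) := congrArg (fun f : Module.End k V => f v) h.eq

lemma jL_hj {φL : bAlg C n β →ₙₐ[k] bAlg C (n + 1) (addA β i)} (hφL : IsUpLb C i φL)
    (r : bAlg C n β) (m : M) : jL C n β i M Λ (r • m) = φL r • jL C n β i M Λ m := by
  refine hjL φL _ hφL ?_ ?_ ?_ r m
  · intro ν m
    rw [ModOf_smul, Sh.act_e, jL_apply, jL_apply, Sh.e_cons,
      end_comm ((SM C n β i M).PP_comm ((SM C n β i M).e_mem ν) (uu_mem C n β i M Λ)), SM_e_const]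
  · intro a m
    rw [ModOf_smul, Sh.act_x, jL_apply, jL_apply, Sh.x_sgl, ← SM_X_const C n β i, Sh.XX_gt]
    · rw [end_comm ((SM C n β i M).PP_comm ((SM C n β i M).X_mem _) (uu_mem C n β i M Λ))]
      rfl
    · exact Nat.succ_pos a.1
  · intro l h m
    rw [ModOf_smul, Sh.act_t, jL_apply, jL_apply, Sh.t_sgl_0, ← SM_T_const C n β i M l h,
      end_comm]
    exact (Commute.mul_right (((SM C n β i M).t_T l).symm.pow_right _)
      ((SM C n β i M).qz_T l h n (by omega) le_rfl)).symm

section cyc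

variable {Λ}

lemma toC_aLam (n : ℕ) (γ : I → ℕ) : (toC C (aLam C Λ n γ) : cAlg C Λ n γ) = 0 := by
  have := RingQuot.mkAlgHom_rel k (CRel.cyc (C := C) (Λ := Λ) (n := n) (β := γ))
  rw [map_zero] at this
  simpa [toC, aLam] using this

variable [Module (cAlg C Λ n β) M]

lemma SM_cyc (hcomp : ∀ (r : bAlg C n β) (m : M), r • m = toC C (Λ := Λ) r • m) (h : 0 < n) :
    ∑ ν ∈ seqs β n, (SM C n β i M).X 0 ^ Λ (ν ⟨0, h⟩) * (SM C n β i M).e ν = 0 := by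
  have h1 : (Algebra.lsmul k k M) (aLam C Λ n β) = 0 := by
    ext m
    change aLam C Λ n β • m = 0
    rw [hcomp, toC_aLam, zero_smul]
  have h2 := congrArg mapV h1
  rw [aLam_eq C Λ n β h, map_zero, map_sum, map_sum] at h2
  rw [← h2]
  refine Finset.sum_congr rfl fun ν _ => ?_
  rw [map_mul, map_mul, map_pow, map_pow, SM_X]
  simp only [KM, KRel.ofHom, h, dif_pos]
  rfl

end cyc

/-- `F M → N`. -/
noncomputable def PsiR {φR : bAlg C n β →ₙₐ[k] bAlg C (n + 1) (addA β i)} (hφR : IsUpRb C i φR) :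
    OT k (bAlg C n β) (bAlg C (n + 1) (addA β i)) M φR →ₗ[bAlg C (n + 1) (addA β i)]
      NN C n β i M :=
  otLift φR (jR C n β i M) (jR_hj M hφR)

/-- `F̄ M → N`. -/
noncomputable def PsiL {φL : bAlg C n β →ₙₐ[k] bAlg C (n + 1) (addA β i)} (hφL : IsUpLb C i φL) :
    OT k (bAlg C n β) (bAlg C (n + 1) (addA β i)) M φL →ₗ[bAlg C (n + 1) (addA β i)]
      NN C n β i M :=
  otLift φL (jL C n β i M Λ) (jL_hj M Λ hφL)

lemma PsiR_J {φR : bAlg C n β →ₙₐ[k] bAlg C (n + 1) (addA β i)} (hφR : IsUpRb C i φR) (m : M) :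
    PsiR M hφR (otJ φR m) = jR C n β i M m := otLift_J _ _ _ _

lemma PsiL_J {φL : bAlg C n β →ₙₐ[k] bAlg C (n + 1) (addA β i)} (hφL : IsUpLb C i φL) (m : M) :
    PsiL M Λ hφL (otJ φL m) = jL C n β i M Λ m := otLift_J _ _ _ _

end Psi

end KLRProof

namespace KLRProof

set_option linter.unusedSectionVars false
set_option linter.unusedSimpArgs false

open KLR

variable {k : Type} [Field k] {I : Type} [Fintype I] [DecidableEq I]

section relG

variable {C : CartanDatum k I} {n : ℕ} {i : I} {E : Type} [Ring E] [Algebra k E]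

lemma Qel_sub (S : Subalgebra k E) (a b : I) {u v : E} (hu : u ∈ S) (hv : v ∈ S) :
    Qel C a b u v ∈ S := by
  unfold Qel
  split_ifs
  · exact S.zero_mem
  · refine sum_mem fun p _ => sum_mem fun q _ => ?_
    split_ifs
    · exact S.smul_mem (mul_mem (pow_mem hu _) (pow_mem hv _)) _
    · exact S.zero_mem

lemma Qdiff_sub (S : Subalgebra k E) (a b : I) {u v w : E} (hu : u ∈ S) (hv : v ∈ S)
    (hw : w ∈ S) : Qdiff C a b u v w ∈ S := by
  unfold Qdiff
  split_ifs
  · exact S.zero_mem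
  · refine sum_mem fun p _ => sum_mem fun q _ => ?_
    split_ifs
    · exact S.smul_mem (mul_mem (sum_mem fun c _ => mul_mem (pow_mem hu _) (pow_mem hw _))
        (pow_mem hv _)) _
    · exact S.zero_mem

namespace KRel

variable (K : KRel C n i E)

/-- the generators `e(ν)`, `x_a`. -/
def GG : Set E := Set.range K.e ∪ Set.range K.X

lemma e_ad (ν) : K.e ν ∈ Algebra.adjoin k K.GG := Algebra.subset_adjoin (Or.inl ⟨ν, rfl⟩)
lemma X_ad (a) : K.X a ∈ Algebra.adjoin k K.GG := Algebra.subset_adjoin (Or.inr ⟨a, rfl⟩)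

lemma ad_of {z : E} (h : ∀ ν, z * K.e ν ∈ Algebra.adjoin k K.GG) :
    z ∈ Algebra.adjoin k K.GG := by
  rw [← mul_one z, ← K.esum, Finset.mul_sum]
  exact sum_mem fun ν _ => h ν

lemma sq_ad (l : ℕ) (hl : l + 1 < n) : K.T l * K.T l ∈ Algebra.adjoin k K.GG := by
  refine K.ad_of fun ν => ?_
  rw [← pow_two, K.tsq l hl]
  exact mul_mem (Qel_sub _ _ _ (K.X_ad _) (K.X_ad _)) (K.e_ad _)

lemma br_ad (l : ℕ) (hl : l + 2 < n) :
    K.T (l + 1) * K.T l * K.T (l + 1) - K.T l * K.T (l + 1) * K.T l ∈ Algebra.adjoin k K.GG := by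
  refine K.ad_of fun ν => ?_
  rw [K.braid l hl]
  split_ifs
  · exact mul_mem (Qdiff_sub _ _ _ (K.X_ad _) (K.X_ad _) (K.X_ad _)) (K.e_ad _)
  · exact zero_mem _

lemma tx_ad0 (l : ℕ) (hl : l + 1 < n) :
    K.T l * K.X l - K.X (l + 1) * K.T l ∈ Algebra.adjoin k K.GG := by
  refine K.ad_of fun ν => ?_
  rw [K.tx0 l hl]
  split_ifs
  · exact neg_mem (K.e_ad _)
  · exact zero_mem _

lemma tx_ad1 (l : ℕ) (hl : l + 1 < n) :
    K.T l * K.X (l + 1) - K.X l * K.T l ∈ Algebra.adjoin k K.GG := by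
  refine K.ad_of fun ν => ?_
  rw [K.tx1 l hl]
  split_ifs
  · exact K.e_ad _
  · exact zero_mem _

lemma tg_ad (l : ℕ) (hl : l + 1 < n) (g : E) (hg : g ∈ K.GG) :
    ∃ p ∈ Algebra.adjoin k K.GG, ∃ q ∈ Algebra.adjoin k K.GG, g * K.T l = K.T l * p + q := by
  rcases hg with ⟨ν, rfl⟩ | ⟨a, rfl⟩
  · refine ⟨_, K.e_ad (sw l hl ν), 0, zero_mem _, ?_⟩
    rw [K.te l hl, add_zero]
    congr 2
    funext b
    simp [sw]
  · by_cases h0 : a = l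
    · subst h0
      exact ⟨_, K.X_ad (a + 1), _, neg_mem (K.tx_ad1 a hl), by abel⟩
    · by_cases h1 : a = l + 1
      · subst h1
        exact ⟨_, K.X_ad l, _, neg_mem (K.tx_ad0 l hl), by abel⟩
      · exact ⟨_, K.X_ad a, 0, zero_mem _, by rw [K.tx2 l hl a h0 h1, add_zero]⟩

end KRel

end relG

section P0

variable {E N M : Type} [Ring E] [Algebra k E] [AddCommGroup N] [Module k N] [Module E N]
  [IsScalarTower k E N] [AddCommGroup M] [Module k M] (Y : E) (J : M →ₗ[k] N)

/-- polynomials in `Y` applied to the image of `J`. -/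
noncomputable def PZ : Submodule k N :=
  LinearMap.range (Finsupp.lsum k (fun j : ℕ => (Algebra.lsmul k k N (Y ^ j)) ∘ₗ J))

lemma PZ_mem (j m) : Y ^ j • J m ∈ PZ Y J :=
  ⟨Finsupp.single j m, by rw [Finsupp.lsum_single]; rfl⟩

lemma PZ_exists {w : N} (hw : w ∈ PZ Y J) : ∃ (L : ℕ) (m : ℕ → M),
    w = ∑ j ∈ Finset.range L, Y ^ j • J (m j) ∧ ∀ j, L ≤ j → m j = 0 := by
  obtain ⟨f, rfl⟩ := hw
  have hsub : f.support ⊆ Finset.range (f.support.sup id + 1) := by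
    intro j hj
    rw [Finset.mem_range]
    exact Nat.lt_succ_of_le (Finset.le_sup (f := id) hj)
  refine ⟨f.support.sup id + 1, f, ?_, ?_⟩
  · rw [Finsupp.lsum_apply, Finsupp.sum_of_support_subset _ hsub]
    · rfl
    · simp
  · intro j hj
    by_contra h
    have := Finset.mem_range.1 (hsub (Finsupp.mem_support_iff.2 h))
    omega

lemma PZ_stab {g : E} (h : ∀ j m, g • Y ^ j • J m ∈ PZ Y J) : Stab g (PZ Y J) := by
  intro w hw
  obtain ⟨L, m, rfl, -⟩ := PZ_exists Y J hw
  rw [Finset.smul_sum]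
  exact sum_mem fun j _ => h j _

lemma PZ_stab_comm {g : E} (h : Commute g Y) (h' : ∀ m, ∃ m', g • J m = J m') :
    Stab g (PZ Y J) := by
  refine PZ_stab Y J fun j m => ?_
  obtain ⟨m', hm'⟩ := h' m
  rw [← mul_smul, (h.pow_right j).eq, mul_smul, hm']
  exact PZ_mem Y J _ _

lemma PZ_stab_Y : Stab Y (PZ Y J) := by
  refine PZ_stab Y J fun j m => ?_
  rw [← mul_smul, ← pow_succ']
  exact PZ_mem Y J _ _

lemma P0_le_WW (U : ℕ → E) (P0 : Submodule k N) (d : ℕ) : P0 ≤ WW U P0 d := by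
  induction d with
  | zero => exact le_rfl
  | succ d ih => exact ih.trans (WW_le U P0 d)

end P0

section span

variable {C : CartanDatum k I} {n : ℕ} {β : I → ℕ} {i : I}
  {M : Type} [AddCommGroup M] [Module k M] [Module (bAlg C n β) M]
  [IsScalarTower k (bAlg C n β) M] 
  (φ : bAlg C n β →ₙₐ[k] bAlg C (n + 1) (addA β i))

variable (C n β i) in
/-- the relations in `R(β + α_i)`. -/
noncomputable def KB : KRel C (n + 1) i (bAlg C (n + 1) (addA β i)) := KRel.ofHom i (toB C)

lemma KB_T (l) : (KB C n β i).T l = tB C n (addA β i) l := rfl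
lemma KB_e (ν) : (KB C n β i).e ν = toB C (Ee C ν) := rfl
lemma KB_X (a : Fin (n + 1)) : (KB C n β i).X a.1 = toB C (Xx C a) := by
  exact dif_pos a.2
lemma KB_Xn (a : ℕ) (h : ¬ a < n + 1) : (KB C n β i).X a = 0 := by
  exact dif_neg h

/-- the initial layer. -/
noncomputable abbrev PR : Submodule k (OT k (bAlg C n β) (bAlg C (n + 1) (addA β i)) M φ) :=
  PZ ((KB C n β i).X n) (otJ φ)
/-- the initial layer. -/
noncomputable abbrev PL : Submodule k (OT k (bAlg C n β) (bAlg C (n + 1) (addA β i)) M φ) :=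
  PZ ((KB C n β i).X 0) (otJ φ)

lemma zero_stab {E N : Type} [Ring E] [AddCommGroup N] [Module k N] [Module E N]
    (W : Submodule k N) : Stab (0 : E) W := by
  intro w _; rw [zero_smul]; exact W.zero_mem

lemma spanR (hφ : IsUpRb C i φ) : SpanHyp (fun d => tB C n (addA β i) (n - 1 - d))
    (PR (M := M) φ) n (KB C n β i).GG := by
  have hK := KB_T (C := C) (n := n) (β := β) (i := i)
  obtain ⟨ge, gx, gt⟩ := genR φ (otJ φ (M := M)) hφ (otJ_smul φ)
  have h0 := eR_smul (otJ φ (M := M)) ge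
  refine ⟨?_, ?_, ?_, ?_, ?_, ?_⟩
  · intro l hl g hg
    simp only [← hK]
    exact KRel.tg_ad _ _ (by omega) g hg
  · intro l hl
    simp only [← hK]
    exact KRel.sq_ad _ _ (by omega)
  · intro l hl l' hl' h
    simp only [← hK]
    exact KRel.tt _ _ _ (by omega) (by omega) (by omega)
  · intro l hl
    simp only [← hK]
    have := KRel.br_ad (KB C n β i) (n - 1 - (l + 1)) (by omega)
    rw [show n - 1 - (l + 1) + 1 = n - 1 - l by omega] at this
    exact this
  · rintro _ (⟨ν, rfl⟩ | ⟨a, rfl⟩)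
    · refine PZ_stab_comm _ _ ((KB C n β i).xe n ν).symm fun m => ?_
      by_cases hν : ν (Fin.last n) = i
      · refine ⟨(toB C (Ee C (Fin.init ν)) : bAlg C n β) • m, ?_⟩
        have hν' : (Fin.snoc (Fin.init ν) i : Fin (n + 1) → I) = ν := by
          rw [← hν, Fin.snoc_init_self]
        rw [ge, hν']
        rfl
      · refine ⟨0, ?_⟩
        rw [map_zero, ← h0, ← mul_smul, eR_eq, Finset.mul_sum, Finset.sum_eq_zero, zero_smul]
        intro ν' _
        rw [← KB_e, (KB C n β i).ee, if_neg]
        rintro rfl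
        exact hν (Fin.snoc_last (α := fun _ => I) i ν')
    · rcases lt_trichotomy a n with h | h | h
      · refine PZ_stab_comm _ _ ((KB C n β i).xx a n) fun m => ?_
        exact ⟨_, (congrArg (· • otJ φ m) (KB_X (Fin.castSucc ⟨a, h⟩))).trans (gx ⟨a, h⟩ m).symm⟩
      · subst h
        exact PZ_stab_Y _ _
      · rw [KB_Xn a (by omega)]
        exact zero_stab _
  · intro l hl hln
    refine PZ_stab_comm _ _ ((KB C n β i).tx2 (n - 1 - l) (by omega) n (by omega) (by omega))
      fun m => ⟨(toB C (Tt C (n - 1 - l) (by omega)) : bAlg C n β) • m, ?_⟩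
    rw [tB, dif_pos (by omega), gt (n - 1 - l) (by omega)]

lemma spanL (hφ : IsUpLb C i φ) : SpanHyp (tB C n (addA β i))
    (PL (M := M) φ) n (KB C n β i).GG := by
  have hK := KB_T (C := C) (n := n) (β := β) (i := i)
  obtain ⟨ge, gx, gt⟩ := genL φ (otJ φ (M := M)) hφ (otJ_smul φ)
  have h0 := eL_smul (otJ φ (M := M)) ge
  refine ⟨?_, ?_, ?_, ?_, ?_, ?_⟩
  · intro l hl g hg
    simp only [← hK]
    exact KRel.tg_ad _ _ (by omega) g hg
  · intro l hl
    simp only [← hK]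
    exact KRel.sq_ad _ _ (by omega)
  · intro l hl l' hl' h
    simp only [← hK]
    exact KRel.tt _ _ _ (by omega) (by omega) (by omega)
  · intro l hl
    simp only [← hK]
    have := KRel.br_ad (KB C n β i) l (by omega)
    rw [← neg_sub]
    exact neg_mem this
  · rintro _ (⟨ν, rfl⟩ | ⟨a, rfl⟩)
    · refine PZ_stab_comm _ _ ((KB C n β i).xe 0 ν).symm fun m => ?_
      by_cases hν : ν 0 = i
      · refine ⟨(toB C (Ee C (Fin.tail ν)) : bAlg C n β) • m, ?_⟩
        have hν' : (Fin.cons i (Fin.tail ν) : Fin (n + 1) → I) = ν := by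
          rw [← hν, Fin.cons_self_tail]
        rw [ge, hν']
        rfl
      · refine ⟨0, ?_⟩
        rw [map_zero, ← h0, ← mul_smul, eL_eq, Finset.mul_sum, Finset.sum_eq_zero, zero_smul]
        intro ν' _
        rw [← KB_e, (KB C n β i).ee, if_neg]
        rintro rfl
        exact hν (Fin.cons_zero (α := fun _ => I) i ν')
    · rcases Nat.eq_zero_or_pos a with h | h
      · subst h
        exact PZ_stab_Y _ _
      · by_cases h' : a < n + 1
        · refine PZ_stab_comm _ _ ((KB C n β i).xx a 0) fun m => ?_
          obtain ⟨a, rfl⟩ : ∃ a', a = a' + 1 := ⟨a - 1, by omega⟩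
          exact ⟨_, (congrArg (· • otJ φ m) (KB_X (Fin.succ ⟨a, by omega⟩))).trans
            (gx ⟨a, by omega⟩ m).symm⟩
        · rw [KB_Xn a (by omega)]
          exact zero_stab _
  · intro l hl hln
    obtain ⟨l, rfl⟩ : ∃ l', l = l' + 1 := ⟨l - 1, by omega⟩
    refine PZ_stab_comm _ _ ((KB C n β i).tx2 (l + 1) (by omega) 0 (by omega) (by omega))
      fun m => ⟨(toB C (Tt C l (by omega)) : bAlg C n β) • m, ?_⟩
    rw [tB, dif_pos (by omega), gt l (by omega)]

lemma span_top {U : ℕ → bAlg C (n + 1) (addA β i)} {Y : bAlg C (n + 1) (addA β i)}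
    (H : SpanHyp U (PZ Y (otJ φ (M := M))) n
      (KB C n β i).GG)
    (hU : ∀ l < n, ∃ l' < n, tB C n (addA β i) l = U l') (z) : z ∈ WW U (PZ Y (otJ φ (M := M))) n := by
  obtain ⟨hG, hT⟩ := H.stab_top
  refine ot_induction φ _ (fun b m => ?_) z
  refine bAlg_stab ?_ ?_ ?_ b _ (P0_le_WW _ _ _ ?_)
  · intro ν; exact hG _ (Or.inl ⟨ν, rfl⟩)
  · intro a; exact hG _ (Or.inr ⟨a.1, KB_X a⟩)
  · intro l h
    obtain ⟨l', hl', h1⟩ := hU l (by omega)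
    have := hT l' hl'
    rwa [← h1, tB, dif_pos h] at this
  · have := PZ_mem Y (otJ φ (M := M)) 0 m
    rwa [pow_zero, one_smul] at this

lemma topR (hφ : IsUpRb C i φ) (z) :
    z ∈ WW (fun d => tB C n (addA β i) (n - 1 - d)) (PR (M := M) φ) n :=
  span_top φ (spanR φ hφ) (fun l hl => ⟨n - 1 - l, by omega, by
    rw [show n - 1 - (n - 1 - l) = l by omega]⟩) z

lemma topL (hφ : IsUpLb C i φ) (z) :
    z ∈ WW (tB C n (addA β i)) (PL (M := M) φ) n :=
  span_top φ (spanL φ hφ) (fun l hl => ⟨l, hl, rfl⟩) z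

end span

end KLRProof

namespace KLRProof

set_option linter.unusedSectionVars false
set_option linter.unusedSimpArgs false

open KLR

variable {k : Type} [Field k] {I : Type} [Fintype I] [DecidableEq I]

section inj

variable {C : CartanDatum k I} {n : ℕ} {β : I → ℕ} {i : I}
  (M : Type) [AddCommGroup M] [Module k M] [Module (bAlg C n β) M]
  [IsScalarTower k (bAlg C n β) M]

lemma qz_inj (d : ℕ) : Function.Injective ((SM C n β i M).qz d) := by
  induction d with
  | zero => intro a b h; exact h
  | succ d ih => exact (qq_inj C n β i M _).comp ih

lemma tpow_inj (d : ℕ) : Function.Injective ((SM C n β i M).t ^ d) := by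
  intro f g h
  ext a
  have := congrArg (fun f : VV k M => f.1 (a + d)) h
  simp only [SM_t, tV_pow_apply] at this
  simpa using this

lemma uu_inj (Λ : I → ℕ) : Function.Injective (uu C n β i M Λ) :=
  (tpow_inj M (Λ i)).comp (qz_inj M n)

/-- component. -/
def cmp (a : ℕ) : NN C n β i M →ₗ[k] VV k M where
  toFun f := (show NS k n (VV k M) from f).1 a
  map_add' _ _ := rfl
  map_smul' _ _ := rfl

variable (C n β i) in
/-- inclusion of a component. -/
noncomputable def sglN (a : ℕ) (h : a ≤ n) : VV k M →ₗ[k] NN C n β i M :=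
  sgl (k := k) (V := VV k M) a h

lemma KB_act (a : ℕ) (h : a ≤ n) (f : NN C n β i M) : (KB C n β i).X a • f =
    (SM C n β i M).xO a f := by
  have := KB_X (C := C) (n := n) (β := β) (i := i) ⟨a, by omega⟩
  simp only at this
  rw [this, ModOf_smul, Sh.act_x]

lemma KB_pow_sgl (a : ℕ) (h : a ≤ n) (j : ℕ) (v : VV k M) :
    (KB C n β i).X a ^ j • sglN C n β i M a h v =
      sglN C n β i M a h (((SM C n β i M).t ^ j) v) := by
  induction j with
  | zero => rw [pow_zero, pow_zero, one_smul]; rfl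
  | succ j ih =>
    rw [pow_succ', mul_smul, ih, KB_act M a h]
    refine (Sh.x_sgl _ _ _ _ _).trans ?_
    rw [Sh.XX_eq, pow_succ']
    rfl

variable {φR : bAlg C n β →ₙₐ[k] bAlg C (n + 1) (addA β i)} 
  {φL : bAlg C n β →ₙₐ[k] bAlg C (n + 1) (addA β i)} (Λ : I → ℕ)

lemma PsiR_P (hφR : IsUpRb C i φR) {p : OT k (bAlg C n β) (bAlg C (n + 1) (addA β i)) M φR} (hp : p ∈ PR (M := M) φR) : ∃ (L : ℕ) (m : ℕ → M),
    p = ∑ j ∈ Finset.range L, (KB C n β i).X n ^ j • otJ φR (m j) ∧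
    PsiR M hφR p = sglN C n β i M n le_rfl
      (∑ j ∈ Finset.range L, ((SM C n β i M).t ^ j) (constV k M (m j))) := by
  obtain ⟨L, m, hm, -⟩ := PZ_exists _ _ hp
  refine ⟨L, m, hm, ?_⟩
  rw [hm, map_sum, map_sum]
  refine Finset.sum_congr rfl fun j _ => ?_
  rw [map_smul, PsiR_J, jR_apply]
  exact KB_pow_sgl M n le_rfl j _

lemma PsiL_P (hφL : IsUpLb C i φL) (Λ : I → ℕ) {p : OT k (bAlg C n β) (bAlg C (n + 1) (addA β i)) M φL} (hp : p ∈ PL (M := M) φL) : ∃ (L : ℕ) (m : ℕ → M),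
    p = ∑ j ∈ Finset.range L, (KB C n β i).X 0 ^ j • otJ φL (m j) ∧
    PsiL M Λ hφL p = sglN C n β i M 0 (Nat.zero_le n)
      (uu C n β i M Λ (∑ j ∈ Finset.range L, ((SM C n β i M).t ^ j) (constV k M (m j)))) := by
  obtain ⟨L, m, hm, -⟩ := PZ_exists _ _ hp
  refine ⟨L, m, hm, ?_⟩
  rw [hm, map_sum, map_sum, map_sum]
  refine Finset.sum_congr rfl fun j _ => ?_
  rw [map_smul, PsiL_J, jL_apply, ← end_comm ((SM C n β i M).PP_comm
    (pow_mem (SM C n β i M).t_mem j) (uu_mem C n β i M Λ))]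
  exact KB_pow_sgl M 0 (Nat.zero_le n) j _

lemma PsiR_inj (hφR : IsUpRb C i φR) : Function.Injective (PsiR M hφR) := by
  rw [injective_iff_map_eq_zero]
  intro z hz
  refine (spanR φR hφR).inj ((PsiR M hφR).restrictScalars k) (fun d => cmp M (n - d)) ?_ ?_ z
    (topR φR hφR z) hz
  · intro d d' h hd p hp
    obtain ⟨L, m, -, h1⟩ := PsiR_P M hφR hp
    change cmp M _ (PsiR M hφR _) = 0
    rw [map_smul, h1]
    exact ((SM C n β i M).zR (SM_sum C n β i M) _ d' (by omega)).1 (n - d) (by omega)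
  · intro d hd p hp h0
    obtain ⟨L, m, hm, h1⟩ := PsiR_P M hφR hp
    change cmp M _ (PsiR M hφR _) = 0 at h0
    rw [map_smul, h1] at h0
    have h2 := ((SM C n β i M).zR (SM_sum C n β i M)
      (∑ j ∈ Finset.range L, ((SM C n β i M).t ^ j) (constV k M (m j))) d (by omega)).2
    have h3 := h2.symm.trans h0
    have h4 := qz_inj M d (h3.trans (map_zero _).symm)
    have h5 := poly_inj L m h4
    rw [hm]
    refine Finset.sum_eq_zero fun j hj => ?_
    rw [h5 j (Finset.mem_range.1 hj), map_zero, smul_zero]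

lemma PsiL_inj (hφL : IsUpLb C i φL) (Λ : I → ℕ) : Function.Injective (PsiL M Λ hφL) := by
  rw [injective_iff_map_eq_zero]
  intro z hz
  refine (spanL φL hφL).inj ((PsiL M Λ hφL).restrictScalars k) (fun d => cmp M d) ?_ ?_ z
    (topL φL hφL z) hz
  · intro d d' h hd p hp
    obtain ⟨L, m, -, h1⟩ := PsiL_P M hφL Λ hp
    change cmp M _ (PsiL M Λ hφL _) = 0
    rw [map_smul, h1]
    exact ((SM C n β i M).zL (SM_sum C n β i M) _ d' (by omega)).1 d (by omega)
  · intro d hd p hp h0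
    obtain ⟨L, m, hm, h1⟩ := PsiL_P M hφL Λ hp
    change cmp M _ (PsiL M Λ hφL _) = 0 at h0
    rw [map_smul, h1] at h0
    have h2 := ((SM C n β i M).zL (SM_sum C n β i M)
      (uu C n β i M Λ (∑ j ∈ Finset.range L, ((SM C n β i M).t ^ j) (constV k M (m j)))) d
      (by omega)).2
    have h3 := h2.symm.trans h0
    have h4 := uu_inj M Λ (h3.trans (map_zero _).symm)
    have h5 := poly_inj L m h4
    rw [hm]
    refine Finset.sum_eq_zero fun j hj => ?_
    rw [h5 j (Finset.mem_range.1 hj), map_zero, smul_zero]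

variable (C n β i) in
/-- the element `a^Λ(x_1) τ_1 ⋯ τ_n`. -/
noncomputable def gg : bAlg C (n + 1) (addA β i) :=
  aLam C Λ (n + 1) (addA β i) * tauProd C n (addA β i)

variable [Module (cAlg C Λ n β) M]

variable {Λ}

lemma aLam_smul (hcomp : ∀ (r : bAlg C n β) (m : M), r • m = toC C (Λ := Λ) r • m)
    (f : NN C n β i M) : aLam C Λ (n + 1) (addA β i) • f =
    sglN C n β i M 0 (Nat.zero_le n) (((SM C n β i M).t ^ Λ i) (cmp M 0 f)) :=
  Sh.act_aLam _ _ _ (SM_cyc M hcomp) f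

lemma PsiR_gg (hφR : IsUpRb C i φR)
    (hcomp : ∀ (r : bAlg C n β) (m : M), r • m = toC C (Λ := Λ) r • m)
    (m : M) : PsiR M hφR (gg C n β i Λ • otJ φR m) = jL C n β i M Λ m := by
  rw [map_smul, PsiR_J, gg, mul_smul, aLam_smul M hcomp, jL_apply, tauProd_eq]
  have h2 := ((SM C n β i M).zR (SM_sum C n β i M) (constV k M m) n le_rfl).2
  rw [Nat.sub_self] at h2
  have h3 : cmp M 0 (zz (fun d => tB C n (addA β i) (n - 1 - d)) n • jR C n β i M m) =
    (SM C n β i M).qz n (constV k M m) := h2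
  rw [h3]
  rfl

/-- the map `m ↦ a^Λ(x_1) τ_1 ⋯ τ_n ⊗ m`. -/
noncomputable def jj (φR : bAlg C n β →ₙₐ[k] bAlg C (n + 1) (addA β i)) (Λ : I → ℕ) :
    M →ₗ[k] OT k (bAlg C n β) (bAlg C (n + 1) (addA β i)) M φR :=
  (Algebra.lsmul k k _ (gg C n β i Λ)) ∘ₗ otJ φR

lemma jj_hj (hφR : IsUpRb C i φR) (hφL : IsUpLb C i φL)
    (hcomp : ∀ (r : bAlg C n β) (m : M), r • m = toC C (Λ := Λ) r • m) (r : bAlg C n β) (m : M) : jj M φR Λ (r • m) = φL r • jj M φR Λ m := by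
  apply PsiR_inj M hφR
  change PsiR M hφR (gg C n β i Λ • otJ φR (r • m)) =
    PsiR M hφR (φL r • (gg C n β i Λ • otJ φR m))
  rw [PsiR_gg M hφR hcomp, map_smul (PsiR M hφR) (φL r), PsiR_gg M hφR hcomp, jL_hj M Λ hφL]

/-- the injection. -/
noncomputable def iota (hφR : IsUpRb C i φR) (hφL : IsUpLb C i φL)
    (hcomp : ∀ (r : bAlg C n β) (m : M), r • m = toC C (Λ := Λ) r • m) : OT k (bAlg C n β) (bAlg C (n + 1) (addA β i)) M φL
    →ₗ[bAlg C (n + 1) (addA β i)] OT k (bAlg C n β) (bAlg C (n + 1) (addA β i)) M φR :=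
  otLift φL (jj M φR Λ) (jj_hj M hφR hφL hcomp)

lemma iota_J (hφR : IsUpRb C i φR) (hφL : IsUpLb C i φL)
    (hcomp : ∀ (r : bAlg C n β) (m : M), r • m = toC C (Λ := Λ) r • m) (m : M) : iota M hφR hφL hcomp (otJ φL m) = gg C n β i Λ • otJ φR m :=
  otLift_J _ _ _ _

lemma Psi_iota (hφR : IsUpRb C i φR) (hφL : IsUpLb C i φL)
    (hcomp : ∀ (r : bAlg C n β) (m : M), r • m = toC C (Λ := Λ) r • m) (z) : PsiR M hφR (iota M hφR hφL hcomp z) = PsiL M Λ hφL z := by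
  refine ot_hom_ext φL (f := (PsiR M hφR).comp (iota M hφR hφL hcomp)) (fun m => ?_) z
  rw [LinearMap.comp_apply, iota_J, PsiR_gg M hφR hcomp, PsiL_J]

lemma iota_inj (hφR : IsUpRb C i φR) (hφL : IsUpLb C i φL)
    (hcomp : ∀ (r : bAlg C n β) (m : M), r • m = toC C (Λ := Λ) r • m) : Function.Injective (iota M hφR hφL hcomp) := by
  intro a b h
  apply PsiL_inj M hφL Λ
  rw [← Psi_iota M hφR hφL hcomp, h, Psi_iota]

lemma aLam_mem (hφR : IsUpRb C i φR) (hφL : IsUpLb C i φL)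
    (hcomp : ∀ (r : bAlg C n β) (m : M), r • m = toC C (Λ := Λ) r • m) (z) : aLam C Λ (n + 1) (addA β i) • z ∈
    LinearMap.range (iota M hφR hφL hcomp) := by
  obtain ⟨p, hp, rfl⟩ := (spanR φR hφR).nf n le_rfl z (topR φR hφR z)
  obtain ⟨L, m, hm, h1⟩ := PsiR_P M hφR (hp n)
  refine ⟨∑ j ∈ Finset.range L, (KB C n β i).X 0 ^ j • otJ φL (m j), ?_⟩
  apply PsiR_inj M hφR
  rw [Psi_iota, map_smul, aLam_smul M hcomp, map_sum, map_sum, map_sum (cmp M 0), Finset.sum_range_succ,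
    Finset.sum_eq_zero (s := Finset.range n), zero_add, map_smul (PsiR M hφR), h1]
  · have h2 := ((SM C n β i M).zR (SM_sum C n β i M)
      (∑ j ∈ Finset.range L, ((SM C n β i M).t ^ j) (constV k M (m j))) n le_rfl).2
    rw [Nat.sub_self] at h2
    refine Eq.trans ?_ (congrArg (fun v => sglN C n β i M 0 (Nat.zero_le n)
      (((SM C n β i M).t ^ Λ i) v)) h2.symm)
    change _ = sglN C n β i M 0 (Nat.zero_le n) (uu C n β i M Λ _)
    rw [map_sum, map_sum]
    refine Finset.sum_congr rfl fun j _ => ?_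
    rw [map_smul, PsiL_J, jL_apply, ← end_comm ((SM C n β i M).PP_comm
      (pow_mem (SM C n β i M).t_mem j) (uu_mem C n β i M Λ))]
    exact KB_pow_sgl M 0 (Nat.zero_le n) j _
  · intro d hd
    rw [Finset.mem_range] at hd
    obtain ⟨L', m', hm', h1'⟩ := PsiR_P M hφR (hp d)
    rw [map_smul, h1']
    exact ((SM C n β i M).zR (SM_sum C n β i M) _ d (by omega)).1 0 (by omega)

end inj

end KLRProof

namespace KLRProof

set_option linter.unusedSectionVars false
set_option linter.unusedSimpArgs false
set_option linter.style.haveILetI false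

open KLR

variable {k : Type} [Field k] {I : Type} [Fintype I] [DecidableEq I]

section pmap

variable {C : CartanDatum k I} {Λ : I → ℕ} {n : ℕ} {β : I → ℕ} {i : I}

lemma toC_mk (γ : I → ℕ) (y : FA k I n) : (toC C (RingQuot.mkAlgHom k (URel C n γ) y) : cAlg C Λ n γ) =
    RingQuot.mkAlgHom k (CRel C Λ n γ) y := by
  simp [toC]

lemma toC_surj (γ : I → ℕ) : Function.Surjective (toC C : bAlg C n γ → cAlg C Λ n γ) := by
  intro z
  obtain ⟨y, rfl⟩ := RingQuot.mkAlgHom_surjective k (CRel C Λ n γ) z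
  exact ⟨RingQuot.mkAlgHom k (URel C n γ) y, toC_mk γ y⟩

lemma toC_phi {φR : bAlg C n β →ₙₐ[k] bAlg C (n + 1) (addA β i)}
    {φc : cAlg C Λ n β →ₙₐ[k] cAlg C Λ (n + 1) (addA β i)} (hφR : IsUpRb C i φR)
    (hφc : IsUpRc C Λ i φc) (r : bAlg C n β) : toC C (φR r) = φc (toC C r) := by
  refine bAlg_ind (p := fun r => toC C (φR r) = φc (toC C r)) ?_ ?_ ?_ ?_ ?_ ?_ ?_ r
  · intro ν; rw [hφR.1]; exact (hφc.1 ν).symm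
  · intro ν; rw [hφR.2.1]; exact (hφc.2.1 ν).symm
  · intro l h; rw [hφR.2.2]; exact (hφc.2.2 l h).symm
  · rw [map_zero, map_zero, map_zero, map_zero]
  · intro x y hx hy; rw [map_add, map_add, map_add, map_add, hx, hy]
  · intro x y hx hy; rw [map_mul, map_mul, map_mul, map_mul, hx, hy]
  · intro c x hx
    rw [map_smul φR c x, map_smul (toC C) c (φR x), map_smul (toC C) c x, map_smul φc c, hx]

section cyclo

variable {N : Type} [AddCommGroup N] [Module k N] {γ : I → ℕ} [Module (bAlg C n γ) N]
  [IsScalarTower k (bAlg C n γ) N]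

/-- a module killed by `a^Λ` is a module over the cyclotomic quotient. -/
noncomputable def rhoC (h : ∀ z : N, aLam C Λ n γ • z = 0) :
    cAlg C Λ n γ →ₐ[k] Module.End k N :=
  RingQuot.liftAlgHom (S := k)
    ⟨(Algebra.lsmul k k N).comp (RingQuot.mkAlgHom k (URel C n γ)), by
      intro x y hxy
      rw [AlgHom.comp_apply, AlgHom.comp_apply]
      cases hxy with
      | base hb => rw [RingQuot.mkAlgHom_rel k (URel.base hb)]
      | unit => rw [RingQuot.mkAlgHom_rel k URel.unit]
      | cyc =>
        rw [map_zero, map_zero]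
        ext z
        exact h z⟩

lemma rhoC_apply (h : ∀ z : N, aLam C Λ n γ • z = 0) (b : bAlg C n γ) (z : N) :
    rhoC h (toC C b) z = b • z := by
  obtain ⟨y, rfl⟩ := RingQuot.mkAlgHom_surjective k (URel C n γ) b
  rw [toC_mk]
  simp [rhoC]

end cyclo

variable (M : Type) [AddCommGroup M] [Module k M] [Module (bAlg C n β) M]
  [IsScalarTower k (bAlg C n β) M] [Module (cAlg C Λ n β) M] [IsScalarTower k (cAlg C Λ n β) M]
  {φR : bAlg C n β →ₙₐ[k] bAlg C (n + 1) (addA β i)}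
  {φc : cAlg C Λ n β →ₙₐ[k] cAlg C Λ (n + 1) (addA β i)}

variable (φc) in
/-- inflation. -/
noncomputable abbrev cInst : Module (bAlg C (n + 1) (addA β i))
    (OT k (cAlg C Λ n β) (cAlg C Λ (n + 1) (addA β i)) M φc) :=
  Module.compHom _ (toC C (Λ := Λ) (n := n + 1) (β := addA β i)).toRingHom

variable (φc) in
lemma cTower : letI := cInst M φc
    IsScalarTower k (bAlg C (n + 1) (addA β i))
      (OT k (cAlg C Λ n β) (cAlg C Λ (n + 1) (addA β i)) M φc) := by
  letI := cInst M φc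
  constructor
  intro c b z
  change toC C (Λ := Λ) (c • b) • z = c • (toC C (Λ := Λ) b • z)
  rw [map_smul, smul_assoc]

/-- the projection. -/
noncomputable def pmap (hφR : IsUpRb C i φR) (hφc : IsUpRc C Λ i φc)
    (hcomp : ∀ (r : bAlg C n β) (m : M), r • m = toC C (Λ := Λ) r • m) : letI := cInst M φc
    OT k (bAlg C n β) (bAlg C (n + 1) (addA β i)) M φR →ₗ[bAlg C (n + 1) (addA β i)]
      OT k (cAlg C Λ n β) (cAlg C Λ (n + 1) (addA β i)) M φc :=
  letI := cInst M φc
  haveI := cTower M φc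
  otLift φR (otJ φc) (by
    intro r m
    change _ = toC C (Λ := Λ) (φR r) • otJ φc m
    rw [hcomp, otJ_smul, toC_phi hφR hφc])

lemma pmap_mk (hφR : IsUpRb C i φR) (hφc : IsUpRc C Λ i φc)
    (hcomp : ∀ (r : bAlg C n β) (m : M), r • m = toC C (Λ := Λ) r • m)
    (b : bAlg C (n + 1) (addA β i)) (m : M) :
    pmap M hφR hφc hcomp (b • otJ φR m) = toC C (Λ := Λ) b • otJ φc m := by
  letI := cInst M φc
  haveI := cTower M φc
  rw [← OTmk_eq]
  exact otLift_mk _ _ _ _ _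

lemma pmap_surj (hφR : IsUpRb C i φR) (hφc : IsUpRc C Λ i φc)
    (hcomp : ∀ (r : bAlg C n β) (m : M), r • m = toC C (Λ := Λ) r • m) :
    Function.Surjective (pmap M hφR hφc hcomp) := by
  letI := cInst M φc
  haveI := cTower M φc
  intro z
  refine ot_induction φc (LinearMap.range ((pmap M hφR hφc hcomp).restrictScalars k)) ?_ z
  intro b m
  obtain ⟨b, rfl⟩ := toC_surj _ b
  exact ⟨b • otJ φR m, pmap_mk M hφR hφc hcomp b m⟩

lemma pmap_iota {φL : bAlg C n β →ₙₐ[k] bAlg C (n + 1) (addA β i)}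
    (hφR : IsUpRb C i φR) (hφL : IsUpLb C i φL) (hφc : IsUpRc C Λ i φc)
    (hcomp : ∀ (r : bAlg C n β) (m : M), r • m = toC C (Λ := Λ) r • m) (z) :
    pmap M hφR hφc hcomp (iota M hφR hφL hcomp z) = 0 := by
  letI := cInst M φc
  haveI := cTower M φc
  refine ot_hom_ext φL (f := (pmap M hφR hφc hcomp).comp (iota M hφR hφL hcomp)) (g := 0)
    (fun m => ?_) z
  rw [LinearMap.comp_apply, iota_J, pmap_mk, gg, map_mul, toC_aLam, zero_mul, zero_smul]
  rfl

/-- a section modulo the image of `iota`. -/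
lemma ker_le {φL : bAlg C n β →ₙₐ[k] bAlg C (n + 1) (addA β i)}
    (hφR : IsUpRb C i φR) (hφL : IsUpLb C i φL) (hφc : IsUpRc C Λ i φc)
    (hcomp : ∀ (r : bAlg C n β) (m : M), r • m = toC C (Λ := Λ) r • m) (z)
    (hz : pmap M hφR hφc hcomp z = 0) : z ∈ LinearMap.range (iota M hφR hφL hcomp) := by
  set K := LinearMap.range (iota M hφR hφL hcomp) with hK
  have hk : ∀ z : (OT k (bAlg C n β) (bAlg C (n + 1) (addA β i)) M φR) ⧸ K,
      aLam C Λ (n + 1) (addA β i) • z = 0 := by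
    intro z
    obtain ⟨y, rfl⟩ := Submodule.Quotient.mk_surjective _ z
    rw [← Submodule.Quotient.mk_smul, Submodule.Quotient.mk_eq_zero]
    exact aLam_mem M hφR hφL hcomp y
  let Q := ModOf (k := k) (rhoC hk)
  let j : M →ₗ[k] Q := (K.mkQ.restrictScalars k) ∘ₗ otJ φR
  have hj : ∀ (r : cAlg C Λ n β) (m : M), j (r • m) = φc r • j m := by
    intro r m
    obtain ⟨r, rfl⟩ := toC_surj _ r
    rw [← hcomp, ← toC_phi hφR hφc]
    refine Eq.trans ?_ (rhoC_apply hk (φR r) (j m)).symm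
    change K.mkQ (otJ φR (r • m)) = φR r • K.mkQ (otJ φR m)
    rw [otJ_smul, map_smul]
  let σ := otLift φc j hj
  letI := cInst M φc
  haveI := cTower M φc
  have key : ∀ z, (σ.restrictScalars k) (((pmap M hφR hφc hcomp).restrictScalars k) z) =
      (K.mkQ.restrictScalars k) z := by
    intro z
    refine ot_induction φR (LinearMap.eqLocus ((σ.restrictScalars k) ∘ₗ
      ((pmap M hφR hφc hcomp).restrictScalars k)) (K.mkQ.restrictScalars k)) ?_ z
    intro b m
    change σ (pmap M hφR hφc hcomp (b • otJ φR m)) = K.mkQ (b • otJ φR m)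
    rw [pmap_mk, map_smul]
    refine Eq.trans ?_ (map_smul K.mkQ b (otJ φR m)).symm
    change rhoC hk (toC C b) (σ (otJ φc m)) = _
    rw [otLift_J]
    exact rhoC_apply hk b _
  have h := key z
  have h0 : ((pmap M hφR hφc hcomp).restrictScalars k) z = 0 := hz
  rw [h0, map_zero] at h
  exact (Submodule.Quotient.mk_eq_zero K).1 h.symm

end pmap

end KLRProof

namespace KLRProof

set_option linter.unusedSectionVars false
set_option linter.unusedSimpArgs false
set_option linter.style.haveILetI false

open KLR TensorProduct

variable {k : Type} [Field k] {I : Type} [Fintype I] [DecidableEq I]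

section grading

variable {C : CartanDatum k I} {Λ : I → ℕ} {n : ℕ} {β : I → ℕ} {i : I}

/-- insertion of `i` in position `l`. -/
def ins (i : I) (ν : Fin n → I) (l : ℕ) : Fin (n + 1) → I := fun a =>
  if a.1 < l then cl i ν a.1 else if a.1 = l then i else cl i ν (a.1 - 1)

lemma ins_n (ν : Fin n → I) : ins i ν n = Fin.snoc ν i := by
  funext a
  refine Fin.lastCases ?_ (fun b => ?_) a
  · simp [ins]
  · simp [ins, cl]

lemma ins_sw (ν : Fin n → I) (l : ℕ) (h : l + 1 < n + 1) : sw l h (ins i ν (l + 1)) = ins i ν l := by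
  funext a
  simp only [sw, Function.comp_apply, Equiv.swap_apply_def, Fin.ext_iff]
  by_cases h1 : a.1 = l
  · simp [ins, h1]
  · by_cases h2 : a.1 = l + 1
    · simp [ins, h2]
    · simp only [h1, h2, if_false, ins]
      by_cases h3 : a.1 < l
      · rw [if_pos (by omega), if_pos h3]
      · rw [if_neg (by omega), if_neg h3]

lemma B_symm (a b : I) : B C a b = B C b a := C.symmetrize a b

lemma sum_cl (ν : Fin n → I) (hν : ν ∈ seqs β n) :
    ∑ b ∈ Finset.range n, B C (cl i ν (n - 1 - b)) i = pairB C i β := by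
  rw [Finset.sum_range_reflect (fun b => B C (cl i ν b) i), Finset.sum_range]
  have h1 : ∀ b : Fin n, B C (cl i ν b.1) i = ∑ j, if ν b = j then B C i j else 0 := by
    intro b
    rw [Finset.sum_ite_eq, if_pos (Finset.mem_univ _), B_symm]
    simp [cl]
  simp only [h1]
  rw [Finset.sum_comm, pairB]
  refine Finset.sum_congr rfl fun j _ => ?_
  rw [← (mem_seqs β ν).1 hν, content, ← Finset.sum_filter, Finset.sum_const, nsmul_eq_mul]

variable {𝒜 : ℤ → Submodule k (bAlg C (n + 1) (addA β i))}

lemma zz_deg (h : IsKLRGrading C (toB C) 𝒜) (ν : Fin n → I) (d : ℕ) (hd : d ≤ n) :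
    zz (fun d => tB C n (addA β i) (n - 1 - d)) d * (KB C n β i).e (ins i ν n) ∈
      𝒜 (-∑ b ∈ Finset.range d, B C (cl i ν (n - 1 - b)) i) ∧
    zz (fun d => tB C n (addA β i) (n - 1 - d)) d * (KB C n β i).e (ins i ν n) =
      (KB C n β i).e (ins i ν (n - d)) *
      (zz (fun d => tB C n (addA β i) (n - 1 - d)) d * (KB C n β i).e (ins i ν n)) := by
  induction d with
  | zero =>
    constructor
    · simpa [zz, KB_e] using h.2.1 (ins i ν n)
    · simp [zz, (KB C n β i).ee]
  | succ d ih =>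
    obtain ⟨ih1, ih2⟩ := ih (by omega)
    set z := zz (fun d => tB C n (addA β i) (n - 1 - d)) d * (KB C n β i).e (ins i ν n) with hz
    have e0 : zz (fun d => tB C n (addA β i) (n - 1 - d)) (d + 1) * (KB C n β i).e (ins i ν n) =
        (KB C n β i).T (n - 1 - d) * z := by
      rw [zz, mul_assoc]; rfl
    have hl : n - 1 - d + 1 < n + 1 := by omega
    have el : n - d = n - 1 - d + 1 := by omega
    have el' : n - (d + 1) = n - 1 - d := by omega
    rw [e0, el']
    have e1 : (KB C n β i).T (n - 1 - d) * z = ((KB C n β i).T (n - 1 - d) *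
        (KB C n β i).e (ins i ν (n - 1 - d + 1))) * z := by
      rw [mul_assoc, ← el, ← ih2]
    constructor
    · rw [e1, Finset.sum_range_succ, neg_add,
        add_comm (-∑ x ∈ Finset.range d, B C (cl i ν (n - 1 - x)) i)]
      refine h.1.2.1 ?_ ih1
      have := h.2.2.2 (n - 1 - d) hl (ins i ν (n - 1 - d + 1))
      rw [map_mul] at this
      convert this using 2
      · simp [ins]
      · rw [KB_T, tB, dif_pos hl]
      · rfl
    · rw [e1, (KB C n β i).te _ hl, ins_sw, mul_assoc, ← mul_assoc ((KB C n β i).e (ins i ν (n - 1 - d)))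
        ((KB C n β i).e (ins i ν (n - 1 - d))), (KB C n β i).ee, if_pos rfl]

lemma xpow_deg (h : IsKLRGrading C (toB C) 𝒜) (w : Fin (n + 1) → I) (j : ℕ) :
    (KB C n β i).X 0 ^ j * (KB C n β i).e w ∈ 𝒜 (j * B C (w 0) (w 0)) := by
  induction j with
  | zero => simpa [KB_e] using h.2.1 w
  | succ j ih =>
    have e1 : (KB C n β i).X 0 ^ (j + 1) * (KB C n β i).e w =
        ((KB C n β i).X 0 * (KB C n β i).e w) * ((KB C n β i).X 0 ^ j * (KB C n β i).e w) := by
      have hc : Commute ((KB C n β i).X 0 ^ j) ((KB C n β i).e w) :=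
        Commute.pow_left ((KB C n β i).xe 0 w) j
      rw [pow_succ', mul_assoc, mul_assoc, hc.eq, ← mul_assoc ((KB C n β i).e w),
        (KB C n β i).ee, if_pos rfl]
    rw [e1]
    have := h.2.2.1 0 w
    rw [map_mul] at this
    have h2 := h.1.2.1 this ih
    have e2 : B C (w 0) (w 0) + (j : ℤ) * B C (w 0) (w 0) = ((j + 1 : ℕ) : ℤ) * B C (w 0) (w 0) := by
      push_cast; ring
    rw [e2] at h2
    exact h2

lemma gg_deg (h : IsKLRGrading C (toB C) 𝒜) :
    gg C n β i Λ * eRb C n β i ∈ 𝒜 (2 * C.d i * (Λ i : ℤ) - pairB C i β) := by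
  rw [eR_eq, Finset.mul_sum]
  refine Submodule.sum_mem _ fun ν hν => ?_
  obtain ⟨h1, h2⟩ := zz_deg h ν n le_rfl
  rw [sum_cl ν hν] at h1
  rw [Nat.sub_self] at h2
  rw [gg, tauProd_eq, mul_assoc (aLam C Λ (n + 1) (addA β i)), ← ins_n]
  have e0 : aLam C Λ (n + 1) (addA β i) * (zz (fun d => tB C n (addA β i) (n - 1 - d)) n *
      (KB C n β i).e (ins i ν n)) = aLam C Λ (n + 1) (addA β i) * (KB C n β i).e (ins i ν 0) *
      (zz (fun d => tB C n (addA β i) (n - 1 - d)) n * (KB C n β i).e (ins i ν n)) := by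
    rw [mul_assoc, ← h2]
  refine Eq.subst (motive := fun z => z ∈ 𝒜 _) e0.symm ?_
  rw [sub_eq_add_neg]
  refine h.1.2.1 ?_ h1
  rw [aLam_eq C Λ (n + 1) (addA β i) (Nat.succ_pos n), Finset.sum_mul]
  refine Submodule.sum_mem _ fun w _ => ?_
  have e1 : (toB C (Ee C w) : bAlg C (n + 1) (addA β i)) * (KB C n β i).e (ins i ν 0) =
    if w = ins i ν 0 then (KB C n β i).e w else 0 := (KB C n β i).ee w _
  rw [mul_assoc (_ ^ _), e1]
  split_ifs with hw
  · have h3 := xpow_deg h w (Λ i)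
    have hw0 : w 0 = i := by rw [hw]; simp [ins]
    rw [hw0] at h3
    have e2 : ((Λ i : ℕ) : ℤ) * B C i i = 2 * C.d i * (Λ i : ℤ) := by
      rw [B, C.a_diag]; ring
    rw [e2] at h3
    have e3 : w ⟨0, Nat.succ_pos n⟩ = i := hw0
    rw [e3]
    exact h3
  · rw [mul_zero]; exact Submodule.zero_mem _

section toCdeg

variable {γ : I → ℕ} {𝒜B : ℤ → Submodule k (bAlg C n γ)} {𝒜D : ℤ → Submodule k (cAlg C Λ n γ)}

lemma toC_deg (hB : IsKLRGrading C (toB C) 𝒜B) (hD : IsKLRGrading C (toCB C Λ) 𝒜D)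
    {c : ℤ} {b : bAlg C n γ} (hb : b ∈ 𝒜B c) : toC C b ∈ 𝒜D c := by
  classical
  let 𝒜' : ℤ → Submodule k (bAlg C n γ) := fun c => 𝒜B c ⊓ (𝒜D c).comap (toC C).toLinearMap
  have hle : ∀ c, 𝒜' c ≤ ⨆ c, 𝒜' c := fun c => le_iSup _ c
  have hmul : ∀ x y, x ∈ (⨆ c, 𝒜' c) → y ∈ (⨆ c, 𝒜' c) → x * y ∈ (⨆ c, 𝒜' c) := by
    intro x y hx hy
    refine Submodule.iSup_induction 𝒜' (motive := fun x => x * y ∈ (⨆ c, 𝒜' c)) hx ?_ ?_ ?_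
    · intro c x hx
      refine Submodule.iSup_induction 𝒜' (motive := fun y => x * y ∈ (⨆ c, 𝒜' c)) hy ?_ ?_ ?_
      · intro c' y hy
        refine hle (c + c') ⟨hB.1.2.1 hx.1 hy.1, ?_⟩
        change toC C (Λ := Λ) (x * y) ∈ 𝒜D (c + c')
        rw [map_mul]
        exact hD.1.2.1 hx.2 hy.2
      · rw [mul_zero]; exact Submodule.zero_mem _
      · intro a b ha hb; rw [mul_add]; exact Submodule.add_mem _ ha hb
    · rw [zero_mul]; exact Submodule.zero_mem _
    · intro a b ha hb; rw [add_mul]; exact Submodule.add_mem _ ha hb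
  have hspl : ∀ z : bAlg C n γ, (∀ ν, z * toB C (Ee C ν) ∈ ⨆ c, 𝒜' c) → z ∈ ⨆ c, 𝒜' c := by
    intro z hz
    have : z = ∑ ν ∈ seqs γ n, z * toB C (Ee C ν) := by
      rw [← Finset.mul_sum, toB_sum, mul_one]
    rw [this]
    exact Submodule.sum_mem _ fun ν _ => hz ν
  have htop : ∀ r, r ∈ ⨆ c, 𝒜' c := by
    intro r
    refine bAlg_ind (p := fun r => r ∈ ⨆ c, 𝒜' c) ?_ ?_ ?_ ?_ ?_ ?_ ?_ r
    · intro ν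
      exact hle 0 ⟨hB.2.1 ν, hD.2.1 ν⟩
    · intro a
      refine hspl _ fun ν => ?_
      rw [← map_mul]
      exact hle _ ⟨hB.2.2.1 a ν, hD.2.2.1 a ν⟩
    · intro l h
      refine hspl _ fun ν => ?_
      rw [← map_mul]
      exact hle _ ⟨hB.2.2.2 l h ν, hD.2.2.2 l h ν⟩
    · exact Submodule.zero_mem _
    · intro x y; exact Submodule.add_mem _
    · exact hmul
    · intro c x; exact Submodule.smul_mem _ c
  letI := hB.1.2.2.chooseDecomposition
  have hdec : ∀ r : bAlg C n γ, ∀ c, ((DirectSum.decompose 𝒜B r c : 𝒜B c) : bAlg C n γ) ∈ 𝒜' c := by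
    intro r
    refine Submodule.iSup_induction 𝒜' (motive := fun r => ∀ c,
      ((DirectSum.decompose 𝒜B r c : 𝒜B c) : bAlg C n γ) ∈ 𝒜' c) (htop r) ?_ ?_ ?_
    · intro c x hx c'
      by_cases hc : c = c'
      · subst hc
        rw [DirectSum.decompose_of_mem_same 𝒜B hx.1]
        exact hx
      · rw [DirectSum.decompose_of_mem_ne 𝒜B hx.1 hc]
        exact Submodule.zero_mem _
    · intro c
      rw [DirectSum.decompose_zero]
      exact Submodule.zero_mem _
    · intro x y hx hy c
      rw [DirectSum.decompose_add]
      exact Submodule.add_mem _ (hx c) (hy c)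
  have h1 := hdec b c
  rw [DirectSum.decompose_of_mem_same 𝒜B hb] at h1
  exact h1.2

end toCdeg

variable (M : Type) [AddCommGroup M] [Module k M] [Module (bAlg C n β) M]
  [IsScalarTower k (bAlg C n β) M] [Module (cAlg C Λ n β) M] [IsScalarTower k (cAlg C Λ n β) M]
  {φR φL : bAlg C n β →ₙₐ[k] bAlg C (n + 1) (addA β i)}
  {φc : cAlg C Λ n β →ₙₐ[k] cAlg C Λ (n + 1) (addA β i)}

lemma iota_deg (hφR : IsUpRb C i φR) (hφL : IsUpLb C i φL)
    (hcomp : ∀ (r : bAlg C n β) (m : M), r • m = toC C (Λ := Λ) r • m)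
    (h : IsKLRGrading C (toB C) 𝒜) (grM : ℤ → Submodule k M) (m : ℤ)
    (x : OT k (bAlg C n β) (bAlg C (n + 1) (addA β i)) M φL)
    (hx : x ∈ otGr k (bAlg C n β) (bAlg C (n + 1) (addA β i)) M φL 𝒜 grM
                (m - (2 * C.d i * (Λ i : ℤ) - pairB C i β))) :
    iota M hφR hφL hcomp x ∈ otGr k (bAlg C n β) (bAlg C (n + 1) (addA β i)) M φR 𝒜 grM m := by
  have hgen : ∀ (c₁ c₂ : ℤ) (b : bAlg C (n + 1) (addA β i)) (y : M),
      c₁ + c₂ = m - (2 * C.d i * (Λ i : ℤ) - pairB C i β) → b ∈ 𝒜 c₁ → y ∈ grM c₂ →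
      iota M hφR hφL hcomp (OTmk k (bAlg C n β) (bAlg C (n + 1) (addA β i)) M φL (b ⊗ₜ[k] y)) ∈
      otGr k (bAlg C n β) (bAlg C (n + 1) (addA β i)) M φR 𝒜 grM m := by
    intro c₁ c₂ b y hc hb hy
    have hj : eRb C n β i • otJ φR y = otJ φR y := by
      refine eR_smul (otJ φR) ?_ y
      intro ν m
      rw [otJ_smul, hφR.1]
    have e1 : iota M hφR hφL hcomp
        (OTmk k (bAlg C n β) (bAlg C (n + 1) (addA β i)) M φL (b ⊗ₜ[k] y)) =
        OTmk k (bAlg C n β) (bAlg C (n + 1) (addA β i)) M φR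
          ((b * (gg C n β i Λ * eRb C n β i)) ⊗ₜ[k] y) := by
      rw [OTmk_eq, OTmk_eq, map_smul, iota_J, mul_smul, mul_smul, hj]
    have e2 : c₁ + (2 * C.d i * (Λ i : ℤ) - pairB C i β) + c₂ = m := by linarith
    exact Submodule.subset_span ⟨c₁ + (2 * C.d i * (Λ i : ℤ) - pairB C i β), c₂,
      b * (gg C n β i Λ * eRb C n β i), y, e2, h.1.2.1 hb (gg_deg h), hy, e1⟩
  unfold otGr at hx
  refine Submodule.span_induction ?_ ?_ ?_ ?_ hx
  · rintro _ ⟨c₁, c₂, b, y, hc, hb, hy, rfl⟩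
    exact hgen c₁ c₂ b y hc hb hy
  · rw [map_zero]; exact Submodule.zero_mem _
  · intro x y _ _ hx hy; rw [map_add]; exact Submodule.add_mem _ hx hy
  · intro c x _ hx; rw [LinearMap.map_smul_of_tower]; exact Submodule.smul_mem _ c hx

lemma pmap_deg (hφR : IsUpRb C i φR) (hφc : IsUpRc C Λ i φc)
    (hcomp : ∀ (r : bAlg C n β) (m : M), r • m = toC C (Λ := Λ) r • m)
    (h : IsKLRGrading C (toB C) 𝒜) {𝒜D : ℤ → Submodule k (cAlg C Λ (n + 1) (addA β i))}
    (hD : IsKLRGrading C (toCB C Λ) 𝒜D) (grM : ℤ → Submodule k M) (m : ℤ)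
    (x : OT k (bAlg C n β) (bAlg C (n + 1) (addA β i)) M φR)
    (hx : x ∈ otGr k (bAlg C n β) (bAlg C (n + 1) (addA β i)) M φR 𝒜 grM m) :
    pmap M hφR hφc hcomp x ∈
      otGr k (cAlg C Λ n β) (cAlg C Λ (n + 1) (addA β i)) M φc 𝒜D grM m := by
  letI := cInst M φc
  haveI := cTower M φc
  change x ∈ (otGr k (cAlg C Λ n β) (cAlg C Λ (n + 1) (addA β i)) M φc 𝒜D grM m).comap
    ((pmap M hφR hφc hcomp).restrictScalars k)
  refine Submodule.span_le.2 ?_ hx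
  rintro _ ⟨c₁, c₂, b, y, hc, hb, hy, rfl⟩
  refine Submodule.subset_span ⟨c₁, c₂, toC C b, y, hc, toC_deg h hD hb, hy, ?_⟩
  change pmap M hφR hφc hcomp _ = _
  rw [OTmk_eq, OTmk_eq, pmap_mk]

end grading

end KLRProof

namespace KLRProof

set_option linter.unusedSectionVars false
set_option linter.unusedSimpArgs false
set_option linter.style.haveILetI false

open KLR TensorProduct

variable {k : Type} [Field k] {I : Type} [Fintype I] [DecidableEq I]

section funct

variable {C : CartanDatum k I} {Λ : I → ℕ} {n : ℕ} {β : I → ℕ} {i : I}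

variable (M : Type) [AddCommGroup M] [Module k M] [Module (bAlg C n β) M]
  [IsScalarTower k (bAlg C n β) M] [Module (cAlg C Λ n β) M] [IsScalarTower k (cAlg C Λ n β) M]
  (M' : Type) [AddCommGroup M'] [Module k M'] [Module (bAlg C n β) M']
  [IsScalarTower k (bAlg C n β) M'] [Module (cAlg C Λ n β) M'] [IsScalarTower k (cAlg C Λ n β) M']
  {φR φL : bAlg C n β →ₙₐ[k] bAlg C (n + 1) (addA β i)}
  {φc : cAlg C Λ n β →ₙₐ[k] cAlg C Λ (n + 1) (addA β i)}

lemma iota_nat (hφR : IsUpRb C i φR) (hφL : IsUpLb C i φL)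
    (hcomp : ∀ (r : bAlg C n β) (m : M), r • m = toC C (Λ := Λ) r • m)
    (hcomp' : ∀ (r : bAlg C n β) (m : M'), r • m = toC C (Λ := Λ) r • m)
    (f : M → M')
    (gbar : OT k (bAlg C n β) (bAlg C (n + 1) (addA β i)) M φL →ₗ[k]
      OT k (bAlg C n β) (bAlg C (n + 1) (addA β i)) M' φL)
    (gR : OT k (bAlg C n β) (bAlg C (n + 1) (addA β i)) M φR →ₗ[k]
      OT k (bAlg C n β) (bAlg C (n + 1) (addA β i)) M' φR)
    (h1 : ∀ (b : bAlg C (n + 1) (addA β i)) (m : M),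
            gbar (OTmk k (bAlg C n β) (bAlg C (n + 1) (addA β i)) M φL (b ⊗ₜ[k] m))
              = OTmk k (bAlg C n β) (bAlg C (n + 1) (addA β i)) M' φL (b ⊗ₜ[k] f m))
    (h2 : ∀ (b : bAlg C (n + 1) (addA β i)) (m : M),
            gR (OTmk k (bAlg C n β) (bAlg C (n + 1) (addA β i)) M φR (b ⊗ₜ[k] m))
              = OTmk k (bAlg C n β) (bAlg C (n + 1) (addA β i)) M' φR (b ⊗ₜ[k] f m)) (z) :
    iota M' hφR hφL hcomp' (gbar z) = gR (iota M hφR hφL hcomp z) := by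
  refine ot_induction φL (LinearMap.eqLocus
    (((iota M' hφR hφL hcomp').restrictScalars k) ∘ₗ gbar)
    (gR ∘ₗ ((iota M hφR hφL hcomp).restrictScalars k))) ?_ z
  intro b m
  change iota M' hφR hφL hcomp' (gbar _) = gR (iota M hφR hφL hcomp _)
  rw [← OTmk_eq, h1, OTmk_eq, OTmk_eq, map_smul, map_smul, iota_J, iota_J, ← mul_smul, ← mul_smul,
    ← OTmk_eq φR (b * gg C n β i Λ) m, h2, OTmk_eq]

lemma pmap_nat (hφR : IsUpRb C i φR) (hφc : IsUpRc C Λ i φc)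
    (hcomp : ∀ (r : bAlg C n β) (m : M), r • m = toC C (Λ := Λ) r • m)
    (hcomp' : ∀ (r : bAlg C n β) (m : M'), r • m = toC C (Λ := Λ) r • m)
    (f : M → M')
    (gR : OT k (bAlg C n β) (bAlg C (n + 1) (addA β i)) M φR →ₗ[k]
      OT k (bAlg C n β) (bAlg C (n + 1) (addA β i)) M' φR)
    (gc : OT k (cAlg C Λ n β) (cAlg C Λ (n + 1) (addA β i)) M φc →ₗ[k]
      OT k (cAlg C Λ n β) (cAlg C Λ (n + 1) (addA β i)) M' φc)
    (h2 : ∀ (b : bAlg C (n + 1) (addA β i)) (m : M),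
            gR (OTmk k (bAlg C n β) (bAlg C (n + 1) (addA β i)) M φR (b ⊗ₜ[k] m))
              = OTmk k (bAlg C n β) (bAlg C (n + 1) (addA β i)) M' φR (b ⊗ₜ[k] f m))
    (h3 : ∀ (b : cAlg C Λ (n + 1) (addA β i)) (m : M),
            gc (OTmk k (cAlg C Λ n β) (cAlg C Λ (n + 1) (addA β i)) M φc (b ⊗ₜ[k] m))
              = OTmk k (cAlg C Λ n β) (cAlg C Λ (n + 1) (addA β i)) M' φc
                  (b ⊗ₜ[k] f m)) (z) :
    pmap M' hφR hφc hcomp' (gR z) = gc (pmap M hφR hφc hcomp z) := by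
  letI := cInst M φc
  haveI := cTower M φc
  letI := cInst M' φc
  haveI := cTower M' φc
  refine ot_induction φR (LinearMap.eqLocus
    (((pmap M' hφR hφc hcomp').restrictScalars k) ∘ₗ gR)
    (gc ∘ₗ ((pmap M hφR hφc hcomp).restrictScalars k))) ?_ z
  intro b m
  change pmap M' hφR hφc hcomp' (gR _) = gc (pmap M hφR hφc hcomp _)
  rw [← OTmk_eq, h2, OTmk_eq, OTmk_eq, pmap_mk, pmap_mk, ← OTmk_eq φc (toC C b) m, h3, OTmk_eq]

end funct

end KLRProof

open KLR TensorProduct in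
set_option maxHeartbeats 1000000 in
/-- For every graded `R^Λ(β)`-module `M` (regarded as an `R(β)`-module via the
projection) there is a short exact sequence of graded `R(β+α_i)`-modules
`0 → q^{(α_i,2Λ-β)} F̄_i M → F_i M → F_i^Λ M → 0`, functorial in `M`, where the map
`F_i M → F_i^Λ M` is induced by the projections. -/
theorem Fbar_F_FLambda_exact {k : Type} [Field k] {I : Type} [Fintype I]
    [DecidableEq I] (C : CartanDatum k I) (Λ : I → ℕ) (β : I → ℕ) (i : I)
    (n : ℕ) (hn : ht I β = n)
    (φR : bAlg C n β →ₙₐ[k] bAlg C (n + 1) (addA β i)) (hφR : IsUpRb C i φR)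
    (φL : bAlg C n β →ₙₐ[k] bAlg C (n + 1) (addA β i)) (hφL : IsUpLb C i φL)
    (φc : cAlg C Λ n β →ₙₐ[k] cAlg C Λ (n + 1) (addA β i)) (hφc : IsUpRc C Λ i φc)
    (𝒜S : ℤ → Submodule k (bAlg C n β)) (h𝒜S : IsKLRGrading C (toB C) 𝒜S)
    (𝒜B : ℤ → Submodule k (bAlg C (n + 1) (addA β i)))
    (h𝒜B : IsKLRGrading C (toB C) 𝒜B)
    (𝒜D : ℤ → Submodule k (cAlg C Λ (n + 1) (addA β i)))
    (h𝒜D : IsKLRGrading C (toCB C Λ) 𝒜D) :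
    ∃ (ι : ∀ (M : Type) [AddCommGroup M] [Module k M] [Module (bAlg C n β) M]
        [IsScalarTower k (bAlg C n β) M] [Module (cAlg C Λ n β) M]
        [IsScalarTower k (cAlg C Λ n β) M],
        (∀ (r : bAlg C n β) (m : M), r • m = toC C (Λ := Λ) r • m) →
        (OT k (bAlg C n β) (bAlg C (n + 1) (addA β i)) M φL
          →ₗ[bAlg C (n + 1) (addA β i)]
          OT k (bAlg C n β) (bAlg C (n + 1) (addA β i)) M φR))
      (p : ∀ (M : Type) [AddCommGroup M] [Module k M] [Module (bAlg C n β) M]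
        [IsScalarTower k (bAlg C n β) M] [Module (cAlg C Λ n β) M]
        [IsScalarTower k (cAlg C Λ n β) M],
        (∀ (r : bAlg C n β) (m : M), r • m = toC C (Λ := Λ) r • m) →
        (letI : Module (bAlg C (n + 1) (addA β i))
            (OT k (cAlg C Λ n β) (cAlg C Λ (n + 1) (addA β i)) M φc) :=
          Module.compHom _ (toC C (Λ := Λ) (n := n + 1) (β := addA β i)).toRingHom;
        (OT k (bAlg C n β) (bAlg C (n + 1) (addA β i)) M φR
          →ₗ[bAlg C (n + 1) (addA β i)]
          OT k (cAlg C Λ n β) (cAlg C Λ (n + 1) (addA β i)) M φc))),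
      ∀ (M : Type) [AddCommGroup M] [Module k M] [Module (bAlg C n β) M]
        [IsScalarTower k (bAlg C n β) M] [Module (cAlg C Λ n β) M]
        [IsScalarTower k (cAlg C Λ n β) M]
        (hcomp : ∀ (r : bAlg C n β) (m : M), r • m = toC C (Λ := Λ) r • m),
        letI : Module (bAlg C (n + 1) (addA β i))
            (OT k (cAlg C Λ n β) (cAlg C Λ (n + 1) (addA β i)) M φc) :=
          Module.compHom _ (toC C (Λ := Λ) (n := n + 1) (β := addA β i)).toRingHom;
        -- `p` is induced by the projections `R(β+α_i) → R^Λ(β+α_i)`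
        (∀ (b : bAlg C (n + 1) (addA β i)) (m : M),
          p M hcomp (OTmk k (bAlg C n β) (bAlg C (n + 1) (addA β i)) M φR (b ⊗ₜ[k] m))
            = OTmk k (cAlg C Λ n β) (cAlg C Λ (n + 1) (addA β i)) M φc
                (toC C b ⊗ₜ[k] m)) ∧
        -- exactness
        Function.Injective (ι M hcomp) ∧
        Function.Surjective (p M hcomp) ∧
        LinearMap.range (ι M hcomp) = LinearMap.ker (p M hcomp) ∧
        -- gradedness: `ι` shifts degrees by `(α_i, 2Λ-β)` and `p` preserves degrees
        (∀ (grM : ℤ → Submodule k M), IsModGrading k 𝒜S grM →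
          (∀ (m : ℤ) (x : OT k (bAlg C n β) (bAlg C (n + 1) (addA β i)) M φL),
            x ∈ otGr k (bAlg C n β) (bAlg C (n + 1) (addA β i)) M φL 𝒜B grM
                (m - (2 * C.d i * (Λ i : ℤ) - pairB C i β)) →
            ι M hcomp x ∈ otGr k (bAlg C n β) (bAlg C (n + 1) (addA β i)) M φR 𝒜B grM m) ∧
          (∀ (m : ℤ) (x : OT k (bAlg C n β) (bAlg C (n + 1) (addA β i)) M φR),
            x ∈ otGr k (bAlg C n β) (bAlg C (n + 1) (addA β i)) M φR 𝒜B grM m →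
            p M hcomp x ∈ otGr k (cAlg C Λ n β) (cAlg C Λ (n + 1) (addA β i)) M φc
              𝒜D grM m)) ∧
        -- functoriality in `M`
        (∀ (M' : Type) [AddCommGroup M'] [Module k M'] [Module (bAlg C n β) M']
          [IsScalarTower k (bAlg C n β) M'] [Module (cAlg C Λ n β) M']
          [IsScalarTower k (cAlg C Λ n β) M']
          (hcomp' : ∀ (r : bAlg C n β) (m : M'), r • m = toC C (Λ := Λ) r • m)
          (f : M →ₗ[cAlg C Λ n β] M')
          (gbar : OT k (bAlg C n β) (bAlg C (n + 1) (addA β i)) M φL →ₗ[k]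
            OT k (bAlg C n β) (bAlg C (n + 1) (addA β i)) M' φL)
          (gR : OT k (bAlg C n β) (bAlg C (n + 1) (addA β i)) M φR →ₗ[k]
            OT k (bAlg C n β) (bAlg C (n + 1) (addA β i)) M' φR)
          (gc : OT k (cAlg C Λ n β) (cAlg C Λ (n + 1) (addA β i)) M φc →ₗ[k]
            OT k (cAlg C Λ n β) (cAlg C Λ (n + 1) (addA β i)) M' φc),
          (∀ (b : bAlg C (n + 1) (addA β i)) (m : M),
            gbar (OTmk k (bAlg C n β) (bAlg C (n + 1) (addA β i)) M φL (b ⊗ₜ[k] m))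
              = OTmk k (bAlg C n β) (bAlg C (n + 1) (addA β i)) M' φL (b ⊗ₜ[k] f m)) →
          (∀ (b : bAlg C (n + 1) (addA β i)) (m : M),
            gR (OTmk k (bAlg C n β) (bAlg C (n + 1) (addA β i)) M φR (b ⊗ₜ[k] m))
              = OTmk k (bAlg C n β) (bAlg C (n + 1) (addA β i)) M' φR (b ⊗ₜ[k] f m)) →
          (∀ (b : cAlg C Λ (n + 1) (addA β i)) (m : M),
            gc (OTmk k (cAlg C Λ n β) (cAlg C Λ (n + 1) (addA β i)) M φc (b ⊗ₜ[k] m))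
              = OTmk k (cAlg C Λ n β) (cAlg C Λ (n + 1) (addA β i)) M' φc
                  (b ⊗ₜ[k] f m)) →
          ((∀ z, ι M' hcomp' (gbar z) = gR (ι M hcomp z)) ∧
            (∀ z, p M' hcomp' (gR z) = gc (p M hcomp z)))) := by
  refine ⟨fun M _ _ _ _ _ _ hcomp => KLRProof.iota M hφR hφL hcomp,
    fun M _ _ _ _ _ _ hcomp => KLRProof.pmap M hφR hφc hcomp, ?_⟩
  intro M _ _ _ _ _ _ hcomp
  refine ⟨?_, KLRProof.iota_inj M hφR hφL hcomp, KLRProof.pmap_surj M hφR hφc hcomp, ?_, ?_, ?_⟩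
  · intro b m
    rw [KLRProof.OTmk_eq, KLRProof.OTmk_eq]
    exact KLRProof.pmap_mk M hφR hφc hcomp b m
  · refine le_antisymm ?_ ?_
    · rintro _ ⟨z, rfl⟩
      exact KLRProof.pmap_iota M hφR hφL hφc hcomp z
    · intro z hz
      exact KLRProof.ker_le M hφR hφL hφc hcomp z hz
  · intro grM _
    exact ⟨fun m x hx => KLRProof.iota_deg M hφR hφL hcomp h𝒜B grM m x hx,
      fun m x hx => KLRProof.pmap_deg M hφR hφc hcomp h𝒜B h𝒜D grM m x hx⟩
  · intro M' _ _ _ _ _ _ hcomp' f gbar gR gc h1 h2 h3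
    exact ⟨fun z => KLRProof.iota_nat M M' hφR hφL hcomp hcomp' f gbar gR h1 h2 z,
      fun z => KLRProof.pmap_nat M M' hφR hφc hcomp hcomp' f gR gc h2 h3 z⟩
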